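/- There exist absolute constants c, C > 0 such that for every integer k ≥ 2 and every real ε with 0 < ε ≤ c/(k log k), the constant γ_{k,ε} satisfies γ_{k,ε} ≥ 1 − (1/4)ε²(1 + C·k^{−2/13}). -/

import Mathlib

open Filter

/-- Length of a longest common subsequence of two words (words are lists of naturals). -/
noncomputable def LCSlen (w w' : List ℕ) : ℕ :=
  sSup {n | ∃ u : List ℕ, u.Sublist w ∧ u.Sublist w' ∧ u.length = n}

/-- Expected LCS length of two independent uniformly random words of lengths `n` and `m`
over the alphabet `[k] = {1, …, k}`. -/
noncomputable def expLCS (k n m : ℕ) : ℝ :=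
  (∑ u : Fin n → Fin k, ∑ v : Fin m → Fin k,
      (LCSlen (List.ofFn fun i => (u i : ℕ) + 1) (List.ofFn fun i => (v i : ℕ) + 1) : ℝ)) /
    ((k : ℝ) ^ n * (k : ℝ) ^ m)

/-- Weighted sum over words of length `n` with letters in `s`, with product weights `p`. -/
def wordSum {R : Type*} [CommSemiring R] (s : Finset ℕ) (p : ℕ → R) :
    ℕ → (List ℕ → R) → R
  | 0, f => f []
  | n + 1, f => ∑ a ∈ s, p a * wordSum s p n (fun l => f (a :: l))

section WordSum

variable {R : Type*} [CommSemiring R] {s : Finset ℕ} {p : ℕ → R}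

lemma wordSum_add (n : ℕ) (f g : List ℕ → R) :
    wordSum s p n (fun l => f l + g l) = wordSum s p n f + wordSum s p n g := by
  induction n generalizing f g with
  | zero => rfl
  | succ n ih => simp only [wordSum, ih, mul_add, Finset.sum_add_distrib]

lemma wordSum_mul_left (n : ℕ) (c : R) (f : List ℕ → R) :
    wordSum s p n (fun l => c * f l) = c * wordSum s p n f := by
  induction n generalizing f with
  | zero => rfl
  | succ n ih =>
    simp only [wordSum, ih, Finset.mul_sum]
    exact Finset.sum_congr rfl fun a _ => by ring

lemma wordSum_zero (n : ℕ) : wordSum s p n (fun _ => 0) = 0 := by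
  simpa using wordSum_mul_left (s := s) (p := p) n 0 (fun _ => 0)

lemma wordSum_sum {ι : Type*} (t : Finset ι) (n : ℕ) (f : ι → List ℕ → R) :
    wordSum s p n (fun l => ∑ i ∈ t, f i l) = ∑ i ∈ t, wordSum s p n (f i) := by
  classical
  induction t using Finset.induction_on with
  | empty => simpa using wordSum_zero n
  | insert i t hi ih => simp only [Finset.sum_insert hi, wordSum_add, ih]

lemma wordSum_congr (n : ℕ) {f g : List ℕ → R}
    (h : ∀ l : List ℕ, l.length = n → (∀ a ∈ l, a ∈ s) → f l = g l) :
    wordSum s p n f = wordSum s p n g := by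
  induction n generalizing f g with
  | zero => exact h [] rfl (by simp)
  | succ n ih =>
    refine Finset.sum_congr rfl fun a ha => ?_
    rw [ih fun l hl hs => h (a :: l) (by simp [hl]) (by simpa [ha] using hs)]

lemma wordSum_append (n m : ℕ) (f : List ℕ → R) :
    wordSum s p (n + m) f = wordSum s p n (fun l => wordSum s p m (fun l' => f (l ++ l'))) := by
  induction n generalizing f with
  | zero => simp [wordSum]
  | succ n ih =>
    rw [show n + 1 + m = n + m + 1 by omega]
    simp only [wordSum, ih, List.cons_append]

lemma wordSum_snoc (n : ℕ) (f : List ℕ → R) :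
    wordSum s p (n + 1) f = wordSum s p n (fun l => ∑ a ∈ s, p a * f (l ++ [a])) := by
  rw [wordSum_append]; rfl

lemma wordSum_succ' (n : ℕ) (f : List ℕ → R) :
    wordSum s p (n + 1) f = wordSum s p n (fun l => ∑ a ∈ s, p a * f (a :: l)) := by
  rw [wordSum_sum]
  simp only [wordSum_mul_left]
  rfl

lemma wordSum_comm {s' : Finset ℕ} {p' : ℕ → R} (n m : ℕ) (f : List ℕ → List ℕ → R) :
    wordSum s p n (fun l => wordSum s' p' m (fun l' => f l l')) =
      wordSum s' p' m (fun l' => wordSum s p n (fun l => f l l')) := by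
  induction n generalizing f with
  | zero => rfl
  | succ n ih => simp only [wordSum, ih, wordSum_sum, wordSum_mul_left]

lemma wordSum_const (hp : ∑ a ∈ s, p a = 1) (n : ℕ) (c : R) :
    wordSum s p n (fun _ => c) = c := by
  induction n with
  | zero => rfl
  | succ n ih => rw [wordSum, ih, ← Finset.sum_mul, hp, one_mul]

lemma wordSum_drop (hp : ∑ a ∈ s, p a = 1) (n m : ℕ) (f : List ℕ → R) :
    wordSum s p (n + m) (fun l => f (l.drop n)) = wordSum s p m f := by
  rw [wordSum_append]
  rw [wordSum_congr n (g := fun _ => wordSum s p m f)]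
  · exact wordSum_const hp n _
  · intro l hl _
    congr 1
    funext l'
    rw [← hl, List.drop_left]

lemma wordSum_set (hp : ∑ a ∈ s, p a = 1) (n i : ℕ) (hi : i < n) (f : List ℕ → R) :
    wordSum s p n f = wordSum s p n (fun l => ∑ a ∈ s, p a * f (l.set i a)) := by
  induction n generalizing i f with
  | zero => omega
  | succ n ih =>
    cases i with
    | zero =>
      simp only [wordSum, List.set_cons_zero, wordSum_sum, wordSum_mul_left]
      rw [← Finset.sum_mul, hp, one_mul]
    | succ i =>
      simp only [wordSum, List.set_cons_succ]
      exact Finset.sum_congr rfl fun a _ => by rw [ih i (by omega)]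

/-- Resampling the letter at a position `T` that is not affected by the value of that letter. -/
lemma wordSum_resample (hp : ∑ a ∈ s, p a = 1) (n : ℕ) (T : List ℕ → ℕ)
    (hT : ∀ l : List ℕ, l.length = n → T l < n)
    (hset : ∀ (l : List ℕ) (a : ℕ), l.length = n → T (l.set (T l) a) = T l) (f : List ℕ → R) :
    wordSum s p n f = wordSum s p n (fun l => ∑ a ∈ s, p a * f (l.set (T l) a)) := by
  classical
  have key : ∀ g : List ℕ → R, wordSum s p n g =
      ∑ t ∈ Finset.range n, wordSum s p n (fun l => if T l = t then g l else 0) := by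
    intro g
    rw [← wordSum_sum]
    refine wordSum_congr n fun l hl _ => ?_
    rw [Finset.sum_ite_eq, if_pos (Finset.mem_range.2 (hT l hl))]
  rw [key f, key]
  refine Finset.sum_congr rfl fun t ht => ?_
  rw [wordSum_set hp n t (Finset.mem_range.1 ht)]
  refine wordSum_congr n fun l hl _ => ?_
  by_cases h : T l = t
  · rw [if_pos h]
    refine Finset.sum_congr rfl fun a _ => ?_
    rw [← h, if_pos (hset l a hl)]
  · rw [if_neg h]
    refine Finset.sum_eq_zero fun a _ => ?_
    rw [if_neg, mul_zero]
    intro h'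
    apply h
    have := hset (l.set t a) (l.getD t 0) (by simpa using hl)
    rw [h', List.set_set] at this
    rwa [List.getD_eq_getElem _ _ (by rw [hl]; exact Finset.mem_range.1 ht),
      List.set_getElem_self] at this

end WordSum

section Order

variable {R : Type*} [CommSemiring R] [PartialOrder R] [IsOrderedRing R]
  {s : Finset ℕ} {p : ℕ → R}

lemma wordSum_mono (hp : ∀ a ∈ s, 0 ≤ p a) (n : ℕ) {f g : List ℕ → R}
    (h : ∀ l : List ℕ, l.length = n → (∀ a ∈ l, a ∈ s) → f l ≤ g l) :
    wordSum s p n f ≤ wordSum s p n g := by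
  induction n generalizing f g with
  | zero => exact h [] rfl (by simp)
  | succ n ih =>
    refine Finset.sum_le_sum fun a ha => mul_le_mul_of_nonneg_left ?_ (hp a ha)
    exact ih fun l hl hs => h (a :: l) (by simp [hl]) (by simpa [ha] using hs)

end Order

/-- Average over uniformly random words of length `n` over `{1, …, k}`. -/
noncomputable def wordAvg (k n : ℕ) (f : List ℕ → ℝ) : ℝ :=
  wordSum (Finset.Icc 1 k) (fun _ => (k : ℝ)⁻¹) n f

lemma sum_inv_Icc {k : ℕ} (hk : 0 < k) : ∑ _a ∈ Finset.Icc 1 k, (k : ℝ)⁻¹ = 1 := by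
  have : (k : ℝ) ≠ 0 := by positivity
  simp [this]

lemma wordAvg_sub (k n : ℕ) (f g : List ℕ → ℝ) :
    wordAvg k n (fun l => f l - g l) = wordAvg k n f - wordAvg k n g := by
  have := wordSum_add (s := Finset.Icc 1 k) (p := fun _ => (k : ℝ)⁻¹) n (fun l => f l - g l) g
  simp only [sub_add_cancel] at this
  simp only [wordAvg]; linarith

lemma wordAvg_mono (k n : ℕ) {f g : List ℕ → ℝ}
    (h : ∀ l : List ℕ, l.length = n → (∀ a ∈ l, a ∈ Finset.Icc 1 k) → f l ≤ g l) :
    wordAvg k n f ≤ wordAvg k n g :=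
  wordSum_mono (fun _ _ => by positivity) n h

lemma wordAvg_eq_sum (k n : ℕ) (f : List ℕ → ℝ) :
    wordAvg k n f = (∑ u : Fin n → Fin k, f (List.ofFn fun i => (u i : ℕ) + 1)) / (k : ℝ) ^ n := by
  induction n generalizing f with
  | zero => simp [wordAvg, wordSum]
  | succ n ih =>
    have h1 : wordAvg k (n + 1) f = ∑ a ∈ Finset.Icc 1 k,
      (k : ℝ)⁻¹ * wordAvg k n (fun l => f (a :: l)) := rfl
    have h2 : ∀ g : ℕ → ℝ, ∑ a ∈ Finset.Icc 1 k, g a = ∑ a : Fin k, g (a + 1) := by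
      intro g
      rw [Fin.sum_univ_eq_sum_range (fun i => g (i + 1)), Finset.range_eq_Ico,
        Finset.sum_Ico_add' g 0 k 1]
      rfl
    rw [h1, h2, ← (Fin.consEquiv (fun _ : Fin (n + 1) => Fin k)).sum_comp, Fintype.sum_prod_type,
      Finset.sum_div]
    refine Finset.sum_congr rfl fun a _ => ?_
    rw [ih]
    simp only [Fin.consEquiv_apply, List.ofFn_succ, Fin.cons_zero, Fin.cons_succ]
    rw [pow_succ, div_mul_eq_div_div, inv_mul_eq_div]

lemma expLCS_eq (k n m : ℕ) :
    expLCS k n m = wordAvg k n (fun w => wordAvg k m (fun v => (LCSlen w v : ℝ))) := by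
  rw [wordAvg_eq_sum]
  simp only [wordAvg_eq_sum]
  rw [expLCS, ← Finset.sum_div, div_div, mul_comm]

/-- One step of the greedy matching process with drops: `x r` is the number of matches of row `r`,
whose position in `w` is `x r + r`. -/
def stepR (w : List ℕ) (b : ℕ) (x : ℕ → ℕ) (r : ℕ) : ℕ :=
  (Finset.range (r + 1)).sup (fun q => x q + if w.getD (x q + q) 0 = b then 1 else 0)

/-- The rows of the matching process after reading the word `l`. -/
def rows (w l : List ℕ) : ℕ → ℕ := l.foldl (fun x b => stepR w b x) (fun _ => 0)

lemma rows_nil (w : List ℕ) (r : ℕ) : rows w [] r = 0 := rfl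

lemma rows_snoc (w l : List ℕ) (b : ℕ) : rows w (l ++ [b]) = stepR w b (rows w l) := by
  simp [rows]

lemma stepR_mono (w : List ℕ) (b : ℕ) (x : ℕ → ℕ) : Monotone (stepR w b x) := by
  intro r s h
  exact Finset.sup_mono (Finset.range_mono (by omega))

lemma le_stepR (w : List ℕ) (b : ℕ) (x : ℕ → ℕ) {q r : ℕ} (h : q ≤ r) :
    (x q + if w.getD (x q + q) 0 = b then 1 else 0) ≤ stepR w b x r :=
  Finset.le_sup (f := fun q => x q + if w.getD (x q + q) 0 = b then 1 else 0)
    (Finset.mem_range.2 (by omega))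

lemma self_le_stepR (w : List ℕ) (b : ℕ) (x : ℕ → ℕ) (r : ℕ) : x r ≤ stepR w b x r :=
  le_trans (Nat.le_add_right _ _) (le_stepR w b x le_rfl)

lemma stepR_le {x : ℕ → ℕ} (hx : Monotone x) (w : List ℕ) (b r : ℕ) :
    stepR w b x r ≤ x r + 1 := by
  refine Finset.sup_le fun q hq => ?_
  have := hx (Nat.lt_succ_iff.1 (Finset.mem_range.1 hq))
  split_ifs <;> omega

lemma exists_stepR (w : List ℕ) (b : ℕ) (x : ℕ → ℕ) (r : ℕ) :
    ∃ q ≤ r, stepR w b x r = x q + if w.getD (x q + q) 0 = b then 1 else 0 := by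
  obtain ⟨q, hq, h⟩ := Finset.exists_mem_eq_sup (Finset.range (r + 1)) ⟨0, by simp⟩
    (fun q => x q + if w.getD (x q + q) 0 = b then 1 else 0)
  exact ⟨q, Nat.lt_succ_iff.1 (Finset.mem_range.1 hq), h⟩

lemma rows_mono (w l : List ℕ) : Monotone (rows w l) := by
  induction l using List.reverseRecOn with
  | nil => exact fun _ _ _ => le_rfl
  | append_singleton l b _ => rw [rows_snoc]; exact stepR_mono _ _ _

lemma rows_le_length (w l : List ℕ) (r : ℕ) : rows w l r ≤ l.length := by
  induction l using List.reverseRecOn with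
  | nil => simp [rows_nil]
  | append_singleton l b ih =>
    rw [rows_snoc]
    have := stepR_le (rows_mono w l) w b r
    simp; omega

lemma rows_congr {w w' : List ℕ} (l : List ℕ) {s : ℕ}
    (h : ∀ i ≤ rows w l s + s, w.getD i 0 = w'.getD i 0) :
    ∀ q ≤ s, rows w l q = rows w' l q := by
  induction l using List.reverseRecOn with
  | nil => intro q _; rfl
  | append_singleton l b ih =>
    rw [rows_snoc] at h
    have h1 := self_le_stepR w b (rows w l) s
    have ih' := ih fun i hi => h i (by omega)
    intro q hq
    rw [rows_snoc, rows_snoc]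
    refine Finset.sup_congr rfl fun p hp => ?_
    have hp' : p ≤ s := by have := Finset.mem_range.1 hp; omega
    have := rows_mono w l hp'
    rw [← ih' p hp', ← h _ (by omega)]

lemma exists_sublist_rows (w l : List ℕ) (hl : ∀ a ∈ l, a ≠ 0) (r : ℕ) :
    ∃ u : List ℕ, u.Sublist (w.take (rows w l r + r)) ∧ u.Sublist l ∧ u.length = rows w l r := by
  induction l using List.reverseRecOn generalizing r with
  | nil => exact ⟨[], by simp, by simp, rfl⟩
  | append_singleton l b ih =>
    have hb : b ≠ 0 := hl b (by simp)
    have ih' := ih fun a ha => hl a (by simp [ha])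
    rw [rows_snoc]
    obtain ⟨q, hq, h⟩ := exists_stepR w b (rows w l) r
    obtain ⟨u, hu1, hu2, hu3⟩ := ih' q
    rw [h]
    split_ifs with hb'
    · refine ⟨u ++ [b], ?_, hu2.append (List.Sublist.refl _), by simp [hu3]⟩
      have hlt : rows w l q + q < w.length := by
        by_contra hlt
        rw [List.getD_eq_default _ _ (by omega)] at hb'
        exact hb hb'.symm
      have h2 : (u ++ [b]).Sublist (w.take (rows w l q + q + 1)) := by
        rw [List.take_add_one]
        refine hu1.append ?_
        rw [List.getElem?_eq_getElem hlt]
        rw [List.getD_eq_getElem _ _ hlt] at hb'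
        simp [hb']
      refine h2.trans (List.IsPrefix.sublist ?_)
      exact List.take_prefix_take_left (by omega)
    · refine ⟨u, hu1.trans (List.IsPrefix.sublist ?_), hu2.trans (List.sublist_append_left _ _), hu3⟩
      exact List.take_prefix_take_left (by omega)

lemma le_LCSlen {u w w' : List ℕ} (h : u.Sublist w) (h' : u.Sublist w') :
    u.length ≤ LCSlen w w' := by
  refine le_csSup ⟨w.length, ?_⟩ ⟨u, h, h', rfl⟩
  rintro n ⟨u, hu, -, rfl⟩
  exact hu.length_le

lemma exists_LCSlen (w w' : List ℕ) :
    ∃ u : List ℕ, u.Sublist w ∧ u.Sublist w' ∧ u.length = LCSlen w w' := by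
  refine Nat.sSup_mem (s := {n | ∃ u : List ℕ, u.Sublist w ∧ u.Sublist w' ∧ u.length = n})
    ⟨0, [], by simp, by simp, rfl⟩ ⟨w.length, ?_⟩
  rintro n ⟨u, hu, -, rfl⟩
  exact hu.length_le

lemma rows_add_LCSlen_le (w l v : List ℕ) (hl : ∀ a ∈ l, a ≠ 0) (r : ℕ) :
    rows w l r + LCSlen (w.drop (rows w l r + (r + 1))) v ≤ LCSlen w (l ++ v) := by
  obtain ⟨u, hu1, hu2, hu3⟩ := exists_sublist_rows w l hl r
  obtain ⟨u', hu1', hu2', hu3'⟩ := exists_LCSlen (w.drop (rows w l r + (r + 1))) v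
  rw [← hu3', ← hu3, ← List.length_append]
  refine le_LCSlen ?_ (hu2.append hu2')
  have h := (hu1.trans (List.IsPrefix.sublist (List.take_prefix_take_left
    (j := rows w l r + (r + 1)) (by omega)))).append hu1'
  rwa [List.take_append_drop] at h

/-- The strong Markov property for a stopping position `T`. -/
lemma wordSum_strongMarkov {R : Type*} [CommSemiring R] {s : Finset ℕ} {p : ℕ → R}
    (n : ℕ) (T : List ℕ → ℕ) (hT : ∀ l : List ℕ, l.length = n → T l ≤ n)
    (hloc : ∀ l l' : List ℕ, (T (l ++ l') = l.length ↔ T l = l.length))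
    (hp : ∑ a ∈ s, p a = 1) (g : ℕ → List ℕ → R) :
    wordSum s p n (fun w => g (T w) (w.drop (T w))) =
      wordSum s p n (fun w => wordSum s p (n - T w) (g (T w))) := by
  classical
  have key : ∀ g : List ℕ → R, wordSum s p n g =
      ∑ t ∈ Finset.range (n + 1), wordSum s p n (fun l => if T l = t then g l else 0) := by
    intro g
    rw [← wordSum_sum]
    refine wordSum_congr n fun l hl _ => ?_
    rw [Finset.sum_ite_eq, if_pos (Finset.mem_range.2 (by have := hT l hl; omega))]
  rw [key, key (fun w => wordSum s p (n - T w) (g (T w)))]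
  refine Finset.sum_congr rfl fun t ht => ?_
  obtain ⟨m, rfl⟩ := Nat.exists_eq_add_of_le (Nat.lt_succ_iff.1 (Finset.mem_range.1 ht))
  rw [wordSum_append, wordSum_append]
  refine wordSum_congr t fun l hl _ => ?_
  have h1 : ∀ l', (T (l ++ l') = t ↔ T l = t) := fun l' => hl ▸ hloc l l'
  by_cases h : T l = t
  · have h2 : ∀ l', T (l ++ l') = t := fun l' => (h1 l').2 h
    simp only [h2, if_true]
    rw [wordSum_const hp, Nat.add_sub_cancel_left]
    refine wordSum_congr _ fun l' _ _ => ?_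
    rw [← hl, List.drop_left]
  · have h2 : ∀ l', ¬ T (l ++ l') = t := fun l' => fun h' => h ((h1 l').1 h')
    simp only [h2, if_false]

lemma rows_append_eq_iff (l w w' : List ℕ) (r : ℕ) :
    rows (w ++ w') l r + (r + 1) = w.length ↔ rows w l r + (r + 1) = w.length := by
  constructor
  · intro h
    rw [← rows_congr (w := w ++ w') (w' := w) l (s := r) ?_ r le_rfl, h]
    intro i hi
    rw [List.getD_append _ _ _ _ (by omega)]
  · intro h
    rw [← rows_congr (w := w) (w' := w ++ w') l (s := r) ?_ r le_rfl, h]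
    intro i hi
    rw [List.getD_append _ _ _ _ (by omega)]

lemma wordAvg_const {k : ℕ} (hk : 0 < k) (n : ℕ) (c : ℝ) : wordAvg k n (fun _ => c) = c :=
  wordSum_const (sum_inv_Icc hk) n c

lemma wordAvg_congr (k n : ℕ) {f g : List ℕ → ℝ}
    (h : ∀ l : List ℕ, l.length = n → (∀ a ∈ l, a ∈ Finset.Icc 1 k) → f l = g l) :
    wordAvg k n f = wordAvg k n g := wordSum_congr n h

lemma wordAvg_add (k n : ℕ) (f g : List ℕ → ℝ) :
    wordAvg k n (fun l => f l + g l) = wordAvg k n f + wordAvg k n g := wordSum_add n f g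

lemma wordAvg_mul_left (k n : ℕ) (c : ℝ) (f : List ℕ → ℝ) :
    wordAvg k n (fun l => c * f l) = c * wordAvg k n f := wordSum_mul_left n c f

lemma wordAvg_append (k n m : ℕ) (f : List ℕ → ℝ) :
    wordAvg k (n + m) f = wordAvg k n (fun l => wordAvg k m (fun l' => f (l ++ l'))) :=
  wordSum_append n m f

lemma wordAvg_comm (k n m : ℕ) (f : List ℕ → List ℕ → ℝ) :
    wordAvg k n (fun l => wordAvg k m (fun l' => f l l')) =
      wordAvg k m (fun l' => wordAvg k n (fun l => f l l')) := wordSum_comm n m f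

lemma expLCS_nonneg (k n m : ℕ) : 0 ≤ expLCS k n m := by
  unfold expLCS; positivity

lemma expLCS_bellman {k : ℕ} (hk : 0 < k) (r J n j : ℕ) (hn : J + (r + 1) ≤ n) :
    wordAvg k n (fun w => wordAvg k J (fun l =>
      (rows w l r : ℝ) + expLCS k (n - (rows w l r + (r + 1))) j)) ≤ expLCS k n (J + j) := by
  rw [expLCS_eq]
  simp only [wordAvg_append]
  rw [wordAvg_comm, wordAvg_comm k n J]
  refine wordAvg_mono _ _ fun l hl hl' => ?_
  have hl0 : ∀ a ∈ l, a ≠ 0 := fun a ha => by have := Finset.mem_Icc.1 (hl' a ha); omega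
  calc wordAvg k n (fun w => (rows w l r : ℝ) + expLCS k (n - (rows w l r + (r + 1))) j)
      = wordAvg k n (fun w => (rows w l r : ℝ)
          + wordAvg k j (fun v => (LCSlen (w.drop (rows w l r + (r + 1))) v : ℝ))) := by
        rw [wordAvg_add, wordAvg_add]
        congr 1
        simp only [expLCS_eq]
        refine (wordSum_strongMarkov n (fun w => rows w l r + (r + 1)) ?_ ?_ (sum_inv_Icc hk)
          (fun _ w => wordAvg k j (fun v => (LCSlen w v : ℝ)))).symm
        · intro w _
          have := rows_le_length w l r
          omega
        · intro w w'
          exact rows_append_eq_iff l w w' r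
    _ ≤ _ := by
        refine wordAvg_mono _ _ fun w _ _ => ?_
        rw [← wordAvg_const hk j (rows w l r : ℝ), ← wordAvg_add]
        refine wordAvg_mono _ _ fun v _ _ => ?_
        exact_mod_cast rows_add_LCSlen_le w l v hl0 r

lemma expLCS_mono_right {k : ℕ} (hk : 0 < k) (n j i : ℕ) :
    expLCS k n j ≤ expLCS k n (j + i) := by
  rw [expLCS_eq, expLCS_eq]
  refine wordAvg_mono _ _ fun w _ _ => ?_
  rw [wordAvg_append]
  refine wordAvg_mono _ _ fun v _ _ => ?_
  rw [← wordAvg_const hk i (LCSlen w v : ℝ)]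
  refine wordAvg_mono _ _ fun v' _ _ => ?_
  obtain ⟨u, h1, h2, h3⟩ := exists_LCSlen w v
  rw [← h3]
  exact_mod_cast le_LCSlen h1 (h2.trans (List.sublist_append_left _ _))

/-- The quadratic potential step: `((a + b)⁺)² ≤ (a⁺)² + 2 a⁺ b + b²`. -/
lemma sq_posPart_add_le (a b : ℝ) :
    (max (a + b) 0) ^ 2 ≤ (max a 0) ^ 2 + 2 * max a 0 * b + b ^ 2 := by
  rcases le_total a 0 with ha | ha <;> rcases le_total (a + b) 0 with hb | hb <;>
    simp only [max_eq_left, max_eq_right, ha, hb] <;> nlinarith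

lemma expLCS_lower {k : ℕ} (hk : 0 < k) (r J : ℕ) (I : ℝ) (hI0 : 0 ≤ I)
    (hI : ∀ n, J + (r + 1) < n →
      I ≤ wordAvg k n (fun w => wordAvg k J (fun l => (rows w l r : ℝ) + (r + 1))))
    (A : ℝ) (hA : 2 * (J + (r + 1)) ≤ A) (q n : ℕ) :
    (n : ℝ) - q * (r + 1) - ((max (n - q * I) 0) ^ 2 + q * (J + (r + 1)) ^ 2) / (2 * A) - A / 2
      ≤ expLCS k n (q * J) := by
  have hI1 : I ≤ J + (r + 1) := by
    refine (hI (J + (r + 1) + 1) (Nat.lt_succ_self _)).trans ?_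
    calc _ ≤ wordAvg k (J + (r + 1) + 1) (fun w => wordAvg k J (fun l => (J : ℝ) + (r + 1))) := by
          refine wordAvg_mono _ _ fun w _ _ => wordAvg_mono _ _ fun l hl _ => ?_
          have := rows_le_length w l r
          rw [hl] at this
          have : (rows w l r : ℝ) ≤ J := by exact_mod_cast this
          linarith
      _ = _ := by rw [wordAvg_const hk, wordAvg_const hk]
  have hA0 : 0 < A := by
    have : (0 : ℝ) ≤ J + r := by positivity
    linarith
  induction q generalizing n with
  | zero =>
    refine le_trans ?_ (expLCS_nonneg _ _ _)
    have h : max ((n : ℝ) - ((0 : ℕ) : ℝ) * I) 0 = n := by simp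
    rw [h]
    have : (n : ℝ) ^ 2 / (2 * A) + A / 2 - n = (n - A) ^ 2 / (2 * A) := by field_simp; ring
    have h2 : 0 ≤ ((n : ℝ) - A) ^ 2 / (2 * A) := by positivity
    push_cast
    simp only [zero_mul, add_zero, sub_zero]
    linarith
  | succ q ih =>
    by_cases hn : J + (r + 1) < n
    · rw [show (q + 1) * J = J + q * J by ring]
      refine le_trans ?_ (expLCS_bellman hk r J n (q * J) hn.le)
      set S : ℝ := ((J : ℝ) + (r + 1)) ^ 2 with hS
      set M : ℝ := max ((n : ℝ) - ((q + 1 : ℕ) : ℝ) * I) 0 with hM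
      have hM0 : 0 ≤ M := le_max_right _ _
      have hpt : ∀ w l : List ℕ, l.length = J →
          (n : ℝ) - (q + 1) * (r + 1) - (M ^ 2 + (q + 1) * S) / (2 * A) - A / 2
            + (M / A) * ((rows w l r + (r + 1)) - I)
          ≤ (rows w l r : ℝ) + expLCS k (n - (rows w l r + (r + 1))) (q * J) := by
        intro w l hl
        have hx := rows_le_length w l r
        rw [hl] at hx
        have h := ih (n - (rows w l r + (r + 1)))
        rw [Nat.cast_sub (by omega)] at h
        push_cast at h
        have hx' : (rows w l r : ℝ) ≤ J := by exact_mod_cast hx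
        set x : ℝ := (rows w l r : ℝ) with hxd
        have hx0 : 0 ≤ x := by positivity
        have hr0 : (0 : ℝ) ≤ r := by positivity
        have e1 := sq_posPart_add_le ((n : ℝ) - ((q + 1 : ℕ) : ℝ) * I) (I - (x + (r + 1)))
        rw [show (n : ℝ) - ((q + 1 : ℕ) : ℝ) * I + (I - (x + (r + 1)))
          = n - (x + (r + 1)) - q * I by push_cast; ring, ← hM] at e1
        have e2 : (I - (x + (r + 1))) ^ 2 ≤ S := by
          rw [hS]
          apply sq_le_sq'
          · linarith
          · linarith
        have e3 : ((max (n - (x + (r + 1)) - q * I) 0) ^ 2 + q * S) / (2 * A)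
            ≤ (M ^ 2 + (q + 1) * S) / (2 * A) - (M / A) * ((x + (r + 1)) - I) := by
          have : (M ^ 2 + (q + 1) * S) / (2 * A) - (M / A) * ((x + (r + 1)) - I)
            = (M ^ 2 + (q + 1) * S + 2 * M * (I - (x + (r + 1)))) / (2 * A) := by
            field_simp; ring
          rw [this]
          refine div_le_div_of_nonneg_right ?_ (by positivity)
          linarith
        linarith
      have h1 : ∀ c d : ℝ, wordAvg k n (fun w => wordAvg k J (fun l =>
            c + d * ((rows w l r + (r + 1)) - I)))
          = c + d * (wordAvg k n (fun w => wordAvg k J (fun l => (rows w l r : ℝ) + (r + 1)))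
              - I) := by
        intro c d
        simp only [wordAvg_add, wordAvg_mul_left, wordAvg_sub, wordAvg_const hk]
      refine le_trans ?_ (wordAvg_mono _ _ fun w _ _ => wordAvg_mono _ _ fun l hl _ => hpt w l hl)
      rw [h1]
      have h2 : 0 ≤ (M / A) * (wordAvg k n (fun w => wordAvg k J
          (fun l => (rows w l r : ℝ) + (r + 1))) - I) :=
        mul_nonneg (by positivity) (by linarith [hI n hn])
      push_cast
      linarith
    · refine le_trans ?_ (expLCS_nonneg _ _ _)
      have h1 : (n : ℝ) ≤ J + (r + 1) := by
        have : n ≤ J + (r + 1) := by omega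
        exact_mod_cast this
      have h2 : (0 : ℝ) ≤ ((q + 1 : ℕ) : ℝ) * (r + 1) := by positivity
      have h3 : 0 ≤ ((max ((n : ℝ) - ((q + 1 : ℕ) : ℝ) * I) 0) ^ 2
        + ((q + 1 : ℕ) : ℝ) * (J + (r + 1)) ^ 2) / (2 * A) := by positivity
      linarith

/-- Renewal lower bound: if on average reading `J` letters advances row `r` by at least
`J / ((1 - ε) k)`, then the limiting constant is at least `1 - (1 - ε) k (r + 1) / J`. -/
lemma gamma_lower {k : ℕ} (hk : 0 < k) (r J : ℕ) (hJ : 0 < J) (I : ℝ) (hI0 : 0 ≤ I)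
    (hI : ∀ n, J + (r + 1) < n →
      I ≤ wordAvg k n (fun w => wordAvg k J (fun l => (rows w l r : ℝ) + (r + 1))))
    {ε : ℝ} (hε0 : 0 ≤ ε) (hε : ε ≤ 1) (hJI : (J : ℝ) ≤ (1 - ε) * k * I) {γ : ℝ}
    (hγ : Tendsto (fun n : ℕ => expLCS k n ⌊(1 - ε) * k * n⌋₊ / n) atTop (nhds γ)) :
    1 - (1 - ε) * k * (r + 1) / J ≤ γ := by
  set S : ℝ := ((J : ℝ) + (r + 1)) ^ 2 with hS
  have hJ' : (0 : ℝ) < J := by exact_mod_cast hJ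
  have hk' : (0 : ℝ) < k := by exact_mod_cast hk
  have hsq : Tendsto (fun n : ℕ => Real.sqrt n) atTop atTop :=
    Real.tendsto_sqrt_atTop.comp tendsto_natCast_atTop_atTop
  have hlim : Tendsto (fun n : ℕ => 1 - (1 - ε) * k * (r + 1) / J
      - ((I ^ 2 + k * S + 1) / 2) / Real.sqrt n) atTop
      (nhds (1 - (1 - ε) * k * (r + 1) / J - 0)) :=
    tendsto_const_nhds.sub (hsq.const_div_atTop _)
  rw [sub_zero] at hlim
  refine le_of_tendsto_of_tendsto hlim hγ ?_
  filter_upwards [hsq.eventually_ge_atTop (2 * (J + (r + 1))), eventually_ge_atTop 1] with n hn hn1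
  have hn0 : (1 : ℝ) ≤ n := by exact_mod_cast hn1
  set A := Real.sqrt n with hA
  have hA1 : 1 ≤ A := Real.one_le_sqrt.2 hn0
  have hAn : A * A = n := Real.mul_self_sqrt (by linarith)
  set M := ⌊(1 - ε) * k * n⌋₊ with hM
  have hMle : (M : ℝ) ≤ (1 - ε) * k * n := Nat.floor_le (by
    have : 0 ≤ 1 - ε := by linarith
    positivity)
  have hMlt : (1 - ε) * k * n < M + 1 := Nat.lt_floor_add_one _
  have h1 := expLCS_lower hk r J I hI0 hI A hn (M / J) n
  have h2 : expLCS k n (M / J * J) ≤ expLCS k n M := by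
    conv_rhs => rw [← Nat.div_add_mod' M J]
    exact expLCS_mono_right hk n _ _
  have h3 : ((M / J : ℕ) : ℝ) ≤ (1 - ε) * k * n / J :=
    Nat.cast_div_le.trans (by gcongr)
  have h4 : (n : ℝ) - ((M / J : ℕ) : ℝ) * I ≤ I := by
    have h5 : M + 1 ≤ (M / J + 1) * J := by
      have := Nat.lt_div_mul_add (a := M) hJ
      rw [add_mul]; omega
    have h5' : (M : ℝ) + 1 ≤ (((M / J : ℕ) : ℝ) + 1) * J := by exact_mod_cast h5
    have h6 : (n : ℝ) * J ≤ (((M / J : ℕ) : ℝ) + 1) * I * J := by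
      calc (n : ℝ) * J ≤ n * ((1 - ε) * k * I) := by gcongr
        _ = ((1 - ε) * k * n) * I := by ring
        _ ≤ ((((M / J : ℕ) : ℝ) + 1) * J) * I :=
          mul_le_mul_of_nonneg_right (by linarith) hI0
        _ = _ := by ring
    have h7 := le_of_mul_le_mul_right h6 hJ'
    linarith
  have h5 : (max ((n : ℝ) - ((M / J : ℕ) : ℝ) * I) 0) ^ 2 ≤ I ^ 2 := by
    have : max ((n : ℝ) - ((M / J : ℕ) : ℝ) * I) 0 ≤ I := max_le h4 hI0
    gcongr
  rw [le_div_iff₀ (by linarith)]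
  refine le_trans ?_ (h1.trans h2)
  rw [← hS]
  have h6 : ((M / J : ℕ) : ℝ) * S ≤ k * n * S := by
    have : ((M / J : ℕ) : ℝ) ≤ k * n := by
      refine h3.trans ?_
      rw [div_le_iff₀ hJ']
      have hJ1 : (1 : ℝ) ≤ J := by exact_mod_cast hJ
      calc (1 - ε) * k * n ≤ 1 * k * n := by gcongr; linarith
        _ = k * n * 1 := by ring
        _ ≤ k * n * J := by gcongr
    gcongr
  have h7 : ((max ((n : ℝ) - ((M / J : ℕ) : ℝ) * I) 0) ^ 2 + ((M / J : ℕ) : ℝ) * S) / (2 * A)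
      ≤ (I ^ 2 + k * S) * A / 2 := by
    rw [div_le_iff₀ (by positivity)]
    have : I ^ 2 ≤ I ^ 2 * n := le_mul_of_one_le_right (by positivity) hn0
    calc _ ≤ I ^ 2 * n + k * n * S := by linarith
      _ = _ := by rw [← hAn]; ring
  have h8 : ((M / J : ℕ) : ℝ) * (r + 1) ≤ (1 - ε) * k * (r + 1) / J * n := by
    calc _ ≤ (1 - ε) * k * n / J * (r + 1) := by gcongr
      _ = _ := by ring
  have h9 : (I ^ 2 + k * S + 1) / 2 / A * n = (I ^ 2 + k * S) * A / 2 + A / 2 := by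
    rw [← hAn]; field_simp
  rw [sub_mul, sub_mul, h9]
  linarith

/-- Average of a function of `w` and of the rows after reading `j` random letters. -/
noncomputable def rowAvg (k n j : ℕ) (f : List ℕ → (ℕ → ℕ) → ℝ) : ℝ :=
  wordAvg k n (fun w => wordAvg k j (fun l => f w (rows w l)))

/-- Average over the next letter. -/
noncomputable def nextAvg (k : ℕ) (f : List ℕ → (ℕ → ℕ) → ℝ) (w : List ℕ) (x : ℕ → ℕ) : ℝ :=
  ∑ b ∈ Finset.Icc 1 k, (k : ℝ)⁻¹ * f w (stepR w b x)

lemma rowAvg_succ (k n j : ℕ) (f : List ℕ → (ℕ → ℕ) → ℝ) :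
    rowAvg k n (j + 1) f = rowAvg k n j (nextAvg k f) := by
  unfold rowAvg nextAvg wordAvg
  simp only [wordSum_snoc, rows_snoc]

lemma rowAvg_zero (k n : ℕ) (f : List ℕ → (ℕ → ℕ) → ℝ) :
    rowAvg k n 0 f = wordAvg k n (fun w => f w (fun _ => 0)) := rfl

lemma rowAvg_const {k : ℕ} (hk : 0 < k) (n j : ℕ) (c : ℝ) :
    rowAvg k n j (fun _ _ => c) = c := by
  simp only [rowAvg, wordAvg_const hk]

lemma rowAvg_add (k n j : ℕ) (f g : List ℕ → (ℕ → ℕ) → ℝ) :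
    rowAvg k n j (fun w x => f w x + g w x) = rowAvg k n j f + rowAvg k n j g := by
  simp only [rowAvg, wordAvg_add]

lemma rowAvg_sub (k n j : ℕ) (f g : List ℕ → (ℕ → ℕ) → ℝ) :
    rowAvg k n j (fun w x => f w x - g w x) = rowAvg k n j f - rowAvg k n j g := by
  simp only [rowAvg, wordAvg_sub]

lemma rowAvg_mul_left (k n j : ℕ) (c : ℝ) (f : List ℕ → (ℕ → ℕ) → ℝ) :
    rowAvg k n j (fun w x => c * f w x) = c * rowAvg k n j f := by
  simp only [rowAvg, wordAvg_mul_left]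

lemma rowAvg_sum {ι : Type*} (t : Finset ι) (k n j : ℕ) (f : ι → List ℕ → (ℕ → ℕ) → ℝ) :
    rowAvg k n j (fun w x => ∑ i ∈ t, f i w x) = ∑ i ∈ t, rowAvg k n j (f i) := by
  simp only [rowAvg, wordAvg, wordSum_sum]

lemma rowAvg_mono (k n j : ℕ) {f g : List ℕ → (ℕ → ℕ) → ℝ}
    (h : ∀ (w : List ℕ) (x : ℕ → ℕ), w.length = n → (∀ a ∈ w, a ∈ Finset.Icc 1 k) →
      Monotone x → (∀ r, x r ≤ j) → f w x ≤ g w x) :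
    rowAvg k n j f ≤ rowAvg k n j g :=
  wordAvg_mono _ _ fun w hw hw' => wordAvg_mono _ _ fun l hl _ =>
    h w _ hw hw' (rows_mono w l) fun r => hl ▸ rows_le_length w l r

lemma rowAvg_congr (k n j : ℕ) {f g : List ℕ → (ℕ → ℕ) → ℝ}
    (h : ∀ (w : List ℕ) (x : ℕ → ℕ), w.length = n → (∀ a ∈ w, a ∈ Finset.Icc 1 k) →
      Monotone x → (∀ r, x r ≤ j) → f w x = g w x) :
    rowAvg k n j f = rowAvg k n j g :=
  wordAvg_congr _ _ fun w hw hw' => wordAvg_congr _ _ fun l hl _ =>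
    h w _ hw hw' (rows_mono w l) fun r => hl ▸ rows_le_length w l r

lemma getD_set_of_ne {w : List ℕ} {i T a : ℕ} (h : i ≠ T) :
    (w.set T a).getD i 0 = w.getD i 0 := by
  simp [List.getD_eq_getElem?_getD, List.getElem?_set_ne h.symm]

lemma getD_set_self {w : List ℕ} {T a : ℕ} (h : T < w.length) :
    (w.set T a).getD T 0 = a := by
  simp [List.getD_eq_getElem?_getD, h]

lemma getD_mem_Icc {w : List ℕ} {k i : ℕ} (hw : ∀ a ∈ w, a ∈ Finset.Icc 1 k) (h : i < w.length) :
    w.getD i 0 ∈ Finset.Icc 1 k := by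
  rw [List.getD_eq_getElem _ _ h]; exact hw _ (List.getElem_mem h)

/-- The letter after the position of row `s` is fresh. -/
lemma rowAvg_fresh {k : ℕ} (hk : 0 < k) (n j s : ℕ) (hn : j + s + 1 < n)
    (f : List ℕ → (ℕ → ℕ) → ℝ)
    (hf : ∀ w x y, (∀ q ≤ s, x q = y q) → f w x = f w y) :
    rowAvg k n j f = rowAvg k n j (fun w x =>
      ∑ a ∈ Finset.Icc 1 k, (k : ℝ)⁻¹ * f (w.set (x s + s + 1) a) x) := by
  unfold rowAvg
  rw [wordAvg_comm, wordAvg_comm k n j]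
  refine wordAvg_congr _ _ fun l hl _ => ?_
  have hset : ∀ (w : List ℕ) (a : ℕ), ∀ q ≤ s,
      rows w l q = rows (w.set (rows w l s + s + 1) a) l q := by
    intro w a
    refine rows_congr l fun i hi => ?_
    rw [getD_set_of_ne (by omega)]
  unfold wordAvg
  rw [wordSum_resample (sum_inv_Icc hk) n (fun w => rows w l s + s + 1)]
  · refine wordSum_congr _ fun w _ _ => Finset.sum_congr rfl fun a _ => ?_
    rw [hf _ _ (rows w l) fun q hq => (hset w a q hq).symm]
  · intro w _
    have := rows_le_length w l s
    omega
  · intro w a _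
    simp only [← hset w a s le_rfl]

/-- Discounted count of the letter `c` in `w` on the window of length `d` starting at `i`. -/
noncomputable def pot (w : List ℕ) (c : ℕ) : ℕ → ℕ → ℝ
  | _, 0 => 0
  | i, d + 1 => (if w.getD i 0 = c then 1 else 0) + pot w c (i + 1) d / 2

lemma pot_nonneg (w : List ℕ) (c i d : ℕ) : 0 ≤ pot w c i d := by
  induction d generalizing i with
  | zero => exact le_rfl
  | succ d ih =>
    have := ih (i + 1)
    unfold pot
    split_ifs <;> linarith

lemma pot_le_two (w : List ℕ) (c i d : ℕ) : pot w c i d ≤ 2 := by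
  induction d generalizing i with
  | zero => simp [pot]
  | succ d ih =>
    have := ih (i + 1)
    unfold pot
    split_ifs <;> linarith

lemma pot_set (w : List ℕ) (c i d T a : ℕ) (h : i + d ≤ T) :
    pot (w.set T a) c i d = pot w c i d := by
  induction d generalizing i with
  | zero => rfl
  | succ d ih => unfold pot; rw [ih _ (by omega), getD_set_of_ne (by omega)]

lemma sum_pot_le (w : List ℕ) (k i d : ℕ) : ∑ c ∈ Finset.Icc 1 k, pot w c i d ≤ 2 := by
  induction d generalizing i with
  | zero => simp [pot]
  | succ d ih =>
    unfold pot
    rw [Finset.sum_add_distrib, Finset.sum_ite_eq, ← Finset.sum_div]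
    have := ih (i + 1)
    split_ifs <;> linarith

/-- The letter that row `r` is waiting for. -/
def rowLetter (w : List ℕ) (x : ℕ → ℕ) (r : ℕ) : ℕ := w.getD (x r + r) 0

/-- Indicator that rows `r` and `s` are waiting for the same letter. -/
def conf (r s : ℕ) (w : List ℕ) (x : ℕ → ℕ) : ℝ :=
  if rowLetter w x r = rowLetter w x s then 1 else 0

/-- Potential controlling the conflicts of rows `r` and `s`. -/
noncomputable def rowPot (r s : ℕ) (w : List ℕ) (x : ℕ → ℕ) : ℝ :=
  pot w (rowLetter w x s) (x r + r) (x s + s - (x r + r))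

/-- Advance of row `r`, as a real number. -/
def adv (r : ℕ) (w : List ℕ) (b : ℕ) (x : ℕ → ℕ) : ℝ := stepR w b x r - x r

/-- Advance of row `r` in excess of its own matches. -/
def push (r : ℕ) (w : List ℕ) (b : ℕ) (x : ℕ → ℕ) : ℝ :=
  adv r w b x - if rowLetter w x r = b then 1 else 0

lemma push_nonneg (r : ℕ) (w : List ℕ) (b : ℕ) (x : ℕ → ℕ) : 0 ≤ push r w b x := by
  have h := le_stepR w b x (le_refl r)
  unfold push adv rowLetter
  have h' : ((x r + if w.getD (x r + r) 0 = b then 1 else 0 : ℕ) : ℝ) ≤ stepR w b x r := by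
    exact_mod_cast h
  push_cast at h'
  linarith

lemma rowPot_step_of_eq {r s : ℕ} (hrs : r < s) (w : List ℕ) (b : ℕ) {x : ℕ → ℕ}
    (hx : Monotone x) (hs : stepR w b x s = x s) :
    rowPot r s w (stepR w b x) ≤ (1 - if rowLetter w x s = b then 1 else 0) * rowPot r s w x
      + (if rowLetter w x r = b then 1 else 0) * (1 - conf r s w x) * rowPot r s w x
      + 2 * push r w b x := by
  have hg0 := pot_nonneg w (rowLetter w x s) (x r + r) (x s + s - (x r + r))
  have hg2 := pot_le_two w (rowLetter w x s) (x r + r) (x s + s - (x r + r))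
  have hsb : rowLetter w x s ≠ b := by
    intro h
    have := le_stepR w b x (le_refl s)
    unfold rowLetter at h
    rw [if_pos h] at this
    omega
  have hp := push_nonneg r w b x
  have hls : rowLetter w (stepR w b x) s = rowLetter w x s := by unfold rowLetter; rw [hs]
  have hm := hx hrs.le
  have h1 := self_le_stepR w b x r
  have h2 := stepR_le hx w b r
  have h3 := stepR_mono w b x hrs.le
  rw [if_neg hsb]
  unfold rowPot
  rw [hls, hs]
  rcases Nat.lt_or_ge (x r) (stepR w b x r) with h | h
  · have hr : stepR w b x r = x r + 1 := by omega
    obtain ⟨d, hd⟩ : ∃ d, x s + s - (x r + r) = d + 1 := ⟨x s + s - (x r + r) - 1, by omega⟩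
    have hd' : x s + s - (x r + 1 + r) = d := by omega
    rw [hr, hd']
    rw [hd] at hg0 hg2 ⊢
    have e : pot w (rowLetter w x s) (x r + r) (d + 1)
      = conf r s w x + pot w (rowLetter w x s) (x r + 1 + r) d / 2 := by
      rw [pot, show x r + r + 1 = x r + 1 + r by ring]; rfl
    set g := pot w (rowLetter w x s) (x r + r) (d + 1)
    set g' := pot w (rowLetter w x s) (x r + 1 + r) d
    have hadv : adv r w b x = 1 := by unfold adv; rw [hr]; push_cast; ring
    by_cases hrb : rowLetter w x r = b
    · have hc : conf r s w x = 0 := by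
        unfold conf; rw [if_neg]; rw [hrb]; exact fun h => hsb h.symm
      rw [hc] at e ⊢
      simp only [hrb, if_true]
      linarith
    · have hpu : push r w b x = 1 := by unfold push; rw [hadv, if_neg hrb]; ring
      rw [if_neg hrb, hpu]
      have : 0 ≤ conf r s w x := by unfold conf; split_ifs <;> norm_num
      linarith
  · have hr : stepR w b x r = x r := by omega
    rw [hr]
    have : (0:ℝ) ≤ (if rowLetter w x r = b then 1 else 0) * (1 - conf r s w x) *
        pot w (rowLetter w x s) (x r + r) (x s + s - (x r + r)) := by
      refine mul_nonneg (mul_nonneg (by split_ifs <;> norm_num) ?_) hg0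
      unfold conf; split_ifs <;> norm_num
    linarith

lemma stepR_congr {s b : ℕ} {w w' : List ℕ} {x y : ℕ → ℕ} (h : ∀ q ≤ s, x q = y q)
    (h' : ∀ q ≤ s, w.getD (x q + q) 0 = w'.getD (x q + q) 0) :
    ∀ q ≤ s, stepR w b x q = stepR w' b y q := by
  intro q hq
  refine Finset.sup_congr rfl fun p hp => ?_
  have hp' : p ≤ s := by have := Finset.mem_range.1 hp; omega
  rw [← h p hp', h' p hp']

/-- Contribution to the next potential from steps in which row `s` advances. -/
noncomputable def jumpPot (k r s : ℕ) (w : List ℕ) (x : ℕ → ℕ) : ℝ :=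
  ∑ b ∈ Finset.Icc 1 k, (k : ℝ)⁻¹ *
    ((if stepR w b x s = x s then 0 else 1) * rowPot r s w (stepR w b x))

lemma rowAvg_jumpPot_le {k : ℕ} (hk : 0 < k) (n j : ℕ) {r s : ℕ} (hrs : r < s)
    (hn : j + s + 1 < n) :
    rowAvg k n j (jumpPot k r s) ≤
      (2 / k) * rowAvg k n j (fun w x => ∑ b ∈ Finset.Icc 1 k, (k : ℝ)⁻¹ * adv s w b x) := by
  have hk' : (0 : ℝ) < k := by exact_mod_cast hk
  rw [rowAvg_fresh hk n j s hn, ← rowAvg_mul_left]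
  · refine rowAvg_mono _ _ _ fun w x hw _ hx hxj => ?_
    unfold jumpPot
    simp only [Finset.mul_sum]
    rw [Finset.sum_comm]
    refine Finset.sum_le_sum fun b _ => ?_
    have hT : x s + s + 1 < w.length := by have := hxj s; omega
    have hst : ∀ a, ∀ q ≤ s, stepR w b x q = stepR (w.set (x s + s + 1) a) b x q := by
      intro a
      refine stepR_congr (fun _ _ => rfl) fun q hq => ?_
      have := hx hq
      rw [getD_set_of_ne (by omega)]
    simp only [← hst _ s le_rfl]
    have h1 := self_le_stepR w b x s
    have h2 := stepR_le hx w b s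
    by_cases hs : stepR w b x s = x s
    · simp [hs, adv]
    · have hs' : stepR w b x s = x s + 1 := by omega
      have hr := stepR_mono w b x hrs.le
      have e : ∀ a, rowPot r s (w.set (x s + s + 1) a) (stepR (w.set (x s + s + 1) a) b x)
          = pot w a (stepR w b x r + r) (x s + s + 1 - (stepR w b x r + r)) := by
        intro a
        unfold rowPot rowLetter
        rw [← hst a s le_rfl, ← hst a r hrs.le, hs', show x s + 1 + s = x s + s + 1 by ring,
          getD_set_self hT, pot_set]
        omega
      simp only [e, if_neg hs, one_mul]
      have hadv : adv s w b x = 1 := by unfold adv; rw [hs']; push_cast; ring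
      rw [hadv, ← Finset.mul_sum, ← Finset.mul_sum]
      have := sum_pot_le w k (stepR w b x r + r) (x s + s + 1 - (stepR w b x r + r))
      calc _ ≤ (k : ℝ)⁻¹ * ((k : ℝ)⁻¹ * 2) := by gcongr
        _ = _ := by ring
  · intro w x y hxy
    unfold jumpPot
    refine Finset.sum_congr rfl fun b _ => ?_
    have := stepR_congr (b := b) (w := w) (w' := w) hxy fun _ _ => rfl
    unfold rowPot rowLetter
    rw [this s le_rfl, this r hrs.le, hxy s le_rfl]

lemma nextAvg_row {k : ℕ} (hk : 0 < k) (r : ℕ) (w : List ℕ) (x : ℕ → ℕ) :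
    nextAvg k (fun _ x => (x r : ℝ)) w x
      = x r + ∑ b ∈ Finset.Icc 1 k, (k : ℝ)⁻¹ * adv r w b x := by
  unfold nextAvg adv
  simp only [mul_sub, Finset.sum_sub_distrib]
  rw [← Finset.sum_mul, sum_inv_Icc hk]
  ring

lemma sum_ite_letter {k a : ℕ} (ha : a ∈ Finset.Icc 1 k) (c : ℝ) :
    ∑ b ∈ Finset.Icc 1 k, (k : ℝ)⁻¹ * ((if a = b then 1 else 0) * c) = (k : ℝ)⁻¹ * c := by
  simp only [ite_mul, one_mul, zero_mul, mul_ite, mul_zero]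
  rw [Finset.sum_ite_eq, if_pos ha]

lemma conf_nonneg (r s : ℕ) (w : List ℕ) (x : ℕ → ℕ) : 0 ≤ conf r s w x := by
  unfold conf; split_ifs <;> norm_num

lemma nextAvg_rowPot_le {k : ℕ} (hk : 0 < k) {r s : ℕ} (hrs : r < s) (w : List ℕ) {x : ℕ → ℕ}
    (hw : ∀ a ∈ w, a ∈ Finset.Icc 1 k) (hx : Monotone x) (hxs : x s + s < w.length) :
    nextAvg k (rowPot r s) w x ≤ rowPot r s w x - (k : ℝ)⁻¹ * conf r s w x
      + 2 * ((∑ b ∈ Finset.Icc 1 k, (k : ℝ)⁻¹ * adv r w b x) - (k : ℝ)⁻¹) + jumpPot k r s w x := by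
  have hk' : (0 : ℝ) < k := by exact_mod_cast hk
  have hm := hx hrs.le
  have hr : rowLetter w x r ∈ Finset.Icc 1 k := getD_mem_Icc hw (by omega)
  have hs : rowLetter w x s ∈ Finset.Icc 1 k := getD_mem_Icc hw (by omega)
  set g := rowPot r s w x with hg
  have hg0 : 0 ≤ g := pot_nonneg _ _ _ _
  set c := conf r s w x with hc
  have hc0 : 0 ≤ c := conf_nonneg _ _ _ _
  have hc1 : c ≤ 1 := by rw [hc]; unfold conf; split_ifs <;> norm_num
  have hcg : c ≤ c * g := by
    rw [hc]; unfold conf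
    split_ifs with h
    · obtain ⟨d, hd⟩ : ∃ d, x s + s - (x r + r) = d + 1 := ⟨x s + s - (x r + r) - 1, by omega⟩
      have : g = 1 + pot w (rowLetter w x s) (x r + r + 1) d / 2 := by
        rw [hg]; unfold rowPot; rw [hd, pot]; unfold rowLetter at h ⊢; rw [if_pos h]
      have h2 := pot_nonneg w (rowLetter w x s) (x r + r + 1) d
      linarith
    · simp
  have hpt : ∀ b ∈ Finset.Icc 1 k, (k : ℝ)⁻¹ * rowPot r s w (stepR w b x) ≤
      (k : ℝ)⁻¹ * g - (k : ℝ)⁻¹ * ((if rowLetter w x s = b then 1 else 0) * g)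
      + (k : ℝ)⁻¹ * ((if rowLetter w x r = b then 1 else 0) * ((1 - c) * g))
      + 2 * ((k : ℝ)⁻¹ * adv r w b x - (k : ℝ)⁻¹ * ((if rowLetter w x r = b then 1 else 0) * 1))
      + (k : ℝ)⁻¹ *
    ((if stepR w b x s = x s then 0 else 1) * rowPot r s w (stepR w b x)) := by
    intro b _
    have hp := push_nonneg r w b x
    have key : rowPot r s w (stepR w b x) ≤
      (1 - if rowLetter w x s = b then 1 else 0) * g
      + (if rowLetter w x r = b then 1 else 0) * (1 - c) * g
      + 2 * push r w b x
      + (if stepR w b x s = x s then 0 else 1) * rowPot r s w (stepR w b x) := by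
      by_cases h : stepR w b x s = x s
      · rw [if_pos h]
        have := rowPot_step_of_eq hrs w b hx h
        linarith
      · rw [if_neg h]
        have e1 : 0 ≤ (1 - if rowLetter w x s = b then 1 else 0) * g :=
          mul_nonneg (by split_ifs <;> norm_num) hg0
        have e2 : 0 ≤ (if rowLetter w x r = b then 1 else 0) * (1 - c) * g :=
          mul_nonneg (mul_nonneg (by split_ifs <;> norm_num) (by linarith)) hg0
        linarith
    have := mul_le_mul_of_nonneg_left key (inv_nonneg.2 hk'.le)
    unfold push at this
    refine this.trans (le_of_eq ?_)
    ring
  unfold nextAvg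
  refine (Finset.sum_le_sum hpt).trans ?_
  have e1 : ∑ _b ∈ Finset.Icc 1 k, (k : ℝ)⁻¹ * g = g := by
    rw [← Finset.sum_mul, sum_inv_Icc hk, one_mul]
  have e2 : ∑ b ∈ Finset.Icc 1 k, 2 * ((k : ℝ)⁻¹ * adv r w b x
      - (k : ℝ)⁻¹ * ((if rowLetter w x r = b then 1 else 0) * 1))
      = 2 * ((∑ b ∈ Finset.Icc 1 k, (k : ℝ)⁻¹ * adv r w b x) - (k : ℝ)⁻¹) := by
    rw [← Finset.mul_sum, Finset.sum_sub_distrib, sum_ite_letter hr, mul_one]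
  rw [Finset.sum_add_distrib, Finset.sum_add_distrib, Finset.sum_add_distrib,
    Finset.sum_sub_distrib, sum_ite_letter hs, sum_ite_letter hr, e1, e2]
  unfold jumpPot
  have : (k : ℝ)⁻¹ * c ≤ (k : ℝ)⁻¹ * (c * g) := by gcongr
  linarith

lemma rowAvg_conf_le {k : ℕ} (hk : 0 < k) (n j : ℕ) {r s : ℕ} (hrs : r < s)
    (hn : j + s + 1 < n) :
    (k : ℝ)⁻¹ * rowAvg k n j (conf r s) ≤
      rowAvg k n j (rowPot r s) - rowAvg k n (j + 1) (rowPot r s)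
      + 2 * (rowAvg k n (j + 1) (fun _ x => (x r : ℝ)) - rowAvg k n j (fun _ x => (x r : ℝ))
          - (k : ℝ)⁻¹)
      + (2 / k) * (rowAvg k n (j + 1) (fun _ x => (x s : ℝ))
          - rowAvg k n j (fun _ x => (x s : ℝ))) := by
  have h1 := rowAvg_jumpPot_le hk n j hrs hn
  have h2 : rowAvg k n j (nextAvg k (rowPot r s)) ≤ rowAvg k n j (fun w x =>
      rowPot r s w x - (k : ℝ)⁻¹ * conf r s w x
      + 2 * ((∑ b ∈ Finset.Icc 1 k, (k : ℝ)⁻¹ * adv r w b x) - (k : ℝ)⁻¹) + jumpPot k r s w x) := by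
    refine rowAvg_mono _ _ _ fun w x hw hw' hx hxj => nextAvg_rowPot_le hk hrs w hw' hx ?_
    have := hxj s; omega
  have h3 : ∀ r, rowAvg k n (j + 1) (fun _ x => (x r : ℝ)) = rowAvg k n j (fun _ x => (x r : ℝ)) +
      rowAvg k n j (fun w x => ∑ b ∈ Finset.Icc 1 k, (k : ℝ)⁻¹ * adv r w b x) := by
    intro r
    rw [rowAvg_succ, ← rowAvg_add]
    exact rowAvg_congr _ _ _ fun w x _ _ _ _ => nextAvg_row hk r w x
  rw [← rowAvg_succ] at h2
  simp only [rowAvg_add, rowAvg_sub, rowAvg_mul_left, rowAvg_const hk] at h2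
  rw [h3, h3]
  have : 2 / (k : ℝ) * (rowAvg k n j (fun _ x => (x s : ℝ)) + rowAvg k n j
      (fun w x => ∑ b ∈ Finset.Icc 1 k, (k : ℝ)⁻¹ * adv s w b x) -
      rowAvg k n j (fun _ x => (x s : ℝ))) = 2 / (k : ℝ) * rowAvg k n j
      (fun w x => ∑ b ∈ Finset.Icc 1 k, (k : ℝ)⁻¹ * adv s w b x) := by ring
  rw [this]
  linarith

lemma sum_rowAvg_conf_le {k : ℕ} (hk : 0 < k) (n J : ℕ) {r s : ℕ} (hrs : r < s)
    (hn : J + s + 1 < n) :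
    ∑ j ∈ Finset.range J, rowAvg k n j (conf r s) ≤
      2 * k + 2 * J / k + (2 * k + 2) * (rowAvg k n J (fun _ x => (x s : ℝ)) - J / k) := by
  have hk' : (0 : ℝ) < k := by exact_mod_cast hk
  have h1 : ∑ j ∈ Finset.range J, (k : ℝ)⁻¹ * rowAvg k n j (conf r s) ≤ _ :=
    Finset.sum_le_sum fun j hj =>
      rowAvg_conf_le hk n j hrs (by have := Finset.mem_range.1 hj; omega)
  rw [Finset.sum_add_distrib, Finset.sum_add_distrib, ← Finset.mul_sum, ← Finset.mul_sum,
    ← Finset.mul_sum, Finset.sum_range_sub', Finset.sum_sub_distrib,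
    Finset.sum_range_sub (fun j => rowAvg k n j (fun _ x => (x r : ℝ))),
    Finset.sum_range_sub (fun j => rowAvg k n j (fun _ x => (x s : ℝ)))] at h1
  have h0 : ∀ r, rowAvg k n 0 (fun _ x => (x r : ℝ)) = 0 := by
    intro r
    rw [rowAvg_zero]
    simpa using wordAvg_const hk n 0
  have h2 : rowAvg k n 0 (rowPot r s) ≤ 2 := by
    rw [← rowAvg_const hk n 0 2]
    exact rowAvg_mono _ _ _ fun w x _ _ _ _ => pot_le_two _ _ _ _
  have h3 : 0 ≤ rowAvg k n J (rowPot r s) := by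
    rw [← rowAvg_const hk n J 0]
    exact rowAvg_mono _ _ _ fun w x _ _ _ _ => pot_nonneg _ _ _ _
  have h4 : rowAvg k n J (fun _ x => (x r : ℝ)) ≤ rowAvg k n J (fun _ x => (x s : ℝ)) :=
    rowAvg_mono _ _ _ fun w x _ _ hx _ => by exact_mod_cast hx hrs.le
  rw [h0, h0] at h1
  simp only [Finset.sum_const, Finset.card_range, nsmul_eq_mul, sub_zero] at h1
  set S := ∑ j ∈ Finset.range J, rowAvg k n j (conf r s)
  set P := rowAvg k n J (fun _ x => (x s : ℝ))
  have h5 : (k : ℝ)⁻¹ * S ≤ 2 + 2 * (P - J * (k : ℝ)⁻¹) + 2 / k * P := by linarith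
  have h6 := mul_le_mul_of_nonneg_left h5 hk'.le
  rw [mul_inv_cancel_left₀ hk'.ne'] at h6
  refine h6.trans (le_of_eq ?_)
  field_simp
  ring

/-- `idl m l r` is the length of the longest weakly increasing subsequence of `l` with letters
in `[r, m]`. -/
def idl (m : ℕ) : List ℕ → ℕ → ℕ
  | [], _ => 0
  | a :: l, r => if r ≤ a ∧ a ≤ m then max (idl m l r) (1 + idl m l a) else idl m l r

/-- Pairing of a profile of rows with a word of the idealised process. -/
def brk (m : ℕ) (y : ℕ → ℕ) (l : List ℕ) : ℕ :=
  (Finset.range m).sup (fun r => y r + idl m l (r + 1))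

lemma le_brk {m r : ℕ} (h : r < m) (y : ℕ → ℕ) (l : List ℕ) :
    y r + idl m l (r + 1) ≤ brk m y l :=
  Finset.le_sup (f := fun r => y r + idl m l (r + 1)) (Finset.mem_range.2 h)

/-- Rows attaining the maximum in `brk`. -/
def argRows (m : ℕ) (y : ℕ → ℕ) (l : List ℕ) : Finset ℕ :=
  (Finset.range m).filter (fun r => y r + idl m l (r + 1) = brk m y l)

lemma brk_cons_le {m : ℕ} {y : ℕ → ℕ} (hy : Monotone y) (a : ℕ) (ha : 1 ≤ a) (l : List ℕ) :
    brk m y (a :: l) ≤ brk m y l + if a - 1 ∈ argRows m y l then 1 else 0 := by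
  obtain ⟨a, rfl⟩ : ∃ a', a = a' + 1 := ⟨a - 1, by omega⟩
  rw [Nat.add_sub_cancel]
  refine Finset.sup_le fun r hr => ?_
  have hr' := Finset.mem_range.1 hr
  have h1 := le_brk hr' y l
  rw [idl]
  split_ifs with h h2
  · have h3 := le_brk (show a < m by omega) y l
    have h4 := hy (show r ≤ a by omega)
    rw [← max_add_add_left]
    refine max_le (by omega) (by omega)
  · have h3 := le_brk (show a < m by omega) y l
    have h4 := hy (show r ≤ a by omega)
    have h5 : y a + idl m l (a + 1) ≠ brk m y l := fun h5 =>
      h2 (Finset.mem_filter.2 ⟨Finset.mem_range.2 (by omega), h5⟩)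
    rw [← max_add_add_left]
    refine max_le (by omega) (by omega)
  · omega
  · omega

lemma sum_brk_cons_le {m : ℕ} {y : ℕ → ℕ} (hy : Monotone y) (k : ℕ) (l : List ℕ) :
    ∑ a ∈ Finset.Icc 1 k, brk m y (a :: l) ≤ k * brk m y l + (argRows m y l).card := by
  calc ∑ a ∈ Finset.Icc 1 k, brk m y (a :: l)
      ≤ ∑ a ∈ Finset.Icc 1 k, (brk m y l + if a - 1 ∈ argRows m y l then 1 else 0) :=
        Finset.sum_le_sum fun a ha => brk_cons_le hy a (Finset.mem_Icc.1 ha).1 l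
    _ = k * brk m y l + ((Finset.Icc 1 k).filter (fun a => a - 1 ∈ argRows m y l)).card := by
        rw [Finset.sum_add_distrib, Finset.card_filter]; simp
    _ ≤ _ := by
        refine Nat.add_le_add_left (Finset.card_le_card_of_injOn (fun a => a - 1) ?_ ?_) _
        · intro a ha
          simp only [Finset.coe_filter, Set.mem_ofPred_eq] at ha
          exact ha.2
        · intro a ha b hb hab
          simp only [Finset.coe_filter, Set.mem_ofPred_eq, Finset.mem_Icc] at ha hb
          simp only at hab
          omega

lemma le_sum_brk_step {m k : ℕ} {w : List ℕ} {x ζ : ℕ → ℕ} (l : List ℕ)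
    (hlet : ∀ r < m, rowLetter w x r ∈ Finset.Icc 1 k) :
    k * brk m (x + ζ) l + ((argRows m (x + ζ) l).image (rowLetter w x)).card ≤
      ∑ b ∈ Finset.Icc 1 k, brk m (stepR w b x + ζ) l := by
  have h1 : ((argRows m (x + ζ) l).image (rowLetter w x)).card
      = ∑ b ∈ Finset.Icc 1 k,
        if b ∈ (argRows m (x + ζ) l).image (rowLetter w x) then 1 else 0 := by
    rw [← Finset.card_filter]
    congr 1
    ext b
    simp only [Finset.mem_filter, Finset.mem_image]
    constructor
    · rintro ⟨r, hr, rfl⟩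
      exact ⟨hlet r (Finset.mem_range.1 (Finset.mem_filter.1 hr).1), r, hr, rfl⟩
    · exact fun h => h.2
  have h2 : k * brk m (x + ζ) l = ∑ b ∈ Finset.Icc 1 k, brk m (x + ζ) l := by simp
  rw [h1, h2, ← Finset.sum_add_distrib]
  refine Finset.sum_le_sum fun b _ => ?_
  split_ifs with h
  · obtain ⟨r, hr, rfl⟩ := Finset.mem_image.1 h
    obtain ⟨hrm, hr⟩ := Finset.mem_filter.1 hr
    refine le_trans ?_ (le_brk (Finset.mem_range.1 hrm) _ l)
    have := le_stepR w (rowLetter w x r) x (le_refl r)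
    have h3 : w.getD (x r + r) 0 = rowLetter w x r := rfl
    rw [if_pos h3] at this
    simp only [Pi.add_apply] at hr ⊢
    omega
  · rw [add_zero]
    refine Finset.sup_le fun r hr => ?_
    have h3 := le_brk (Finset.mem_range.1 hr) (stepR w b x + ζ) l
    have := self_le_stepR w b x r
    simp only [Pi.add_apply] at h3 ⊢
    omega

lemma card_le_card_image_add (R : Finset ℕ) (m : ℕ) (hR : R ⊆ Finset.range m) (f : ℕ → ℕ) :
    R.card ≤ (R.image f).card + ∑ s ∈ Finset.range m, ∑ r ∈ Finset.range s,
      if (r ∈ R ∧ s ∈ R) ∧ f r = f s then 1 else 0 := by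
  classical
  have h1 := Finset.card_filter_add_card_filter_not (s := R) (fun s => ∀ r ∈ R, r < s → f r ≠ f s)
  have h2 : (R.filter (fun s => ∀ r ∈ R, r < s → f r ≠ f s)).card ≤ (R.image f).card := by
    refine Finset.card_le_card_of_injOn f ?_ ?_
    · intro s hs
      simp only [Finset.coe_filter, Set.mem_ofPred_eq] at hs
      exact Finset.mem_image_of_mem _ hs.1
    · intro s hs t ht hst
      simp only [Finset.coe_filter, Set.mem_ofPred_eq] at hs ht
      rcases lt_trichotomy s t with h | h | h
      · exact absurd hst (ht.2 s hs.1 h)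
      · exact h
      · exact absurd hst.symm (hs.2 t ht.1 h)
  have h3 : (R.filter (fun s => ¬ ∀ r ∈ R, r < s → f r ≠ f s)).card ≤
      ∑ s ∈ Finset.range m, ∑ r ∈ Finset.range s,
      if (r ∈ R ∧ s ∈ R) ∧ f r = f s then 1 else 0 := by
    calc _ ≤ ((Finset.range m).filter (fun s => s ∈ R ∧ ¬ ∀ r ∈ R, r < s → f r ≠ f s)).card := by
          refine Finset.card_le_card fun s hs => ?_
          rw [Finset.mem_filter] at hs ⊢
          exact ⟨hR hs.1, hs⟩
      _ ≤ _ := by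
          rw [Finset.card_filter]
          refine Finset.sum_le_sum fun s _ => ?_
          split_ifs with h
          · obtain ⟨hs, h⟩ := h
            push Not at h
            obtain ⟨r, hr, hrs, hf⟩ := h
            refine le_trans ?_ (Finset.single_le_sum (fun _ _ => Nat.zero_le _)
              (Finset.mem_range.2 hrs))
            rw [if_pos ⟨⟨hr, hs⟩, hf⟩]
          · exact Nat.zero_le _
  omega

/-- Tilted offsets used to break ties between rows. -/
def tilt (m i r : ℕ) : ℕ := r * i / m

lemma tilt_mono (m i : ℕ) : Monotone (tilt m i) := fun r s h => by
  unfold tilt; gcongr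

lemma card_tilt_le {m : ℕ} (r s : ℕ) (hrs : r < s) (hs : s < m) (A : Finset ℕ) (p q : ℕ)
    (hA : ∀ i ∈ A, p + tilt m i r = q + tilt m i s) :
    A.card * (s - r) ≤ 3 * m := by
  rcases A.eq_empty_or_nonempty with rfl | hne
  · simp
  obtain ⟨d, rfl⟩ := Nat.exists_eq_add_of_le hrs.le
  have hm : 0 < m := by omega
  have h1 : A.card ≤ A.max' hne - A.min' hne + 1 := by
    calc A.card ≤ (Finset.Icc (A.min' hne) (A.max' hne)).card :=
          Finset.card_le_card fun i hi => Finset.mem_Icc.2 ⟨A.min'_le i hi, A.le_max' i hi⟩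
      _ = _ := by
          rw [Nat.card_Icc]
          have := A.min'_le_max' hne
          omega
  have h2 : (A.max' hne - A.min' hne) * d ≤ 2 * m := by
    have a1 := hA _ (A.max'_mem hne)
    have a2 := hA _ (A.min'_mem hne)
    have huv := A.min'_le_max' hne
    generalize A.max' hne = u at *
    generalize A.min' hne = v at *
    unfold tilt at a1 a2
    have b4 := Nat.div_mul_le_self ((r + d) * v) m
    have b5 := Nat.div_mul_le_self (r * u) m
    have b6 := Nat.lt_div_mul_add (a := (r + d) * u) hm
    have b8 := Nat.lt_div_mul_add (a := r * v) hm
    rw [Nat.sub_mul]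
    have huv' := Nat.mul_le_mul_right d huv
    generalize r * u / m = U at *
    generalize (r + d) * u / m = U' at *
    generalize r * v / m = V at *
    generalize (r + d) * v / m = V' at *
    zify [huv']
    zify at a1 a2 b4 b5 b6 b8
    have e1 : ((p : ℤ) + U) * m = (q + U') * m := by rw [a1]
    have e2 : ((p : ℤ) + V) * m = (q + V') * m := by rw [a2]
    linarith
  rw [Nat.add_sub_cancel_left]
  calc A.card * d ≤ (A.max' hne - A.min' hne + 1) * d := by gcongr
    _ = (A.max' hne - A.min' hne) * d + d := by ring
    _ ≤ _ := by omega

/-- Sum over tilts of the expected pairing with a random word of length `n`. -/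
noncomputable def tiltVal (k m Λ n : ℕ) (_w : List ℕ) (x : ℕ → ℕ) : ℝ :=
  ∑ i ∈ Finset.range Λ, wordAvg k n (fun l => (brk m (x + tilt m i) l : ℝ))

/-- Expected loss from conflicts, weighted by the tie multiplicities. -/
noncomputable def confLoss (k m : ℕ) (w : List ℕ) (x : ℕ → ℕ) : ℝ :=
  (k : ℝ)⁻¹ * ∑ s ∈ Finset.range m, ∑ r ∈ Finset.range s,
    (3 * m / (s - r : ℝ)) * conf r s w x

lemma tiltVal_step {k m : ℕ} (hk : 0 < k) (Λ n : ℕ) {w : List ℕ} {x : ℕ → ℕ} (hx : Monotone x)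
    (hlet : ∀ r < m, rowLetter w x r ∈ Finset.Icc 1 k) :
    tiltVal k m Λ (n + 1) w x ≤ nextAvg k (tiltVal k m Λ n) w x + confLoss k m w x := by
  have hk' : (0 : ℝ) < k := by exact_mod_cast hk
  have h1 : ∀ l : List ℕ, ∑ i ∈ Finset.range Λ, ∑ a ∈ Finset.Icc 1 k,
      (k : ℝ)⁻¹ * (brk m (x + tilt m i) (a :: l) : ℝ) ≤
      ∑ i ∈ Finset.range Λ, ∑ b ∈ Finset.Icc 1 k,
      (k : ℝ)⁻¹ * (brk m (stepR w b x + tilt m i) l : ℝ) + confLoss k m w x := by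
    intro l
    simp only [← Finset.mul_sum]
    unfold confLoss
    rw [← mul_add]
    refine mul_le_mul_of_nonneg_left ?_ (inv_nonneg.2 hk'.le)
    have e1 : ∀ i, ∑ a ∈ Finset.Icc 1 k, brk m (x + tilt m i) (a :: l) ≤
        ∑ b ∈ Finset.Icc 1 k, brk m (stepR w b x + tilt m i) l +
        ∑ s ∈ Finset.range m, ∑ r ∈ Finset.range s,
          if (r ∈ argRows m (x + tilt m i) l ∧ s ∈ argRows m (x + tilt m i) l) ∧
            rowLetter w x r = rowLetter w x s then 1 else 0 := by
      intro i
      have hxt : Monotone (x + tilt m i) := hx.add (tilt_mono m i)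
      have a1 := sum_brk_cons_le (m := m) hxt k l
      have a2 := le_sum_brk_step (m := m) (k := k) (w := w) (x := x) (ζ := tilt m i) l hlet
      have a3 := card_le_card_image_add (argRows m (x + tilt m i) l) m (Finset.filter_subset _ _)
        (rowLetter w x)
      omega
    have e2 : ∀ s ∈ Finset.range m, ∀ r ∈ Finset.range s,
        ((∑ i ∈ Finset.range Λ,
          if (r ∈ argRows m (x + tilt m i) l ∧ s ∈ argRows m (x + tilt m i) l) ∧
            rowLetter w x r = rowLetter w x s then 1 else 0 : ℕ) : ℝ) ≤
        (3 * m / (s - r : ℝ)) * conf r s w x := by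
      intro s hs r hr
      have hs' := Finset.mem_range.1 hs
      have hr' := Finset.mem_range.1 hr
      unfold conf
      by_cases h : rowLetter w x r = rowLetter w x s
      · simp only [h, and_true, if_true, mul_one]
        rw [← Finset.card_filter]
        have hc := card_tilt_le r s hr' hs' ((Finset.range Λ).filter (fun i =>
          r ∈ argRows m (x + tilt m i) l ∧ s ∈ argRows m (x + tilt m i) l))
          (x r + idl m l (r + 1)) (x s + idl m l (s + 1)) (by
            intro i hi
            obtain ⟨-, h1, h2⟩ := Finset.mem_filter.1 hi
            have h1 := (Finset.mem_filter.1 h1).2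
            have h2 := (Finset.mem_filter.1 h2).2
            simp only [Pi.add_apply] at h1 h2
            omega)
        have hsr : (0 : ℝ) < s - r := by
          have : (r : ℝ) < s := by exact_mod_cast hr'
          linarith
        rw [le_div_iff₀ hsr]
        rw [← Nat.cast_sub hr'.le]
        exact_mod_cast hc
      · simp [h]
    calc ∑ i ∈ Finset.range Λ, ∑ a ∈ Finset.Icc 1 k, (brk m (x + tilt m i) (a :: l) : ℝ)
        ≤ ∑ i ∈ Finset.range Λ, ((∑ b ∈ Finset.Icc 1 k, brk m (stepR w b x + tilt m i) l +
        ∑ s ∈ Finset.range m, ∑ r ∈ Finset.range s,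
          if (r ∈ argRows m (x + tilt m i) l ∧ s ∈ argRows m (x + tilt m i) l) ∧
            rowLetter w x r = rowLetter w x s then 1 else 0 : ℕ) : ℝ) :=
          Finset.sum_le_sum fun i _ => by exact_mod_cast e1 i
      _ = ∑ i ∈ Finset.range Λ, ∑ b ∈ Finset.Icc 1 k, (brk m (stepR w b x + tilt m i) l : ℝ) +
          ∑ s ∈ Finset.range m, ∑ r ∈ Finset.range s, ((∑ i ∈ Finset.range Λ,
          if (r ∈ argRows m (x + tilt m i) l ∧ s ∈ argRows m (x + tilt m i) l) ∧
            rowLetter w x r = rowLetter w x s then 1 else 0 : ℕ) : ℝ) := by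
          push_cast
          rw [Finset.sum_add_distrib]
          congr 1
          rw [Finset.sum_comm]
          refine Finset.sum_congr rfl fun s _ => ?_
          rw [Finset.sum_comm]
      _ ≤ _ := by
          gcongr with s hs r hr
          exact e2 s hs r hr
  have h2 : tiltVal k m Λ (n + 1) w x = wordAvg k n (fun l => ∑ i ∈ Finset.range Λ,
      ∑ a ∈ Finset.Icc 1 k, (k : ℝ)⁻¹ * (brk m (x + tilt m i) (a :: l) : ℝ)) := by
    unfold tiltVal wordAvg
    simp only [wordSum_sum, wordSum_succ']
  have h3 : nextAvg k (tiltVal k m Λ n) w x = wordAvg k n (fun l => ∑ i ∈ Finset.range Λ,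
      ∑ b ∈ Finset.Icc 1 k, (k : ℝ)⁻¹ * (brk m (stepR w b x + tilt m i) l : ℝ)) := by
    unfold nextAvg tiltVal wordAvg
    simp only [wordSum_sum, wordSum_mul_left, Finset.mul_sum]
    rw [Finset.sum_comm]
  rw [h2, h3, ← wordAvg_const hk n (confLoss k m w x), ← wordAvg_add]
  exact wordAvg_mono _ _ fun l _ _ => h1 l

lemma tiltVal_telescope {k m : ℕ} (hk : 0 < k) (Λ n J : ℕ) (hn : J + m < n) (j : ℕ) (hj : j ≤ J) :
    tiltVal k m Λ J [] (fun _ => 0) ≤ rowAvg k n j (tiltVal k m Λ (J - j))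
      + ∑ i ∈ Finset.range j, rowAvg k n i (confLoss k m) := by
  induction j with
  | zero =>
    rw [rowAvg_zero]
    simp only [Finset.range_zero, Finset.sum_empty, add_zero, Nat.sub_zero]
    exact (wordAvg_const hk n _).ge
  | succ j ih =>
    refine (ih (by omega)).trans ?_
    rw [Finset.sum_range_succ, rowAvg_succ]
    have : rowAvg k n j (tiltVal k m Λ (J - j)) ≤ rowAvg k n j
        (fun w x => nextAvg k (tiltVal k m Λ (J - (j + 1))) w x + confLoss k m w x) := by
      refine rowAvg_mono _ _ _ fun w x hw hw' hx hxj => ?_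
      rw [show J - j = J - (j + 1) + 1 by omega]
      refine tiltVal_step hk Λ _ hx fun r hr => getD_mem_Icc hw' ?_
      have := hxj r
      omega
    rw [rowAvg_add] at this
    linarith

/-- Comparison of the greedy matching process with its idealisation. -/
lemma wordAvg_idl_le {k : ℕ} (hk : 0 < k) (R Λ n J : ℕ) (hΛ : 0 < Λ) (hn : J + (R + 1) < n) :
    wordAvg k J (fun l => (idl (R + 1) l 1 : ℝ)) ≤ rowAvg k n J (fun _ x => (x R : ℝ)) + Λ
      + (Λ : ℝ)⁻¹ * ∑ i ∈ Finset.range J, rowAvg k n i (confLoss k (R + 1)) := by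
  have hΛ' : (0 : ℝ) < Λ := by exact_mod_cast hΛ
  have h := tiltVal_telescope (m := R + 1) hk Λ n J hn J le_rfl
  have h1 : Λ * wordAvg k J (fun l => (idl (R + 1) l 1 : ℝ))
      ≤ tiltVal k (R + 1) Λ J [] (fun _ => 0) := by
    unfold tiltVal
    rw [← nsmul_eq_mul, ← Finset.card_range Λ, ← Finset.sum_const, Finset.card_range]
    refine Finset.sum_le_sum fun i _ => wordAvg_mono _ _ fun l _ _ => ?_
    have h2 : idl (R + 1) l 1 ≤ brk (R + 1) ((fun _ => 0) + tilt (R + 1) i) l :=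
      le_trans (Nat.le_add_left _ _) (le_brk (m := R + 1) (r := 0) (Nat.succ_pos R) _ l)
    exact_mod_cast h2
  have h2 : rowAvg k n J (tiltVal k (R + 1) Λ (J - J)) ≤
      Λ * (rowAvg k n J (fun _ x => (x R : ℝ)) + Λ) := by
    rw [← rowAvg_const hk n J (Λ : ℝ), ← rowAvg_add, rowAvg_const hk n J, ← rowAvg_mul_left,
      Nat.sub_self]
    refine rowAvg_mono _ _ _ fun w x _ _ hx _ => ?_
    unfold tiltVal
    rw [← nsmul_eq_mul, ← Finset.card_range Λ, ← Finset.sum_const, Finset.card_range]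
    refine Finset.sum_le_sum fun i hi => ?_
    have hi' := Finset.mem_range.1 hi
    change ((brk (R + 1) (x + tilt (R + 1) i) [] : ℕ) : ℝ) ≤ _
    have : brk (R + 1) (x + tilt (R + 1) i) [] ≤ x R + Λ := by
      refine Finset.sup_le fun r hr => ?_
      have hr' := Finset.mem_range.1 hr
      have a1 := hx (show r ≤ R by omega)
      have a2 : tilt (R + 1) i r ≤ i := by
        unfold tilt
        refine Nat.div_le_of_le_mul ?_
        gcongr
      simp only [Pi.add_apply, idl]
      omega
    exact_mod_cast this
  have h3 : Λ * wordAvg k J (fun l => (idl (R + 1) l 1 : ℝ)) ≤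
      Λ * (rowAvg k n J (fun _ x => (x R : ℝ)) + Λ)
        + ∑ i ∈ Finset.range J, rowAvg k n i (confLoss k (R + 1)) := by linarith
  have h4 := mul_le_mul_of_nonneg_left h3 (inv_nonneg.2 hΛ'.le)
  rw [inv_mul_cancel_left₀ hΛ'.ne', mul_add, inv_mul_cancel_left₀ hΛ'.ne'] at h4
  exact h4

lemma sum_inv_sub_le (m : ℕ) :
    ∑ s ∈ Finset.range m, ∑ r ∈ Finset.range s, (1 / (s - r : ℝ)) ≤ m * (1 + Real.log m) := by
  have h1 : ∀ s ∈ Finset.range m, ∑ r ∈ Finset.range s, (1 / (s - r : ℝ)) ≤ 1 + Real.log m := by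
    intro s hs
    have hs' := Finset.mem_range.1 hs
    rw [← Finset.sum_range_reflect]
    have e : ∑ j ∈ Finset.range s, (1 / ((s : ℝ) - ((s - 1 - j : ℕ) : ℝ)))
        = ((harmonic s : ℚ) : ℝ) := by
      rw [harmonic]
      push_cast
      refine Finset.sum_congr rfl fun j hj => ?_
      have hj' := Finset.mem_range.1 hj
      rw [one_div]
      congr 1
      rw [show s - 1 - j = s - (j + 1) by omega, Nat.cast_sub (by omega)]
      push_cast; ring
    rw [e]
    rcases Nat.eq_zero_or_pos s with rfl | hs0
    · simp only [harmonic_zero, Rat.cast_zero]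
      have := Real.log_natCast_nonneg m
      linarith
    · refine (harmonic_le_one_add_log s).trans ?_
      gcongr
  calc _ ≤ ∑ s ∈ Finset.range m, (1 + Real.log m) := Finset.sum_le_sum h1
    _ = _ := by simp [mul_add]

lemma rowAvg_confLoss_le {k : ℕ} (hk : 0 < k) (R n J : ℕ) (C : ℝ)
    (hC : ∀ r s, r < s → s ≤ R → ∑ j ∈ Finset.range J, rowAvg k n j (conf r s) ≤ C)
    (hC0 : 0 ≤ C) :
    ∑ j ∈ Finset.range J, rowAvg k n j (confLoss k (R + 1)) ≤
      3 * (R + 1) ^ 2 * (1 + Real.log (R + 1)) * C / k := by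
  have hk' : (0 : ℝ) < k := by exact_mod_cast hk
  have e : ∑ j ∈ Finset.range J, rowAvg k n j (confLoss k (R + 1)) = (k : ℝ)⁻¹ *
      ∑ s ∈ Finset.range (R + 1), ∑ r ∈ Finset.range s, (3 * (R + 1) / (s - r : ℝ)) *
        ∑ j ∈ Finset.range J, rowAvg k n j (conf r s) := by
    unfold confLoss
    simp only [rowAvg_mul_left, rowAvg_sum, Finset.mul_sum]
    rw [Finset.sum_comm]
    refine Finset.sum_congr rfl fun s _ => ?_
    rw [Finset.sum_comm]
    push_cast
    rfl
  rw [e]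
  have h1 : ∑ s ∈ Finset.range (R + 1), ∑ r ∈ Finset.range s, (3 * (R + 1) / (s - r : ℝ)) *
        ∑ j ∈ Finset.range J, rowAvg k n j (conf r s) ≤
      ∑ s ∈ Finset.range (R + 1), ∑ r ∈ Finset.range s, (3 * (R + 1) * C) * (1 / (s - r : ℝ)) := by
    refine Finset.sum_le_sum fun s hs => Finset.sum_le_sum fun r hr => ?_
    have hs' := Finset.mem_range.1 hs
    have hr' := Finset.mem_range.1 hr
    have hsr : (0 : ℝ) < s - r := by
      have : (r : ℝ) < s := by exact_mod_cast hr'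
      linarith
    calc _ ≤ (3 * (R + 1) / (s - r : ℝ)) * C := by
          gcongr
          exact hC r s hr' (by omega)
      _ = _ := by ring
  simp only [← Finset.mul_sum] at h1
  have h2 := sum_inv_sub_le (R + 1)
  push_cast at h2
  calc _ ≤ (k : ℝ)⁻¹ * ((3 * (R + 1) * C) * ((R + 1) * (1 + Real.log (R + 1)))) := by
        gcongr
        refine h1.trans ?_
        gcongr
    _ = _ := by ring

lemma idl_antitone (m : ℕ) (l : List ℕ) : Antitone (idl m l) := by
  induction l with
  | nil => exact fun _ _ _ => le_rfl
  | cons a l ih =>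
    intro r s h
    have := ih h
    simp only [idl]
    split_ifs
    · exact max_le_max this le_rfl
    · omega
    · exact this.trans (le_max_left _ _)
    · exact this

lemma idl_cons_self {m r : ℕ} (hr : r ≤ m) (l : List ℕ) : idl m (r :: l) r = 1 + idl m l r := by
  simp [idl, hr]

lemma idl_cons_of_lt {m r a : ℕ} (h : a < r) (l : List ℕ) : idl m (a :: l) r = idl m l r := by
  rw [idl, if_neg (by omega)]

lemma idl_le_cons (m a r : ℕ) (l : List ℕ) : idl m l r ≤ idl m (a :: l) r := by
  rw [idl]; split_ifs
  · exact le_max_left _ _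
  · exact le_rfl

lemma idl_cons_le_max {m r a : ℕ} (h : r < a) (l : List ℕ) :
    idl m (a :: l) r ≤ max (idl m l r) (idl m (a :: l) (r + 1)) := by
  simp only [idl]
  by_cases ha : a ≤ m
  · rw [if_pos ⟨h.le, ha⟩, if_pos ⟨h, ha⟩]
    exact max_le_max le_rfl (le_max_right _ _)
  · rw [if_neg (by omega)]; exact le_max_left _ _

/-- Dynamics of a tandem of queues: the letter `0` is a service of the first queue, passed on while
queues are empty; the letter `a + 1` is an arrival at queue `a` and a service of the next one. -/
def qstep : ℕ → List ℕ → List ℕ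
  | _, [] => []
  | 0, 0 :: Q => 0 :: qstep 0 Q
  | 0, (q + 1) :: Q => q :: Q
  | 1, q :: Q => (q + 1) :: qstep 0 Q
  | i + 2, q :: Q => q :: qstep (i + 1) Q

@[simp] lemma length_qstep (a : ℕ) (Q : List ℕ) : (qstep a Q).length = Q.length := by
  induction Q generalizing a with
  | nil => cases a <;> simp [qstep]
  | cons q Q ih =>
    rcases a with _ | _ | a
    · cases q <;> simp [qstep, ih]
    · simp [qstep, ih]
    · simp [qstep, ih]

lemma qstep_length_succ (Q : List ℕ) : qstep (Q.length + 1) Q = Q := by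
  induction Q with
  | nil => rfl
  | cons q Q ih => simp [qstep, ih]

/-- Last passage value of the word `l` started from the queues `Q` of index at least `r`. -/
def lpp (m : ℕ) (l : List ℕ) : ℕ → List ℕ → ℕ
  | r, [] => idl m l r
  | r, q :: Q => max (idl m l r) (q + lpp m l (r + 1) Q)

lemma idl_le_lpp (m : ℕ) (l : List ℕ) (r : ℕ) (Q : List ℕ) : idl m l r ≤ lpp m l r Q := by
  cases Q with
  | nil => exact le_rfl
  | cons q Q => exact le_max_left _ _

lemma lpp_cons_of_lt {m a r : ℕ} (h : a < r) (l Q : List ℕ) :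
    lpp m (a :: l) r Q = lpp m l r Q := by
  induction Q generalizing r with
  | nil => exact idl_cons_of_lt h l
  | cons q Q ih => rw [lpp, lpp, idl_cons_of_lt h, ih (by omega)]

lemma lpp_service (m : ℕ) (l : List ℕ) (r : ℕ) (Q : List ℕ) :
    1 + lpp m l r (qstep 0 Q) = max (1 + idl m l r) (lpp m l r Q) := by
  induction Q generalizing r with
  | nil => simp only [qstep, lpp]; omega
  | cons q Q ih =>
    have h1 := idl_antitone m l (show r ≤ r + 1 by omega)
    have h2 := ih (r + 1)
    cases q with
    | zero => simp only [qstep, lpp]; omega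
    | succ q => simp only [qstep, lpp]; omega

lemma lpp_cons {m a r : ℕ} (h : r ≤ a) (l Q : List ℕ) (hQ : r + Q.length = m) :
    lpp m (a :: l) r Q = (if a = r then 1 else 0) + lpp m l r (qstep (a - r) Q) := by
  induction Q generalizing r with
  | nil =>
    simp only [List.length_nil, add_zero] at hQ
    subst hQ
    split_ifs with ha
    · subst ha
      simp only [lpp, qstep]
      exact idl_cons_self le_rfl l
    · simp only [qstep, lpp]
      rw [idl, if_neg (by omega), zero_add]
  | cons q Q ih =>
    simp only [List.length_cons] at hQ
    split_ifs with ha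
    · subst ha
      rw [Nat.sub_self, lpp_service, lpp, lpp, idl_cons_self (by omega),
        lpp_cons_of_lt (show a < a + 1 by omega)]
      omega
    · have ih' := ih (r := r + 1) (by omega) (by omega)
      have h1 := idl_cons_le_max (m := m) (show r < a by omega) l
      have h2 := idl_le_lpp m (a :: l) (r + 1) Q
      have h3 := idl_le_cons m a r l
      obtain ⟨d, rfl⟩ : ∃ d, a = r + 1 + d := ⟨a - r - 1, by omega⟩
      rw [show r + 1 + d - (r + 1) = d by omega] at ih'
      rw [show r + 1 + d - r = d + 1 by omega]
      cases d with
      | zero =>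
        rw [if_pos (by omega)] at ih'
        rw [lpp, zero_add 1, qstep, lpp]
        simp only [add_zero] at *
        omega
      | succ d =>
        rw [if_neg (by omega)] at ih'
        simp only [qstep, lpp]
        omega

lemma lpp_nil (m r : ℕ) (Q : List ℕ) : lpp m [] r Q = Q.sum := by
  induction Q generalizing r with
  | nil => rfl
  | cons q Q ih => simp [lpp, idl, ih]

/-- Evolution of the queues along a word. -/
def qrun (Q l : List ℕ) : List ℕ := l.foldl (fun Q a => qstep a Q) Q

@[simp] lemma length_qrun (Q l : List ℕ) : (qrun Q l).length = Q.length := by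
  induction l generalizing Q with
  | nil => rfl
  | cons a l ih => exact (ih (qstep a Q)).trans (length_qstep a Q)

lemma qrun_append (Q p s : List ℕ) : qrun Q (p ++ s) = qrun (qrun Q p) s := by
  simp [qrun]

lemma sum_qrun (l Q : List ℕ) : (qrun Q l).sum + l.count 0 = lpp Q.length l 0 Q := by
  induction l generalizing Q with
  | nil => simp [lpp_nil, qrun]
  | cons a l ih =>
    have h := ih (qstep a Q)
    rw [length_qstep] at h
    rw [lpp_cons (Nat.zero_le a) l Q (by simp), Nat.sub_zero, ← h, List.count_cons]
    simp only [beq_iff_eq, qrun, List.foldl_cons]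
    omega

lemma lpp_le (m : ℕ) (l Q : List ℕ) (r : ℕ) : lpp m l r Q ≤ Q.sum + idl m l r := by
  induction Q generalizing r with
  | nil => simp [lpp]
  | cons q Q ih =>
    have := ih (r + 1)
    have := idl_antitone m l (show r ≤ r + 1 by omega)
    simp only [lpp, List.sum_cons]
    omega

lemma exists_idl_zero (m : ℕ) (l : List ℕ) :
    ∃ p s, l = p ++ s ∧ idl m l 0 = p.count 0 + idl m s 1 := by
  induction l with
  | nil => exact ⟨[], [], rfl, rfl⟩
  | cons a l ih =>
    obtain ⟨p, s, rfl, h⟩ := ih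
    rcases Nat.eq_zero_or_pos a with rfl | ha
    · refine ⟨0 :: p, s, rfl, ?_⟩
      rw [idl_cons_self (Nat.zero_le m), h, List.count_cons_self]
      omega
    · by_cases h' : idl m (a :: (p ++ s)) 0 = idl m (p ++ s) 0
      · refine ⟨a :: p, s, rfl, ?_⟩
        rw [h', h, List.count_cons_of_ne (by omega)]
      · refine ⟨[], a :: (p ++ s), rfl, ?_⟩
        have h1 := idl_cons_le_max (m := m) ha (p ++ s)
        rw [zero_add] at h1
        have h2 := idl_le_cons m a 0 (p ++ s)
        have h3 := idl_antitone m (a :: (p ++ s)) (Nat.zero_le 1)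
        simp only [List.count_nil]
        omega

/-- The final queue content is bounded below by the excess over services on every suffix. -/
lemma idl_le_sum_qrun (Q p s : List ℕ) (hQ : Q ≠ []) :
    idl Q.length s 1 ≤ (qrun Q (p ++ s)).sum + s.count 0 := by
  rw [qrun_append, sum_qrun, length_qrun]
  have h : qrun Q p ≠ [] := by
    rw [← List.length_pos_iff, length_qrun, List.length_pos_iff]; exact hQ
  obtain ⟨q, Q', h'⟩ := List.exists_cons_of_ne_nil h
  rw [h', lpp]
  have := idl_le_lpp Q.length s 1 Q'
  rw [zero_add]
  omega

/-- The final queue content is attained on some suffix, up to the initial queue content. -/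
lemma exists_sum_qrun_le (Q l : List ℕ) (hQ : Q ≠ []) :
    (∃ p s, l = p ++ s ∧ (qrun Q l).sum + s.count 0 ≤ idl Q.length s 1) ∨
      (qrun Q l).sum + l.count 0 ≤ Q.sum + idl Q.length l 1 := by
  obtain ⟨q, Q', rfl⟩ := List.exists_cons_of_ne_nil hQ
  have h := sum_qrun l (q :: Q')
  set m := (q :: Q').length
  rw [lpp] at h
  have h1 := lpp_le m l Q' 1
  rcases le_total (q + lpp m l 1 Q') (idl m l 0) with h2 | h2
  · left
    obtain ⟨p, s, rfl, h3⟩ := exists_idl_zero m l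
    refine ⟨p, s, rfl, ?_⟩
    rw [List.count_append] at h
    rw [zero_add] at h
    omega
  · right
    rw [zero_add] at h
    simp only [List.sum_cons]
    omega

lemma count_one_add_idl_le {m : ℕ} (hm : 1 ≤ m) (p s : List ℕ) :
    p.count 1 + idl m s 1 ≤ idl m (p ++ s) 1 := by
  induction p with
  | nil => simp
  | cons a p ih =>
    rw [List.cons_append]
    by_cases ha : a = 1
    · subst ha
      rw [idl_cons_self hm, List.count_cons_self]; omega
    · rw [List.count_cons_of_ne (by omega)]
      exact ih.trans (idl_le_cons _ _ _ _)

lemma count_one_le_idl {m : ℕ} (hm : 1 ≤ m) (l : List ℕ) : l.count 1 ≤ idl m l 1 := by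
  have := count_one_add_idl_le hm l []
  simpa [idl] using this

open scoped ENNReal

/-- Average over lists of length `m` with independent entries, each equal to `q` with
weight `σ * ρ ^ q`. -/
noncomputable def geoAvg (σ ρ : ℝ≥0∞) : ℕ → (List ℕ → ℝ≥0∞) → ℝ≥0∞
  | 0, F => F []
  | m + 1, F => ∑' q : ℕ, σ * ρ ^ q * geoAvg σ ρ m (fun Q => F (q :: Q))

section GeoAvg

variable {σ ρ : ℝ≥0∞}

lemma geoAvg_mono (m : ℕ) {F G : List ℕ → ℝ≥0∞} (h : ∀ Q, Q.length = m → F Q ≤ G Q) :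
    geoAvg σ ρ m F ≤ geoAvg σ ρ m G := by
  induction m generalizing F G with
  | zero => exact h [] rfl
  | succ m ih =>
    exact ENNReal.tsum_le_tsum fun q => by
      gcongr
      exact ih fun Q hQ => h _ (by simp [hQ])

lemma geoAvg_congr (m : ℕ) {F G : List ℕ → ℝ≥0∞} (h : ∀ Q, Q.length = m → F Q = G Q) :
    geoAvg σ ρ m F = geoAvg σ ρ m G :=
  le_antisymm (geoAvg_mono m fun Q hQ => (h Q hQ).le) (geoAvg_mono m fun Q hQ => (h Q hQ).ge)

lemma geoAvg_add (m : ℕ) (F G : List ℕ → ℝ≥0∞) :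
    geoAvg σ ρ m (fun Q => F Q + G Q) = geoAvg σ ρ m F + geoAvg σ ρ m G := by
  induction m generalizing F G with
  | zero => rfl
  | succ m ih => simp only [geoAvg, ih, mul_add, ENNReal.tsum_add]

lemma geoAvg_mul_left (m : ℕ) (c : ℝ≥0∞) (F : List ℕ → ℝ≥0∞) :
    geoAvg σ ρ m (fun Q => c * F Q) = c * geoAvg σ ρ m F := by
  induction m generalizing F with
  | zero => rfl
  | succ m ih =>
    simp only [geoAvg, ih]
    rw [← ENNReal.tsum_mul_left]
    exact tsum_congr fun q => by ring

lemma geoAvg_pow_sum {z M : ℝ≥0∞} (hM : ∑' q : ℕ, σ * (ρ * z) ^ q = M) (m : ℕ) :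
    geoAvg σ ρ m (fun Q => z ^ Q.sum) = M ^ m := by
  induction m with
  | zero => simp [geoAvg]
  | succ m ih =>
    simp only [geoAvg, List.sum_cons, pow_add, geoAvg_mul_left, ih]
    rw [pow_one, show M ^ m * M = ∑' q : ℕ, M ^ m * (σ * (ρ * z) ^ q) by
      rw [ENNReal.tsum_mul_left, hM]]
    exact tsum_congr fun q => by ring

lemma geoAvg_const (h : ∑' q : ℕ, σ * ρ ^ q = 1) (m : ℕ) (c : ℝ≥0∞) :
    geoAvg σ ρ m (fun _ => c) = c := by
  have := geoAvg_mul_left (σ := σ) (ρ := ρ) m c (fun Q => 1 ^ Q.sum)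
  rw [geoAvg_pow_sum (M := 1) (by simpa using h)] at this
  simpa using this

/-- Product geometric weights are invariant under the dynamics of the tandem of queues. -/
lemma geoAvg_qstep {lam μ : ℝ≥0∞} (hμ : lam * ρ = μ) (m : ℕ) (F : List ℕ → ℝ≥0∞) :
    geoAvg σ ρ m (fun Q => lam * F (qstep 0 Q) + ∑ a ∈ Finset.range m, μ * F (qstep (a + 1) Q)) =
      (lam + m * μ) * geoAvg σ ρ m F := by
  induction m generalizing F with
  | zero => simp [geoAvg, qstep]
  | succ m ih =>
    have h0 : ∀ G : ℕ → ℝ≥0∞, ∑' q, G q = G 0 + ∑' q, G (q + 1) := fun G => by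
      rw [tsum_eq_zero_add' ENNReal.summable]
    have hstep : ∀ q Q, lam * F (qstep 0 (q :: Q)) +
        ∑ a ∈ Finset.range (m + 1), μ * F (qstep (a + 1) (q :: Q)) =
        lam * F (qstep 0 (q :: Q)) + μ * F ((q + 1) :: qstep 0 Q) +
          ∑ a ∈ Finset.range m, μ * F (q :: qstep (a + 1) Q) := by
      intro q Q
      rw [Finset.sum_range_succ']
      simp only [qstep, zero_add]
      ring
    set g : ℕ → ℝ≥0∞ := fun q => geoAvg σ ρ m (fun Q => F (q :: Q)) with hg
    set h : ℕ → ℝ≥0∞ := fun q => geoAvg σ ρ m (fun Q => F (q :: qstep 0 Q)) with hh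
    set b : ℕ → ℝ≥0∞ := fun q =>
      geoAvg σ ρ m (fun Q => ∑ a ∈ Finset.range m, μ * F (q :: qstep (a + 1) Q)) with hb
    have ih' : ∀ q, lam * h q + b q = (lam + m * μ) * g q := by
      intro q
      rw [← ih (fun Q => F (q :: Q)), geoAvg_add, geoAvg_mul_left]
    have e1 : geoAvg σ ρ (m + 1) (fun Q => lam * F (qstep 0 Q) +
        ∑ a ∈ Finset.range (m + 1), μ * F (qstep (a + 1) Q)) =
        (∑' q, σ * ρ ^ q * (lam * geoAvg σ ρ m (fun Q => F (qstep 0 (q :: Q))))) +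
        (∑' q, σ * ρ ^ q * (μ * h (q + 1))) + ∑' q, σ * ρ ^ q * b q := by
      simp only [geoAvg, hstep, geoAvg_add, geoAvg_mul_left, mul_add, ENNReal.tsum_add, hh, hb]
    have e2 : ∑' q, σ * ρ ^ q * (lam * geoAvg σ ρ m (fun Q => F (qstep 0 (q :: Q)))) =
        σ * (lam * h 0) + ∑' q, σ * ρ ^ q * (μ * g q) := by
      rw [h0]
      simp only [qstep, pow_zero, mul_one]
      congr 1
      exact tsum_congr fun q => by rw [← hμ, pow_succ]; ring
    have e3 : ∑' q, σ * ρ ^ q * (lam * h q) =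
        σ * (lam * h 0) + ∑' q, σ * ρ ^ q * (μ * h (q + 1)) := by
      rw [h0]
      simp only [pow_zero, mul_one]
      congr 1
      exact tsum_congr fun q => by rw [← hμ, pow_succ]; ring
    have e4 : ∑' q, σ * ρ ^ q * (lam * h q) + ∑' q, σ * ρ ^ q * b q =
        (lam + m * μ) * geoAvg σ ρ (m + 1) F := by
      rw [← ENNReal.tsum_add, geoAvg, ← ENNReal.tsum_mul_left]
      exact tsum_congr fun q => by rw [← mul_add, ih']; ring
    have e5 : ∑' q, σ * ρ ^ q * (μ * g q) = μ * geoAvg σ ρ (m + 1) F := by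
      rw [geoAvg, ← ENNReal.tsum_mul_left]
      exact tsum_congr fun q => by ring
    rw [e1, e2]
    calc σ * (lam * h 0) + ∑' q, σ * ρ ^ q * (μ * g q) + ∑' q, σ * ρ ^ q * (μ * h (q + 1)) +
          ∑' q, σ * ρ ^ q * b q
        = (σ * (lam * h 0) + ∑' q, σ * ρ ^ q * (μ * h (q + 1)) + ∑' q, σ * ρ ^ q * b q) +
          ∑' q, σ * ρ ^ q * (μ * g q) := by ring
      _ = (lam + (m + 1 : ℕ) * μ) * geoAvg σ ρ (m + 1) F := by
        rw [← e3, e4, e5]; push_cast; ring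

/-- If the letters are independent with weight `lam` for `0`, `lam * ρ` for each of `1, …, m`, and
the remaining weight for `m + 1`, then the queues are stationary. -/
lemma geoAvg_qrun {m : ℕ} {p : ℕ → ℝ≥0∞} (hp : ∑ a ∈ Finset.range (m + 2), p a = 1)
    (hμ : ∀ a < m, p (a + 1) = p 0 * ρ) (n : ℕ) (F : List ℕ → ℝ≥0∞) :
    geoAvg σ ρ m (fun Q => wordSum (Finset.range (m + 2)) p n (fun l => F (qrun Q l))) =
      geoAvg σ ρ m F := by
  have hp' : p 0 + m * (p 0 * ρ) + p (m + 1) = 1 := by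
    rw [← hp, Finset.sum_range_succ, Finset.sum_range_succ',
      Finset.sum_congr rfl fun a ha => hμ a (Finset.mem_range.1 ha)]
    simp [add_comm]
  induction n generalizing F with
  | zero => rfl
  | succ n ih =>
    have h1 : ∀ Q : List ℕ, Q.length = m →
        wordSum (Finset.range (m + 2)) p (n + 1) (fun l => F (qrun Q l)) =
        (p 0 * wordSum (Finset.range (m + 2)) p n (fun l => F (qrun (qstep 0 Q) l)) +
        ∑ a ∈ Finset.range m, p 0 * ρ *
          wordSum (Finset.range (m + 2)) p n (fun l => F (qrun (qstep (a + 1) Q) l))) +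
        p (m + 1) * wordSum (Finset.range (m + 2)) p n (fun l => F (qrun Q l)) := by
      intro Q hQ
      rw [wordSum, Finset.sum_range_succ, Finset.sum_range_succ',
        Finset.sum_congr rfl fun a ha => by rw [hμ a (Finset.mem_range.1 ha)]]
      have : qstep (m + 1) Q = Q := hQ ▸ qstep_length_succ Q
      simp only [qrun, List.foldl_cons, this]
      ring
    rw [geoAvg_congr m h1, geoAvg_add, geoAvg_mul_left, ih,
      geoAvg_qstep (F := fun Q => wordSum (Finset.range (m + 2)) p n (fun l => F (qrun Q l))) rfl,
      ih, ← add_mul, hp', one_mul]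

end GeoAvg

/-- Weight of the event `E` for words of length `n` with independent letters of weights `p`. -/
noncomputable def wordProb (s : Finset ℕ) (p : ℕ → ℝ) (n : ℕ) (E : Set (List ℕ)) : ℝ :=
  wordSum s p n (E.indicator 1)

section WordProb

variable {s : Finset ℕ} {p : ℕ → ℝ}

lemma wordProb_nonneg (hp : ∀ a ∈ s, 0 ≤ p a) (n : ℕ) (E : Set (List ℕ)) :
    0 ≤ wordProb s p n E := by
  have := wordSum_mono hp n (f := fun _ => 0) (g := E.indicator 1)
    fun l _ _ => Set.indicator_nonneg (fun _ _ => zero_le_one) l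
  rwa [wordSum_zero] at this

lemma wordProb_union_le (hp : ∀ a ∈ s, 0 ≤ p a) (n : ℕ) (E F : Set (List ℕ)) :
    wordProb s p n (E ∪ F) ≤ wordProb s p n E + wordProb s p n F := by
  rw [wordProb, wordProb, wordProb, ← wordSum_add]
  refine wordSum_mono hp n fun l _ _ => ?_
  by_cases hE : l ∈ E <;> by_cases hF : l ∈ F <;> simp [hE, hF]

/-- Maximal inequality for the number of occurrences of a letter in the suffixes of a word. -/
lemma wordProb_count_le (hp : ∀ a ∈ s, 0 ≤ p a) (hp1 : ∑ a ∈ s, p a = 1) {b : ℕ} (hb : b ∈ s)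
    {θ : ℝ} (hθ : |θ| ≤ 1) (x : ℝ) (n : ℕ) :
    wordProb s p n {l | ∃ t, t <:+ l ∧ x ≤ θ * (t.count b - p b * t.length)} ≤
      Real.exp (-x + θ ^ 2 * (p b * n)) := by
  classical
  set Z : List ℕ → ℝ := fun l =>
    Real.exp (θ * l.count b - (Real.exp θ - 1) * (p b * l.length)) with hZ
  set A : ℝ := Real.exp (x - θ ^ 2 * (p b * n)) with hA
  have hA0 : 0 < A := Real.exp_pos _
  have hZ0 : ∀ l, 0 < Z l := fun l => Real.exp_pos _
  set Y : List ℕ → ℝ := fun l => if ∃ t, t <:+ l ∧ A ≤ Z t then 1 else Z l / A with hY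
  have hZstep : ∀ l, ∑ a ∈ s, p a * Z (a :: l) ≤ Z l := by
    intro l
    have h1 : ∀ a ∈ s, p a * Z (a :: l) = (p a + if a = b then p b * (Real.exp θ - 1) else 0) *
        (Real.exp (-((Real.exp θ - 1) * p b)) * Z l) := by
      intro a _
      rw [hZ]
      simp only [List.count_cons, List.length_cons, ← Real.exp_add]
      split_ifs with h h' h'
      · subst h'
        push_cast
        rw [show p a + p a * (Real.exp θ - 1) = p a * Real.exp θ by ring, mul_assoc,
          ← Real.exp_add]
        ring_nf
      · simp_all
      · simp_all
      · push_cast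
        ring_nf
    rw [Finset.sum_congr rfl h1, ← Finset.sum_mul, Finset.sum_add_distrib, hp1,
      Finset.sum_ite_eq' s b, if_pos hb, ← mul_assoc]
    have h2 := Real.add_one_le_exp (p b * (Real.exp θ - 1))
    have h3 : Real.exp (p b * (Real.exp θ - 1)) * Real.exp (-((Real.exp θ - 1) * p b)) = 1 := by
      rw [← Real.exp_add, ← Real.exp_zero]; congr 1; ring
    refine mul_le_of_le_one_left (hZ0 l).le ?_
    rw [add_comm] at h2
    exact (mul_le_mul_of_nonneg_right h2 (Real.exp_pos _).le).trans h3.le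
  have hYstep : ∀ l, ∑ a ∈ s, p a * Y (a :: l) ≤ Y l := by
    intro l
    by_cases h : ∃ t, t <:+ l ∧ A ≤ Z t
    · have : ∀ a, Y (a :: l) = 1 := fun a => by
        obtain ⟨t, ht, h⟩ := h
        exact if_pos ⟨t, ht.trans (List.suffix_cons a l), h⟩
      simp only [this, mul_one, hp1]
      rw [hY]; simp only [if_pos h]; exact le_rfl
    · have h1 : Y l = Z l / A := if_neg h
      rw [h1]
      calc ∑ a ∈ s, p a * Y (a :: l) ≤ ∑ a ∈ s, p a * (Z (a :: l) / A) := by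
            refine Finset.sum_le_sum fun a ha => mul_le_mul_of_nonneg_left ?_ (hp a ha)
            rw [hY]
            simp only
            split_ifs with h2
            · obtain ⟨t, ht, h2⟩ := h2
              rcases List.suffix_cons_iff.1 ht with rfl | ht
              · exact (one_le_div hA0).2 h2
              · exact absurd ⟨t, ht, h2⟩ h
            · exact le_rfl
        _ = (∑ a ∈ s, p a * Z (a :: l)) / A := by
            rw [Finset.sum_div]
            exact Finset.sum_congr rfl fun a _ => by ring
        _ ≤ Z l / A := by gcongr; exact hZstep l
  have hY0 : ∀ j, wordSum s p j Y ≤ A⁻¹ := by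
    intro j
    induction j with
    | zero =>
      have hZn : Z [] = 1 := by simp [hZ]
      change Y [] ≤ _
      rw [hY]
      simp only [List.suffix_nil, exists_eq_left, hZn, one_div]
      split_ifs with h
      · exact (one_le_inv₀ hA0).2 h
      · exact le_rfl
    | succ j ih =>
      rw [wordSum_succ']
      exact (wordSum_mono hp j fun l _ _ => hYstep l).trans ih
  have hfin : A⁻¹ = Real.exp (-x + θ ^ 2 * (p b * n)) := by
    rw [hA, ← Real.exp_neg]; ring_nf
  rw [← hfin]
  refine le_trans (wordSum_mono hp n fun l hl _ => ?_) (hY0 n)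
  by_cases h : ∃ t, t <:+ l ∧ x ≤ θ * (t.count b - p b * t.length)
  · rw [Set.indicator_of_mem (by exact h)]
    rw [hY]
    simp only
    rw [if_pos]
    · rfl
    · obtain ⟨t, ht, h⟩ := h
      refine ⟨t, ht, Real.exp_le_exp.2 ?_⟩
      have h1 := (abs_le.1 (Real.abs_exp_sub_one_sub_id_le hθ)).2
      have h2 : (t.length : ℝ) ≤ n := by exact_mod_cast hl ▸ ht.length_le
      have h3 : p b * t.length ≤ p b * n := mul_le_mul_of_nonneg_left h2 (hp b hb)
      have h4 : 0 ≤ p b * t.length := mul_nonneg (hp b hb) (Nat.cast_nonneg _)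
      nlinarith [mul_le_mul_of_nonneg_right h1 h4, mul_le_mul_of_nonneg_left h3 (sq_nonneg θ)]
  · rw [Set.indicator_of_notMem (by exact h)]
    rw [hY]
    simp only
    split_ifs
    · exact zero_le_one
    · exact (div_pos (hZ0 l) hA0).le

end WordProb

lemma wordSum_map {R : Type*} [CommSemiring R] {s s' : Finset ℕ} {p p' : ℕ → R} {φ : ℕ → ℕ}
    (h : ∀ G : ℕ → R, ∑ a ∈ s, p a * G (φ a) = ∑ a ∈ s', p' a * G (φ a)) (n : ℕ)
    (f : List ℕ → R) :
    wordSum s p n (fun l => f (l.map φ)) = wordSum s' p' n (fun l => f (l.map φ)) := by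
  induction n generalizing f with
  | zero => rfl
  | succ n ih =>
    simp only [wordSum, List.map_cons]
    rw [h fun b => wordSum s p n (fun l => f (b :: l.map φ))]
    exact Finset.sum_congr rfl fun a _ => by rw [ih fun l => f (φ a :: l)]

lemma wordSum_ofReal {s : Finset ℕ} {p : ℕ → ℝ} (hp : ∀ a ∈ s, 0 ≤ p a) (n : ℕ)
    {f : List ℕ → ℝ} (hf : ∀ l, 0 ≤ f l) :
    wordSum s (fun a => ENNReal.ofReal (p a)) n (fun l => ENNReal.ofReal (f l)) =
      ENNReal.ofReal (wordSum s p n f) := by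
  induction n generalizing f with
  | zero => rfl
  | succ n ih =>
    have h0 : ∀ a, 0 ≤ wordSum s p n (fun l => f (a :: l)) := fun a => by
      have := wordSum_mono hp n (f := fun _ => 0) fun l _ _ => hf (a :: l)
      rwa [wordSum_zero] at this
    simp only [wordSum]
    rw [ENNReal.ofReal_sum_of_nonneg fun a ha => mul_nonneg (hp a ha) (h0 a)]
    exact Finset.sum_congr rfl fun a ha => by
      rw [ih fun l => hf (a :: l), ENNReal.ofReal_mul (hp a ha)]

lemma tsum_ofReal_mul_pow {c z : ℝ} (hc : 0 ≤ c) (hz : 0 ≤ z) (hz1 : z < 1) :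
    ∑' q : ℕ, ENNReal.ofReal c * ENNReal.ofReal z ^ q = ENNReal.ofReal (c / (1 - z)) := by
  have h : HasSum (fun q : ℕ => c * z ^ q) (c / (1 - z)) :=
    (hasSum_geometric_of_lt_one hz hz1).mul_left c
  rw [← h.tsum_eq, ENNReal.ofReal_tsum_of_nonneg (fun q => by positivity) h.summable]
  exact tsum_congr fun q => by rw [ENNReal.ofReal_mul hc, ENNReal.ofReal_pow hz]

/-- Average over lists of `m` independent geometric variables of mean `e⁻¹`. -/
noncomputable def queueAvg (e : ℝ) (m : ℕ) (F : List ℕ → ℝ≥0∞) : ℝ≥0∞ :=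
  geoAvg (ENNReal.ofReal (e / (1 + e))) (ENNReal.ofReal (1 + e)⁻¹) m F

section QueueAvg

variable {e : ℝ}

lemma queueAvg_const (he : 0 < e) (m : ℕ) (c : ℝ≥0∞) : queueAvg e m (fun _ => c) = c := by
  refine geoAvg_const ?_ m c
  rw [tsum_ofReal_mul_pow (by positivity) (by positivity) (inv_lt_one_of_one_lt₀ (by linarith)),
    ← ENNReal.ofReal_one]
  congr 1
  field_simp
  ring_nf
  field_simp

lemma queueAvg_indicator_le (he : 0 < e) {s B : ℝ} (hs : s < 1) (hs' : 0 < 1 + e * s) (m : ℕ)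
    (E : Set (List ℕ)) (hE : ∀ Q ∈ E, 0 ≤ Real.log (1 + e * s) * (Q.sum - B)) :
    queueAvg e m (E.indicator 1) ≤
      ENNReal.ofReal (Real.exp (-(Real.log (1 + e * s) * B) - m * Real.log (1 - s))) := by
  set z := 1 + e * s with hz
  have hM : ∑' q : ℕ, ENNReal.ofReal (e / (1 + e)) *
      (ENNReal.ofReal (1 + e)⁻¹ * ENNReal.ofReal z) ^ q = ENNReal.ofReal (1 - s)⁻¹ := by
    rw [← ENNReal.ofReal_mul (by positivity), tsum_ofReal_mul_pow (by positivity) (by positivity)]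
    · congr 1
      have : 1 - s ≠ 0 := by linarith
      have h1 : 1 - (1 + e)⁻¹ * z = e * (1 - s) / (1 + e) := by rw [hz]; field_simp; ring
      rw [h1]
      field_simp
    · rw [inv_mul_lt_iff₀ (by positivity), hz]
      nlinarith
  calc queueAvg e m (E.indicator 1)
      ≤ queueAvg e m (fun Q => ENNReal.ofReal (Real.exp (-(Real.log z * B))) *
          ENNReal.ofReal z ^ Q.sum) := by
        refine geoAvg_mono m fun Q _ => ?_
        by_cases hQ : Q ∈ E
        · rw [Set.indicator_of_mem hQ, ← ENNReal.ofReal_pow hs'.le,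
            ← ENNReal.ofReal_mul (Real.exp_pos _).le, Pi.one_apply, ← ENNReal.ofReal_one]
          refine ENNReal.ofReal_le_ofReal ?_
          rw [← Real.exp_log (pow_pos hs' _), Real.log_pow, ← Real.exp_add]
          refine Real.one_le_exp ?_
          linarith [hE Q hQ]
        · rw [Set.indicator_of_notMem hQ]; exact zero_le
    _ = _ := by
        rw [queueAvg, geoAvg_mul_left, geoAvg_pow_sum hM, ← ENNReal.ofReal_pow
          (inv_nonneg.2 (by linarith)), ← ENNReal.ofReal_mul (Real.exp_pos _).le]
        congr 1
        rw [← Real.exp_log (pow_pos (inv_pos.2 (show 0 < 1 - s by linarith)) m), Real.log_pow,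
          Real.log_inv, ← Real.exp_add]
        ring_nf

lemma le_log_one_add {u : ℝ} (hu : 0 ≤ u) : u - u ^ 2 ≤ Real.log (1 + u) := by
  have h := Real.one_sub_inv_le_log_of_pos (show 0 < 1 + u by linarith)
  refine le_trans ?_ h
  have : 1 - (1 + u)⁻¹ = u / (1 + u) := by field_simp; ring
  rw [this, le_div_iff₀ (by linarith)]
  nlinarith [pow_nonneg hu 3]

lemma le_log_one_sub {u : ℝ} (hu' : u ≤ 1 / 4) :
    -u - 4 / 3 * u ^ 2 ≤ Real.log (1 - u) := by
  have h := Real.one_sub_inv_le_log_of_pos (show 0 < 1 - u by linarith)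
  refine le_trans ?_ h
  have h1 : 1 - u ≠ 0 := by linarith
  have : 1 - (1 - u)⁻¹ = -u / (1 - u) := by field_simp; ring
  rw [this, le_div_iff₀ (by linarith)]
  nlinarith [mul_nonneg (sq_nonneg u) (show 0 ≤ 1 - 4 * u by linarith)]

lemma queueAvg_sum_ge (he : 0 < e) (he1 : e ≤ 1) {y : ℝ} (hy : 0 ≤ y) (hy1 : y ≤ 1) (m : ℕ) :
    queueAvg e m ({Q : List ℕ | m / e * (1 + y) ≤ Q.sum}.indicator 1) ≤
      ENNReal.ofReal (Real.exp (-(m * y ^ 2 / 24))) := by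
  have h1 := le_log_one_add (show 0 ≤ e * (y / 4) by positivity)
  have h2 := le_log_one_sub (show y / 4 ≤ 1 / 4 by linarith)
  have h0 : 0 ≤ Real.log (1 + e * (y / 4)) := Real.log_nonneg (by nlinarith)
  refine (queueAvg_indicator_le he (s := y / 4) (B := m / e * (1 + y)) (by linarith)
    (by positivity) m _ fun Q hQ => mul_nonneg h0 (sub_nonneg.2 hQ)).trans
    (ENNReal.ofReal_le_ofReal (Real.exp_le_exp.2 ?_))
  have h3 : y / 4 - (y / 4) ^ 2 ≤ Real.log (1 + e * (y / 4)) / e := by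
    rw [le_div_iff₀ he]
    nlinarith [mul_le_mul_of_nonneg_left he1 (mul_nonneg he.le (sq_nonneg (y / 4)))]
  have h4 : Real.log (1 + e * (y / 4)) * (m / e * (1 + y)) =
      m * ((1 + y) * (Real.log (1 + e * (y / 4)) / e)) := by ring
  rw [h4]
  have h5 : y ^ 2 / 24 ≤
      (1 + y) * (Real.log (1 + e * (y / 4)) / e) + Real.log (1 - y / 4) := by
    nlinarith [mul_le_mul_of_nonneg_left h3 (show 0 ≤ 1 + y by linarith), mul_nonneg hy hy,
      mul_nonneg (mul_nonneg hy hy) (sub_nonneg.2 hy1)]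
  nlinarith [mul_le_mul_of_nonneg_left h5 (Nat.cast_nonneg (α := ℝ) m)]

lemma queueAvg_sum_le (he : 0 < e) (he1 : e ≤ 1) {y : ℝ} (hy : 0 ≤ y) (hy1 : y ≤ 1) (m : ℕ) :
    queueAvg e m ({Q : List ℕ | Q.sum ≤ m / e * (1 - y)}.indicator 1) ≤
      ENNReal.ofReal (Real.exp (-(m * y ^ 2 / 24))) := by
  have hu : e * (y / 4) ≤ 1 / 4 := by nlinarith
  have h1 := le_log_one_sub hu
  have h2 := le_log_one_add (show 0 ≤ y / 4 by positivity)
  have h0 : Real.log (1 - e * (y / 4)) ≤ 0 :=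
    Real.log_nonpos (by linarith) (by nlinarith [mul_nonneg he.le hy])
  have hs : 1 + e * -(y / 4) = 1 - e * (y / 4) := by ring
  refine (queueAvg_indicator_le he (s := -(y / 4)) (B := m / e * (1 - y)) (by linarith)
    (by linarith) m _ fun Q hQ => ?_).trans (ENNReal.ofReal_le_ofReal (Real.exp_le_exp.2 ?_))
  · rw [hs]
    exact mul_nonneg_of_nonpos_of_nonpos h0 (sub_nonpos.2 hQ)
  rw [hs, sub_neg_eq_add]
  have h3 : -(y / 4) - 4 / 3 * (y / 4) ^ 2 ≤ Real.log (1 - e * (y / 4)) / e := by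
    rw [le_div_iff₀ he]
    nlinarith [mul_le_mul_of_nonneg_left he1 (mul_nonneg he.le (sq_nonneg (y / 4)))]
  have h4 : Real.log (1 - e * (y / 4)) * (m / e * (1 - y)) =
      m * ((1 - y) * (Real.log (1 - e * (y / 4)) / e)) := by ring
  rw [h4]
  have h5 : y ^ 2 / 24 ≤
      (1 - y) * (Real.log (1 - e * (y / 4)) / e) + Real.log (1 + y / 4) := by
    nlinarith [mul_le_mul_of_nonneg_left h3 (show 0 ≤ 1 - y by linarith), mul_nonneg hy hy,
      mul_nonneg (mul_nonneg hy hy) hy]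
  nlinarith [mul_le_mul_of_nonneg_left h5 (Nat.cast_nonneg (α := ℝ) m)]

end QueueAvg

/-- Letter weights driving a stationary tandem of `m` queues whose lengths have mean `e⁻¹`. -/
noncomputable def driver (k m : ℕ) (e : ℝ) (a : ℕ) : ℝ :=
  if a = 0 then (1 + e) / k else if a ≤ m then (k : ℝ)⁻¹ else 1 - (1 + e) / k - m / k

section Driver

variable {k m : ℕ} {e : ℝ}

lemma driver_nonneg (he : 0 ≤ e) (he1 : e ≤ 1) (hk : m + 2 ≤ k) (a : ℕ) : 0 ≤ driver k m e a := by
  rw [driver]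
  split_ifs
  · positivity
  · positivity
  · have hk' : (m : ℝ) + 2 ≤ k := by exact_mod_cast hk
    have hk0 : (0 : ℝ) < k := by exact_mod_cast (show 0 < k by omega)
    rw [sub_sub, ← add_div, sub_nonneg, div_le_one hk0]
    linarith

lemma sum_driver_mul (G : ℕ → ℝ) :
    ∑ a ∈ Finset.range (m + 2), driver k m e a * G a =
      (1 + e) / k * G 0 + ∑ a ∈ Finset.range m, (k : ℝ)⁻¹ * G (a + 1) +
        (1 - (1 + e) / k - m / k) * G (m + 1) := by
  rw [Finset.sum_range_succ, Finset.sum_range_succ']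
  have h : ∀ a ∈ Finset.range m, driver k m e (a + 1) * G (a + 1) = (k : ℝ)⁻¹ * G (a + 1) := by
    intro a ha
    have := Finset.mem_range.1 ha
    rw [driver, if_neg (by omega), if_pos (by omega)]
  rw [Finset.sum_congr rfl h]
  simp only [driver, if_true]
  rw [if_neg (by omega), if_neg (by omega)]
  ring

lemma sum_driver : ∑ a ∈ Finset.range (m + 2), driver k m e a = 1 := by
  have := sum_driver_mul (k := k) (m := m) (e := e) (fun _ => 1)
  simp only [mul_one, Finset.sum_const, Finset.card_range, nsmul_eq_mul] at this
  rw [this]; ring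

/-- Replace the letters above `m` by `0`. -/
def cutoff (m a : ℕ) : ℕ := if a ≤ m then a else 0

lemma idl_map_cutoff (m : ℕ) (l : List ℕ) {r : ℕ} (hr : 1 ≤ r) :
    idl m (l.map (cutoff m)) r = idl m l r := by
  induction l generalizing r with
  | nil => rfl
  | cons a l ih =>
    simp only [List.map_cons, idl]
    by_cases ha : a ≤ m
    · rw [cutoff, if_pos ha, ih hr]
      split_ifs with h
      · rw [ih (by omega)]
      · rfl
    · rw [cutoff, if_neg ha, if_neg (by omega), if_neg (by omega), ih hr]

lemma sum_driver_cutoff (hk : m + 2 ≤ k) (G : ℕ → ℝ) :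
    ∑ a ∈ Finset.range (m + 2), driver k m e a * G (cutoff m a) =
      ∑ a ∈ Finset.Icc 1 k, (k : ℝ)⁻¹ * G (cutoff m a) := by
  have hk0 : (0 : ℝ) < k := by exact_mod_cast (show 0 < k by omega)
  rw [sum_driver_mul (fun a => G (cutoff m a)), ← Finset.mul_sum, ← Finset.mul_sum]
  have h1 : ∑ a ∈ Finset.Icc 1 k, G (cutoff m a) =
      ∑ a ∈ Finset.range m, G (cutoff m (a + 1)) + (k - m) * G 0 := by
    have h2 : Finset.Icc 1 k = Finset.Ico 1 (k + 1) := by ext; simp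
    rw [h2, Finset.sum_Ico_eq_sum_range, show k + 1 - 1 = m + (k - m) by omega,
      Finset.sum_range_add]
    congr 1
    · exact Finset.sum_congr rfl fun a _ => by rw [add_comm]
    · rw [Finset.sum_congr rfl (g := fun _ => G 0)]
      · rw [Finset.sum_const, Finset.card_range, nsmul_eq_mul, Nat.cast_sub (by omega)]
      · intro a _
        rw [cutoff, if_neg (by omega)]
  rw [h1, show cutoff m 0 = 0 by simp [cutoff], show cutoff m (m + 1) = 0 by simp [cutoff]]
  field_simp
  ring

lemma wordProb_eq_driver (hk : m + 2 ≤ k) (n : ℕ) {S : Set (List ℕ)}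
    (hS : ∀ l : List ℕ, l.map (cutoff m) ∈ S ↔ l ∈ S) :
    wordProb (Finset.Icc 1 k) (fun _ => (k : ℝ)⁻¹) n S =
      wordProb (Finset.range (m + 2)) (driver k m e) n S := by
  have h : (S.indicator 1 : List ℕ → ℝ) = fun l => S.indicator 1 (l.map (cutoff m)) := by
    funext l
    by_cases hl : l ∈ S
    · rw [Set.indicator_of_mem hl, Set.indicator_of_mem ((hS l).2 hl)]; rfl
    · rw [Set.indicator_of_notMem hl, Set.indicator_of_notMem (fun h => hl ((hS l).1 h))]
  rw [wordProb, wordProb, h]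
  exact (wordSum_map (sum_driver_cutoff hk) n _).symm

/-- Transfer from a stationary tandem of queues to uniformly random words. -/
lemma wordProb_le_of_queue (he : 0 < e) (he1 : e ≤ 1) (hk : m + 2 ≤ k) (n : ℕ)
    {S V A A₀ : Set (List ℕ)} {v a a₀ : ℝ} (ha : 0 ≤ a) (ha₀ : 0 ≤ a₀)
    (hS : ∀ l : List ℕ, l.map (cutoff m) ∈ S ↔ l ∈ S)
    (hV : wordProb (Finset.range (m + 2)) (driver k m e) n V ≤ v)
    (hA : queueAvg e m (A.indicator 1) ≤ ENNReal.ofReal a)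
    (hA₀ : queueAvg e m (A₀.indicator 1) ≤ ENNReal.ofReal a₀)
    (h : ∀ Q l : List ℕ, Q.length = m → l.length = n → l ∈ S →
      l ∈ V ∨ qrun Q l ∈ A ∨ Q ∈ A₀) :
    wordProb (Finset.Icc 1 k) (fun _ => (k : ℝ)⁻¹) n S ≤ v + a + a₀ := by
  rw [wordProb_eq_driver (e := e) hk n hS]
  have hd := driver_nonneg he.le he1 hk
  set p : ℕ → ℝ≥0∞ := fun a => ENNReal.ofReal (driver k m e a) with hp
  have hp1 : ∑ a ∈ Finset.range (m + 2), p a = 1 := by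
    rw [hp, ← ENNReal.ofReal_sum_of_nonneg fun a _ => hd a, sum_driver, ENNReal.ofReal_one]
  have hμ : ∀ a < m, p (a + 1) = p 0 * ENNReal.ofReal (1 + e)⁻¹ := by
    intro a ha
    rw [hp]
    simp only
    rw [← ENNReal.ofReal_mul (hd 0), driver, if_neg (by omega), if_pos (by omega), driver,
      if_pos rfl]
    congr 1
    field_simp
  have hind : ∀ E : Set (List ℕ), wordSum (Finset.range (m + 2)) p n (E.indicator 1) =
      ENNReal.ofReal (wordProb (Finset.range (m + 2)) (driver k m e) n E) := by
    intro E
    rw [wordProb, ← wordSum_ofReal (fun a _ => hd a) n (f := E.indicator 1)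
      (fun l => Set.indicator_nonneg (fun _ _ => zero_le_one) l)]
    congr 1
    funext l
    by_cases hl : l ∈ E <;> simp [hl]
  have hv : 0 ≤ v := (wordProb_nonneg (fun a _ => hd a) n V).trans hV
  rw [← ENNReal.ofReal_le_ofReal_iff (by positivity), ENNReal.ofReal_add (by positivity) ha₀,
    ENNReal.ofReal_add hv ha, ← hind]
  calc wordSum (Finset.range (m + 2)) p n (S.indicator 1)
      = queueAvg e m (fun _ => wordSum (Finset.range (m + 2)) p n (S.indicator 1)) :=
        (queueAvg_const he m _).symm
    _ ≤ queueAvg e m (fun Q => wordSum (Finset.range (m + 2)) p n (V.indicator 1) +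
          wordSum (Finset.range (m + 2)) p n (fun l => A.indicator 1 (qrun Q l)) +
          A₀.indicator 1 Q) := by
        refine geoAvg_mono m fun Q hQ => ?_
        rw [← wordSum_const (p := p) (s := Finset.range (m + 2)) hp1 n (A₀.indicator 1 Q),
          ← wordSum_add, ← wordSum_add]
        refine wordSum_mono (fun _ _ => zero_le) n fun l hl _ => ?_
        by_cases hlS : l ∈ S
        · rw [Set.indicator_of_mem hlS]
          rcases h Q l hQ hl hlS with h | h | h
          · rw [Set.indicator_of_mem h, add_assoc]; exact le_self_add
          · rw [Set.indicator_of_mem h, add_comm (V.indicator 1 l), add_assoc]; exact le_self_add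
          · rw [Set.indicator_of_mem h]; exact le_add_self
        · rw [Set.indicator_of_notMem hlS]; exact zero_le
    _ = wordSum (Finset.range (m + 2)) p n (V.indicator 1) + queueAvg e m (A.indicator 1) +
          queueAvg e m (A₀.indicator 1) := by
        have h1 := geoAvg_qrun (σ := ENNReal.ofReal (e / (1 + e))) hp1 hμ n (A.indicator 1)
        have h2 := queueAvg_const he m (wordSum (Finset.range (m + 2)) p n (V.indicator 1))
        simp only [queueAvg] at h2 ⊢
        rw [geoAvg_add, geoAvg_add, h2, h1]
    _ ≤ _ := by
        rw [hind]
        gcongr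

end Driver

section Suffixes

variable {k m : ℕ} {e : ℝ}

lemma map_cutoff_mem_iff (P : ℕ → ℕ → Prop) (l : List ℕ) :
    (∃ t, t <:+ l.map (cutoff m) ∧ P t.length (idl m t 1)) ↔
      ∃ t, t <:+ l ∧ P t.length (idl m t 1) := by
  constructor
  · rintro ⟨t, ht, h⟩
    obtain ⟨u, hu, rfl⟩ := List.suffix_map_iff.1 ht
    exact ⟨u, hu, by simpa [idl_map_cutoff] using h⟩
  · rintro ⟨t, ht, h⟩
    exact ⟨t.map (cutoff m), ht.map _, by simpa [idl_map_cutoff] using h⟩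

lemma sum_driver_zero (k m : ℕ) (e : ℝ) : driver k m e 0 = (1 + e) / k := if_pos rfl

lemma wordProb_idl_ge_le (hm : 1 ≤ m) (hk : m + 2 ≤ k) (he : 0 < e) (he1 : e ≤ 1) {y : ℝ}
    (hy : 0 ≤ y) (hy1 : y ≤ 1) {θ : ℝ} (hθ : 0 ≤ θ) (hθ1 : θ ≤ 1) (x : ℝ) (n : ℕ) :
    wordProb (Finset.Icc 1 k) (fun _ => (k : ℝ)⁻¹) n {l | ∃ t, t <:+ l ∧
      (1 + e) / k * t.length + x + m / e * (1 + y) ≤ idl m t 1} ≤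
      Real.exp (-(θ * x) + θ ^ 2 * ((1 + e) / k * n)) + Real.exp (-(m * y ^ 2 / 24)) := by
  rw [← add_zero (_ + Real.exp (-(m * y ^ 2 / 24)))]
  have hd := driver_nonneg he.le he1 hk
  have hV := wordProb_count_le (fun a _ => hd a) sum_driver
    (Finset.mem_range.2 (show 0 < m + 2 by omega)) (θ := θ) (by rwa [abs_of_nonneg hθ]) (θ * x) n
  rw [sum_driver_zero] at hV
  refine wordProb_le_of_queue he he1 hk n (Real.exp_pos _).le le_rfl
    (fun l => map_cutoff_mem_iff (fun i j => (1 + e) / k * i + x + m / e * (1 + y) ≤ j) l) hV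
    (queueAvg_sum_ge he he1 hy hy1 m) (A₀ := ∅) (by simp [queueAvg_const he]) ?_
  rintro Q l hQ hl ⟨t, ⟨p, rfl⟩, h⟩
  have h1 := idl_le_sum_qrun Q p t (by rintro rfl; simp at hQ; omega)
  rw [hQ] at h1
  have h2 : (idl m t 1 : ℝ) ≤ (qrun Q (p ++ t)).sum + t.count 0 := by exact_mod_cast h1
  by_cases h3 : (m / e * (1 + y) : ℝ) ≤ (qrun Q (p ++ t)).sum
  · exact Or.inr (Or.inl h3)
  · refine Or.inl ⟨t, List.suffix_append p t, mul_le_mul_of_nonneg_left ?_ hθ⟩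
    linarith

lemma wordProb_idl_lt_le (hm : 1 ≤ m) (hk : m + 2 ≤ k) (he : 0 < e) (he1 : e ≤ 1) {y : ℝ}
    (hy : 0 ≤ y) (hy1 : y ≤ 1) {θ : ℝ} (hθ : 0 ≤ θ) (hθ1 : θ ≤ 1) (x : ℝ) (n : ℕ) :
    wordProb (Finset.Icc 1 k) (fun _ => (k : ℝ)⁻¹) n {l | ¬ ∃ t, t <:+ l ∧
      (1 + e) / k * t.length - x + m / e * (1 - y) ≤
        idl m t 1 + if t.length = n then m / e * (1 + y) else 0} ≤
      Real.exp (-(θ * x) + θ ^ 2 * ((1 + e) / k * n)) + Real.exp (-(m * y ^ 2 / 24)) +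
        Real.exp (-(m * y ^ 2 / 24)) := by
  have hd := driver_nonneg he.le he1 hk
  have hV := wordProb_count_le (fun a _ => hd a) sum_driver
    (Finset.mem_range.2 (show 0 < m + 2 by omega)) (θ := -θ) (by rwa [abs_neg, abs_of_nonneg hθ])
    (θ * x) n
  rw [sum_driver_zero, neg_sq] at hV
  refine wordProb_le_of_queue he he1 hk n (Real.exp_pos _).le (Real.exp_pos _).le
    (fun l => not_congr (map_cutoff_mem_iff (fun i j => (1 + e) / k * i - x + m / e * (1 - y) ≤
      j + if i = n then m / e * (1 + y) else 0) l)) hV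
    (queueAvg_sum_le he he1 hy hy1 m) (queueAvg_sum_ge he he1 hy hy1 m) ?_
  intro Q l hQ hl hnot
  by_contra! hcon
  obtain ⟨hc1, hc2, hc3⟩ := hcon
  have hQ0 : Q ≠ [] := by rintro rfl; simp at hQ; omega
  have hm0 : (0 : ℝ) ≤ m / e * (1 + y) := by positivity
  have hc1' : ∀ t, t <:+ l → (1 + e) / k * t.length - x ≤ t.count 0 := by
    intro t ht
    by_contra! hlt
    exact hc1 ⟨t, ht, by
      rw [neg_mul, ← mul_neg]; exact mul_le_mul_of_nonneg_left (by linarith) hθ⟩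
  have hc2' : (m / e * (1 - y) : ℝ) < (qrun Q l).sum := not_le.1 hc2
  have hc3' : (Q.sum : ℝ) < m / e * (1 + y) := not_le.1 hc3
  apply hnot
  rcases exists_sum_qrun_le Q l hQ0 with ⟨p, t, rfl, h⟩ | h
  · rw [hQ] at h
    have h' : ((qrun Q (p ++ t)).sum : ℝ) + t.count 0 ≤ idl m t 1 := by exact_mod_cast h
    refine ⟨t, List.suffix_append p t, ?_⟩
    have h0 : (0 : ℝ) ≤ if t.length = n then m / e * (1 + y) else 0 := by
      split_ifs <;> [exact hm0; exact le_rfl]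
    linarith [hc1' t (List.suffix_append p t)]
  · rw [hQ] at h
    have h' : ((qrun Q l).sum : ℝ) + l.count 0 ≤ Q.sum + idl m l 1 := by exact_mod_cast h
    refine ⟨l, List.suffix_refl l, ?_⟩
    rw [if_pos hl]
    linarith [hc1' l (List.suffix_refl l)]

end Suffixes

lemma wordAvg_count_one {k : ℕ} (hk : 1 ≤ k) (n : ℕ) :
    wordAvg k n (fun l => (l.count 1 : ℝ)) = n / k := by
  have hk0 : (k : ℝ) ≠ 0 := by positivity
  have hp := sum_inv_Icc (show 0 < k from hk)
  induction n with
  | zero => simp [wordAvg, wordSum]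
  | succ n ih =>
    rw [wordAvg, wordSum_succ']
    have h : ∀ l : List ℕ, ∑ a ∈ Finset.Icc 1 k, (k : ℝ)⁻¹ * ((a :: l).count 1 : ℝ) =
        l.count 1 + (k : ℝ)⁻¹ := by
      intro l
      have h1 : ∀ a ∈ Finset.Icc 1 k, (k : ℝ)⁻¹ * ((a :: l).count 1 : ℝ) =
          (k : ℝ)⁻¹ * l.count 1 + if a = 1 then (k : ℝ)⁻¹ else 0 := by
        intro a _
        rw [List.count_cons]
        by_cases ha : a = 1
        · simp [ha]; ring
        · simp [ha]
      rw [Finset.sum_congr rfl h1, Finset.sum_add_distrib, ← Finset.sum_mul, hp, one_mul,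
        Finset.sum_ite_eq' (Finset.Icc 1 k) 1, if_pos (by simp [hk])]
    simp only [h]
    rw [wordSum_add, wordSum_const hp]
    rw [wordAvg] at ih
    rw [ih]
    push_cast
    field_simp

/-- Comparison of one lower and three upper linear bounds around the optimal slope. -/
lemma bounds_of_slopes {τ v : ℝ} (hτ : 0 < τ) (hτ1 : τ ≤ 1 / 7)
    (h1 : v + 1 - 2 * τ ^ 2 ≤ (1 + τ) * v + τ ^ 2 + (1 + τ ^ 2) / (1 + τ))
    (h2 : v + 1 - 2 * τ ^ 2 ≤ (1 - τ) * v + τ ^ 2 + (1 + τ ^ 2) / (1 - τ)) :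
    1 - 5 * τ ≤ v ∧ v ≤ 1 + 7 * τ := by
  have ha : (1 + τ ^ 2) / (1 + τ) ≤ 1 - τ * (1 - 2 * τ) := by
    rw [div_le_iff₀ (by linarith)]
    nlinarith [pow_pos hτ 3]
  have hb : (1 + τ ^ 2) / (1 - τ) ≤ 1 + τ * (1 + 3 * τ) := by
    rw [div_le_iff₀ (by linarith)]
    nlinarith [pow_pos hτ 3]
  constructor
  · by_contra! h
    nlinarith
  · by_contra! h
    nlinarith

/-- A long increasing subsequence ends in a word of length `J` when the upper and lower bounds
on suffixes hold in a longer word. -/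
lemma idl_drop_ge {k m J : ℕ} (hm : 1 ≤ m) (hk : 0 < k) (hJ : 0 < J) {τ e G : ℝ} (hτ : 0 < τ)
    (hτ1 : τ ≤ 1 / 7) (he : 0 < e) (heJ : e ^ 2 * J = (1 + 7 * τ) * (k * m)) (hG : m / e = G)
    {l : List ℕ} (hl : l.length = 12 * J)
    (hlow : ∃ t, t <:+ l ∧ (1 + e) / k * t.length - τ ^ 2 * G + m / e * (1 - τ ^ 2) ≤
        idl m t 1 + if t.length = 12 * J then m / e * (1 + τ ^ 2) else 0)
    (hup : ∀ α ∈ ({1 + τ, 1 - τ, 1 / 2} : Set ℝ), ∀ t, t <:+ l → (idl m t 1 : ℝ) ≤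
      (1 + α * e) / k * t.length + τ ^ 2 * G + m / (α * e) * (1 + τ ^ 2))
    (hone : ∀ t, t <:+ l → (t.count 1 : ℝ) ≤ (k : ℝ)⁻¹ * t.length + τ ^ 2 * G) :
    ((l.drop (11 * J)).count 1 : ℝ) + G * (2 - 6 * τ) ≤ idl m (l.drop (11 * J)) 1 := by
  have hm0 : (0 : ℝ) < m := by exact_mod_cast hm
  have hk0 : (0 : ℝ) < k := by exact_mod_cast hk
  have hJ0 : (0 : ℝ) < J := by exact_mod_cast hJ
  have hG0 : 0 < G := hG ▸ by positivity
  have hGe : m = G * e := by rw [← hG]; field_simp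
  obtain ⟨t, ht, hlow⟩ := hlow
  rw [hG] at hlow
  obtain ⟨v, hv⟩ : ∃ v : ℝ, e * t.length = k * (v * G) := ⟨e * t.length / (k * G), by field_simp⟩
  have hv' : ∀ α : ℝ, (1 + α * e) / k * t.length = (k : ℝ)⁻¹ * t.length + G * (α * v) := by
    intro α
    have : α * (e * t.length) = α * (k * (v * G)) := by rw [hv]
    field_simp
    linarith
  have hlow' := hv' 1
  rw [one_mul] at hlow'
  rw [hlow'] at hlow
  have hub : ∀ α : ℝ, 0 < α → α ∈ ({1 + τ, 1 - τ, 1 / 2} : Set ℝ) → (idl m t 1 : ℝ) ≤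
      (k : ℝ)⁻¹ * t.length + G * (α * v + τ ^ 2 + (1 + τ ^ 2) / α) := by
    intro α hα hmem
    have h := hup α hmem t ht
    rw [hv', show m / (α * e) = G / α by rw [← hG]; field_simp] at h
    refine h.trans (le_of_eq ?_)
    ring
  have hω : τ ^ 2 ≤ 1 / 49 := by nlinarith
  have hlen : t.length ≠ 12 * J := by
    intro hlen
    rw [if_pos hlen] at hlow
    have h := hub (1 / 2) (by norm_num) (by simp)
    have hvT : (12 : ℝ) ≤ v := by
      have h1 : (t.length : ℝ) = 12 * J := by exact_mod_cast hlen
      have h2 : e * (e * t.length) = k * m * v := by rw [hv, hGe]; ring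
      rw [h1, show e * (e * (12 * J)) = 12 * (e ^ 2 * J) by ring, heJ] at h2
      have h3 : 12 * (1 + 7 * τ) = v := by
        have : (k * m : ℝ) ≠ 0 := by positivity
        apply mul_left_cancel₀ this
        linarith
      linarith
    have h' : G * (v + 1 - 2 * τ ^ 2 - (1 + τ ^ 2)) ≤
        G * (1 / 2 * v + τ ^ 2 + (1 + τ ^ 2) / (1 / 2)) := by linarith
    have := le_of_mul_le_mul_left h' hG0
    linarith
  rw [if_neg hlen, add_zero] at hlow
  have hub' : ∀ α : ℝ, 0 < α → α ∈ ({1 + τ, 1 - τ, 1 / 2} : Set ℝ) →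
      v + 1 - 2 * τ ^ 2 ≤ α * v + τ ^ 2 + (1 + τ ^ 2) / α := by
    intro α hα hmem
    refine le_of_mul_le_mul_left ?_ hG0
    linarith [hub α hα hmem]
  obtain ⟨hv1, hv2⟩ := bounds_of_slopes hτ hτ1 (hub' (1 + τ) (by linarith) (by simp))
    (hub' (1 - τ) (by linarith) (by simp))
  have hlenJ : t.length ≤ J := by
    have h2 : e ^ 2 * t.length = k * m * v := by rw [pow_two, mul_assoc, hv, hGe]; ring
    have h3 : e ^ 2 * t.length ≤ e ^ 2 * J := by
      rw [h2, heJ, mul_comm (1 + 7 * τ)]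
      gcongr
    exact_mod_cast le_of_mul_le_mul_left h3 (by positivity)
  obtain ⟨p, hp⟩ : t <:+ l.drop (11 * J) := by
    refine List.suffix_of_suffix_length_le ht (List.drop_suffix _ _) ?_
    rw [List.length_drop]
    omega
  rw [← hp]
  have h1 : (p.count 1 : ℝ) + idl m t 1 ≤ idl m (p ++ t) 1 := by
    exact_mod_cast count_one_add_idl_le hm p t
  have h2 := hone t ht
  rw [List.count_append]
  push_cast
  have h3 : G * (2 - 6 * τ) ≤ G * (v + 1 - 3 * τ ^ 2) := by
    refine mul_le_mul_of_nonneg_left ?_ hG0.le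
    nlinarith
  linarith

lemma wordSum_add_mul_le {s : Finset ℕ} {p : ℕ → ℝ} (f : List ℕ → ℝ) (hp : ∀ a ∈ s, 0 ≤ p a)
    (hp1 : ∑ a ∈ s, p a = 1) (n : ℕ) {g : List ℕ → ℝ} {c : ℝ} (E : Set (List ℕ))
    (h0 : ∀ l, g l ≤ f l) (h : ∀ l : List ℕ, l.length = n → l ∉ E → g l + c ≤ f l) :
    wordSum s p n g + c * (1 - wordProb s p n E) ≤ wordSum s p n f := by
  have : wordSum s p n g + c * (1 - wordProb s p n E) + c * wordProb s p n E ≤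
      wordSum s p n f + c * wordProb s p n E := by
    rw [wordProb, ← wordSum_mul_left, ← wordSum_add]
    have h1 : wordSum s p n g + c * (1 - wordSum s p n (E.indicator 1)) +
        wordSum s p n (fun l => c * E.indicator 1 l) = wordSum s p n (fun l => g l + c) := by
      rw [wordSum_mul_left, wordSum_add, wordSum_const hp1]; ring
    rw [h1]
    refine wordSum_mono hp n fun l hl _ => ?_
    by_cases hE : l ∈ E
    · rw [Set.indicator_of_mem hE, Pi.one_apply, mul_one]
      linarith [h0 l]
    · rw [Set.indicator_of_notMem hE]
      linarith [h l hl hE]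
  linarith

lemma wordProb_le_one {s : Finset ℕ} {p : ℕ → ℝ} (hp : ∀ a ∈ s, 0 ≤ p a)
    (hp1 : ∑ a ∈ s, p a = 1) (n : ℕ) (E : Set (List ℕ)) : wordProb s p n E ≤ 1 := by
  rw [← wordSum_const hp1 n 1]
  exact wordSum_mono hp n fun l _ _ => Set.indicator_le_self' (fun _ _ => zero_le_one) l

lemma sqrt_mul_slope_le {τ e G k m J : ℝ} (hτ : 0 < τ) (hτ1 : τ ≤ 1 / 7) (hk : 0 < k)
    (hG : 0 < G) (hGe : G * e = m) (heJ : e ^ 2 * J = (1 + 7 * τ) * (k * m)) :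
    √(m * J / k) * (1 - 7 / 2 * τ) ≤ G := by
  have h1 : m * J / k = (1 + 7 * τ) * G ^ 2 ∨ m = 0 := by
    by_cases hm : m = 0
    · exact Or.inr hm
    · left
      rw [div_eq_iff hk.ne']
      apply mul_left_cancel₀ hm
      calc m * (m * J) = G ^ 2 * (e ^ 2 * J) := by rw [← hGe]; ring
        _ = m * ((1 + 7 * τ) * G ^ 2 * k) := by rw [heJ]; ring
  rcases h1 with h1 | h1
  · rw [h1, Real.sqrt_mul (by positivity), Real.sqrt_sq hG.le]
    have h2 : √(1 + 7 * τ) ≤ 1 + 7 / 2 * τ := Real.sqrt_le_iff.2 ⟨by positivity, by nlinarith⟩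
    have h3 : √(1 + 7 * τ) * (1 - 7 / 2 * τ) ≤ 1 := by
      refine (mul_le_mul_of_nonneg_right h2 (by linarith)).trans ?_
      nlinarith
    nlinarith
  · rw [h1]
    simpa using hG.le

lemma mul_slope_le {τ G b w P : ℝ} (hτ : 0 < τ) (hτ1 : τ ≤ 1 / 7) (hG : 0 < G) (hb : 0 ≤ b)
    (hw : 0 ≤ w) (hwG : w * (1 - 7 / 2 * τ) ≤ G) (hP : P ≤ 10 * b) (hP1 : P ≤ 1) :
    2 * w * (1 - 7 * τ - 10 * b) ≤ G * (2 - 6 * τ) * (1 - P) := by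
  by_cases hsmall : 1 - 7 * τ - 10 * b ≤ 0
  · have h1 := mul_nonneg hw (neg_nonneg.2 hsmall)
    have h2 := mul_nonneg (mul_nonneg hG.le (show 0 ≤ 2 - 6 * τ by linarith))
      (sub_nonneg.2 hP1)
    linarith
  · push Not at hsmall
    calc 2 * w * (1 - 7 * τ - 10 * b) ≤ 2 * w * ((1 - 7 * τ) * (1 - 10 * b)) := by
          refine mul_le_mul_of_nonneg_left ?_ (by linarith)
          nlinarith [mul_nonneg hτ.le hb]
      _ = w * (2 * (1 - 7 * τ)) * (1 - 10 * b) := by ring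
      _ ≤ w * ((1 - 7 / 2 * τ) * (2 - 6 * τ)) * (1 - 10 * b) := by
          refine mul_le_mul_of_nonneg_right (mul_le_mul_of_nonneg_left ?_ hw) (by linarith)
          nlinarith
      _ = w * (1 - 7 / 2 * τ) * (2 - 6 * τ) * (1 - 10 * b) := by ring
      _ ≤ G * (2 - 6 * τ) * (1 - P) :=
          mul_le_mul (mul_le_mul_of_nonneg_right hwG (by linarith)) (by linarith) (by linarith)
            (mul_nonneg hG.le (by linarith))

/-- The mean length of a longest increasing subsequence of a random word. -/
lemma wordAvg_idl_ge {k m J : ℕ} (hm : 1 ≤ m) (hk : m + 2 ≤ k) (hJ : 8 * (k * m) ≤ J) {τ : ℝ}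
    (hτ : 0 < τ) (hτ1 : τ ≤ 1 / 7) :
    (J : ℝ) / k + 2 * √(m * J / k) * (1 - 7 * τ - 10 * Real.exp (-(τ ^ 4 * m / 192))) ≤
      wordAvg k J (fun l => (idl m l 1 : ℝ)) := by
  have hk1 : 0 < k := by omega
  have hJ1 : 0 < J := lt_of_lt_of_le (by positivity) hJ
  have hm0 : (0 : ℝ) < m := by exact_mod_cast hm
  have hk0 : (0 : ℝ) < k := by exact_mod_cast hk1
  have hJ0 : (0 : ℝ) < J := by exact_mod_cast hJ1
  have hJ' : (8 : ℝ) * (k * m) ≤ J := by exact_mod_cast hJ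
  have hω : τ ^ 2 ≤ 1 / 49 := by nlinarith
  set e : ℝ := √((1 + 7 * τ) * (k * m) / J) with he_def
  have he : 0 < e := Real.sqrt_pos.2 (by positivity)
  have he2 : e ^ 2 = (1 + 7 * τ) * (k * m) / J := Real.sq_sqrt (by positivity)
  have heJ : e ^ 2 * J = (1 + 7 * τ) * (k * m) := by rw [he2]; field_simp
  have he_half : e ≤ 1 / 2 := by
    refine Real.sqrt_le_iff.2 ⟨by norm_num, ?_⟩
    rw [div_le_iff₀ hJ0]
    nlinarith [mul_pos hk0 hm0]
  set G : ℝ := m / e with hG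
  have hG0 : 0 < G := by positivity
  have hGe : G * e = m := by rw [hG]; field_simp
  set θ : ℝ := τ ^ 2 * e / 96 with hθ_def
  have hθ : 0 ≤ θ := by positivity
  have hθ1 : θ ≤ 1 := by rw [hθ_def]; nlinarith [mul_nonneg (sq_nonneg τ) he.le]
  set b : ℝ := Real.exp (-(τ ^ 4 * m / 192)) with hb
  have hville : ∀ f : ℝ, f ≤ 1 →
      Real.exp (-(θ * (τ ^ 2 * G)) + θ ^ 2 * ((1 + f) / k * (12 * J : ℕ))) ≤ b := by
    intro f hf
    refine Real.exp_le_exp.2 ?_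
    have h1 : θ * (τ ^ 2 * G) = τ ^ 4 * m / 96 := by rw [hθ_def, ← hGe]; ring
    have h2 : e ^ 2 * J / k ≤ 2 * m := by
      rw [heJ, div_le_iff₀ hk0]
      nlinarith [mul_pos hk0 hm0]
    have h3 : θ ^ 2 * ((1 + f) / k * (12 * J : ℕ)) =
        12 * (τ ^ 4 / 9216) * ((1 + f) * (e ^ 2 * J / k)) := by
      rw [hθ_def]; push_cast; ring
    have h4 : (1 + f) * (e ^ 2 * J / k) ≤ 2 * (2 * m) :=
      mul_le_mul (by linarith) h2 (by positivity) (by norm_num)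
    rw [h1, h3]
    have := mul_le_mul_of_nonneg_left h4 (show 0 ≤ 12 * (τ ^ 4 / 9216) by positivity)
    nlinarith [pow_pos hτ 4]
  have hchern : Real.exp (-(m * (τ ^ 2) ^ 2 / 24)) ≤ b := by
    refine Real.exp_le_exp.2 ?_
    have : 0 ≤ τ ^ 4 * m := by positivity
    rw [← pow_mul]
    norm_num
    linarith
  set u : ℕ → ℝ := fun _ => (k : ℝ)⁻¹ with hu
  have hu0 : ∀ a ∈ Finset.Icc 1 k, 0 ≤ u a := fun _ _ => by positivity
  have hu1 := sum_inv_Icc hk1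
  set L : Set (List ℕ) := {l | ¬ ∃ t, t <:+ l ∧
    (1 + e) / k * t.length - τ ^ 2 * G + m / e * (1 - τ ^ 2) ≤
      idl m t 1 + if t.length = 12 * J then m / e * (1 + τ ^ 2) else 0} with hL
  set U : ℝ → Set (List ℕ) := fun α => {l | ∃ t, t <:+ l ∧
    (1 + α * e) / k * t.length + τ ^ 2 * G + m / (α * e) * (1 + τ ^ 2) ≤ idl m t 1} with hU
  set V : Set (List ℕ) := {l | ∃ t, t <:+ l ∧
    θ * (τ ^ 2 * G) ≤ θ * (t.count 1 - (k : ℝ)⁻¹ * t.length)} with hV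
  have hLb : wordProb (Finset.Icc 1 k) u (12 * J) L ≤ 3 * b := by
    have := wordProb_idl_lt_le hm hk he (by linarith) (sq_nonneg τ) (by linarith) hθ hθ1
      (τ ^ 2 * G) (12 * J)
    linarith [hville e (by linarith)]
  have hUb : ∀ α, 0 < α → α ≤ 2 → wordProb (Finset.Icc 1 k) u (12 * J) (U α) ≤ 2 * b := by
    intro α h1 h2
    have hα : α * e ≤ 1 := by nlinarith
    have := wordProb_idl_ge_le hm hk (mul_pos h1 he) hα (sq_nonneg τ) (by linarith) hθ hθ1
      (τ ^ 2 * G) (12 * J)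
    linarith [hville (α * e) hα]
  have hVb : wordProb (Finset.Icc 1 k) u (12 * J) V ≤ b := by
    have h1 := wordProb_count_le hu0 hu1 (b := 1) (by simp; omega) (θ := θ)
      (by rwa [abs_of_nonneg hθ]) (θ * (τ ^ 2 * G)) (12 * J)
    have h2 := hville 0 (by norm_num)
    rw [add_zero, one_div] at h2
    exact h1.trans h2
  set E : Set (List ℕ) := L ∪ (U (1 + τ) ∪ (U (1 - τ) ∪ (U (1 / 2) ∪ V))) with hE
  have hEb : wordProb (Finset.Icc 1 k) u (12 * J) E ≤ 10 * b := by
    have h1 := wordProb_union_le hu0 (12 * J) L (U (1 + τ) ∪ (U (1 - τ) ∪ (U (1 / 2) ∪ V)))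
    have h2 := wordProb_union_le hu0 (12 * J) (U (1 + τ)) (U (1 - τ) ∪ (U (1 / 2) ∪ V))
    have h3 := wordProb_union_le hu0 (12 * J) (U (1 - τ)) (U (1 / 2) ∪ V)
    have h4 := wordProb_union_le hu0 (12 * J) (U (1 / 2)) V
    linarith [hUb (1 + τ) (by linarith) (by linarith), hUb (1 - τ) (by linarith) (by linarith),
      hUb (1 / 2) (by norm_num) (by norm_num)]
  have key := wordSum_add_mul_le (s := Finset.Icc 1 k) (p := u)
    (fun l => (idl m (l.drop (11 * J)) 1 : ℝ)) hu0 hu1 (12 * J)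
    (g := fun l => ((l.drop (11 * J)).count 1 : ℝ)) (c := G * (2 - 6 * τ)) E
    (fun l => by exact_mod_cast count_one_le_idl hm _) ?_
  · rw [show 12 * J = 11 * J + J by ring,
      wordSum_drop hu1 (11 * J) J (fun l => ((l.count 1 : ℕ) : ℝ)),
      wordSum_drop hu1 (11 * J) J (fun l => (idl m l 1 : ℝ)),
      show 11 * J + J = 12 * J by ring] at key
    change wordAvg k J (fun l => ((l.count 1 : ℕ) : ℝ)) + _ ≤
      wordAvg k J (fun l => (idl m l 1 : ℝ)) at key
    rw [wordAvg_count_one hk1] at key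
    refine le_trans ?_ key
    exact add_le_add le_rfl (mul_slope_le hτ hτ1 hG0 (Real.exp_pos _).le (Real.sqrt_nonneg _)
      (sqrt_mul_slope_le hτ hτ1 hk0 hG0 hGe heJ) hEb (wordProb_le_one hu0 hu1 _ _))
  · intro l hl hlE
    simp only [hE, Set.mem_union, not_or] at hlE
    obtain ⟨h1, h2, h3, h4, h5⟩ := hlE
    have hU' : ∀ α, l ∉ U α → ∀ t, t <:+ l → (idl m t 1 : ℝ) ≤
        (1 + α * e) / k * t.length + τ ^ 2 * G + m / (α * e) * (1 + τ ^ 2) := by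
      intro α hα t ht
      by_contra! hcon
      exact hα ⟨t, ht, hcon.le⟩
    refine idl_drop_ge hm hk1 hJ1 hτ hτ1 he heJ hG.symm hl (not_not.1 h1) ?_ ?_
    · rintro α (rfl | rfl | rfl)
      exacts [hU' _ h2, hU' _ h3, hU' _ h4]
    · intro t ht
      by_contra! hcon
      exact h5 ⟨t, ht, mul_le_mul_of_nonneg_left (by linarith) hθ⟩

lemma stepR_zero (w : List ℕ) (b : ℕ) (x : ℕ → ℕ) :
    stepR w b x 0 = x 0 + if rowLetter w x 0 = b then 1 else 0 := by
  simp [stepR, rowLetter]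

lemma stepR_one (w : List ℕ) (b : ℕ) (x : ℕ → ℕ) :
    stepR w b x 1 = max (x 0 + if rowLetter w x 0 = b then 1 else 0)
      (x 1 + if rowLetter w x 1 = b then 1 else 0) := by
  simp [stepR, rowLetter, Finset.range_add_one, max_comm]

/-- Distance between the first two rows. -/
def gap (x : ℕ → ℕ) : ℝ := x 1 - x 0

lemma gap_stepR_eq {x : ℕ → ℕ} (w : List ℕ) (b : ℕ) :
    gap (stepR w b x) = max 0 (gap x + (if rowLetter w x 1 = b then 1 else 0)
      - if rowLetter w x 0 = b then 1 else 0) := by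
  unfold gap
  rw [stepR_one, stepR_zero]
  push_cast
  rw [← max_sub_sub_right]
  congr 1 <;> ring

lemma gap_zero_or_one_le {x : ℕ → ℕ} (hx : Monotone x) : gap x = 0 ∨ 1 ≤ gap x := by
  unfold gap
  rcases (hx (Nat.zero_le 1)).eq_or_lt with h | h
  · left; rw [h]; ring
  · right
    have : ((x 0 + 1 : ℕ) : ℝ) ≤ x 1 := by exact_mod_cast h
    push_cast at this
    linarith

lemma gap_stepR_sq_ge {x : ℕ → ℕ} (hx : Monotone x) (w : List ℕ) (b : ℕ) :
    gap x ^ 2 + (2 * gap x + 1) * (if rowLetter w x 1 = b then 1 else 0)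
      - 2 * gap x * (if rowLetter w x 0 = b then 1 else 0)
      - (if rowLetter w x 0 = b then 1 else 0) * (if rowLetter w x 1 = b then 1 else 0)
      ≤ gap (stepR w b x) ^ 2 := by
  rw [gap_stepR_eq]
  rcases gap_zero_or_one_le hx with h | h
  · rw [h]; split_ifs <;> norm_num
  · rw [max_eq_right (by split_ifs <;> linarith)]
    split_ifs <;> nlinarith

lemma gap_stepR_sq_le {x : ℕ → ℕ} (hx : Monotone x) (w : List ℕ) (b : ℕ) :
    gap (stepR w b x) ^ 2 ≤ gap x ^ 2
      + (2 * gap x + 1) * (if rowLetter w x 1 = b then 1 else 0)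
      + (1 - 2 * gap x) * (if rowLetter w x 0 = b then 1 else 0) := by
  rw [gap_stepR_eq]
  rcases gap_zero_or_one_le hx with h | h
  · rw [h]; split_ifs <;> norm_num
  · rw [max_eq_right (by split_ifs <;> linarith)]
    split_ifs <;> nlinarith

lemma gap_stepR_pow_four_le {x : ℕ → ℕ} (hx : Monotone x) (w : List ℕ) (b : ℕ) :
    gap (stepR w b x) ^ 4 ≤ gap x ^ 4
      + (4 * gap x ^ 3 + 6 * gap x ^ 2 + 4 * gap x + 1)
        * (if rowLetter w x 1 = b then 1 else 0)
      + (6 * gap x ^ 2 + 1 - 4 * gap x ^ 3 - 4 * gap x)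
        * (if rowLetter w x 0 = b then 1 else 0) := by
  rw [gap_stepR_eq]
  rcases gap_zero_or_one_le hx with h | h
  · rw [h]; split_ifs <;> norm_num
  · rw [max_eq_right (by split_ifs <;> linarith)]
    split_ifs <;> ring_nf <;> nlinarith [sq_nonneg (gap x)]

lemma sum_inv_mul_ite {k a : ℕ} (ha : a ∈ Finset.Icc 1 k) (c : ℝ) :
    ∑ b ∈ Finset.Icc 1 k, (k : ℝ)⁻¹ * (c * (if a = b then 1 else 0)) = (k : ℝ)⁻¹ * c := by
  simp only [mul_comm c]
  exact sum_ite_letter ha c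

lemma rowLetter_mem {k r : ℕ} {w : List ℕ} {x : ℕ → ℕ} (hw : ∀ a ∈ w, a ∈ Finset.Icc 1 k)
    (h : x r + r < w.length) : rowLetter w x r ∈ Finset.Icc 1 k := getD_mem_Icc hw h

lemma nextAvg_gap_sq_ge {k : ℕ} (hk : 0 < k) {w : List ℕ} {x : ℕ → ℕ}
    (hw : ∀ a ∈ w, a ∈ Finset.Icc 1 k) (hx : Monotone x) (hxl : x 1 + 1 < w.length) :
    gap x ^ 2 + (k : ℝ)⁻¹ * (1 - conf 0 1 w x) ≤ nextAvg k (fun _ x => gap x ^ 2) w x := by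
  have hm := hx (Nat.zero_le 1)
  have h0 : rowLetter w x 0 ∈ Finset.Icc 1 k := rowLetter_mem hw (by omega)
  have h1 : rowLetter w x 1 ∈ Finset.Icc 1 k := rowLetter_mem hw hxl
  have h2 : nextAvg k (fun _ x => gap x ^ 2) w x ≥ ∑ b ∈ Finset.Icc 1 k, ((k : ℝ)⁻¹ * gap x ^ 2
      + (k : ℝ)⁻¹ * ((2 * gap x + 1) * (if rowLetter w x 1 = b then 1 else 0))
      - (k : ℝ)⁻¹ * (2 * gap x * (if rowLetter w x 0 = b then 1 else 0))
      - (k : ℝ)⁻¹ * (conf 0 1 w x * (if rowLetter w x 0 = b then 1 else 0))) := by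
    refine Finset.sum_le_sum fun b _ => ?_
    rw [← mul_add, ← mul_sub, ← mul_sub]
    refine mul_le_mul_of_nonneg_left ?_ (by positivity)
    refine le_trans (le_of_eq ?_) (gap_stepR_sq_ge hx w b)
    congr 1
    unfold conf
    split_ifs <;> simp_all
  rw [Finset.sum_sub_distrib, Finset.sum_sub_distrib, Finset.sum_add_distrib, ← Finset.sum_mul,
    sum_inv_Icc hk, sum_inv_mul_ite h1, sum_inv_mul_ite h0, sum_inv_mul_ite h0] at h2
  linarith

lemma nextAvg_gap_sq_le {k : ℕ} (hk : 2 ≤ k) {w : List ℕ} {x : ℕ → ℕ}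
    (hw : ∀ a ∈ w, a ∈ Finset.Icc 1 k) (hx : Monotone x) (hxl : x 1 + 1 < w.length) :
    nextAvg k (fun _ x => gap x ^ 2) w x ≤ gap x ^ 2 + 1 := by
  have hm := hx (Nat.zero_le 1)
  have h0 : rowLetter w x 0 ∈ Finset.Icc 1 k := rowLetter_mem hw (by omega)
  have h1 : rowLetter w x 1 ∈ Finset.Icc 1 k := rowLetter_mem hw hxl
  have h2 : nextAvg k (fun _ x => gap x ^ 2) w x ≤ ∑ b ∈ Finset.Icc 1 k, ((k : ℝ)⁻¹ * gap x ^ 2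
      + (k : ℝ)⁻¹ * ((2 * gap x + 1) * (if rowLetter w x 1 = b then 1 else 0))
      + (k : ℝ)⁻¹ * ((1 - 2 * gap x) * (if rowLetter w x 0 = b then 1 else 0))) := by
    refine Finset.sum_le_sum fun b _ => ?_
    rw [← mul_add, ← mul_add]
    exact mul_le_mul_of_nonneg_left (gap_stepR_sq_le hx w b) (by positivity)
  rw [Finset.sum_add_distrib, Finset.sum_add_distrib, ← Finset.sum_mul,
    sum_inv_Icc (by omega), sum_inv_mul_ite h1, sum_inv_mul_ite h0] at h2
  have hk2 : (k : ℝ)⁻¹ ≤ 2⁻¹ := inv_anti₀ (by norm_num) (by exact_mod_cast hk)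
  linarith

lemma nextAvg_gap_pow_four_le {k : ℕ} (hk : 2 ≤ k) {w : List ℕ} {x : ℕ → ℕ}
    (hw : ∀ a ∈ w, a ∈ Finset.Icc 1 k) (hx : Monotone x) (hxl : x 1 + 1 < w.length) :
    nextAvg k (fun _ x => gap x ^ 4) w x ≤ gap x ^ 4 + 6 * gap x ^ 2 + 1 := by
  have hm := hx (Nat.zero_le 1)
  have h0 : rowLetter w x 0 ∈ Finset.Icc 1 k := rowLetter_mem hw (by omega)
  have h1 : rowLetter w x 1 ∈ Finset.Icc 1 k := rowLetter_mem hw hxl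
  have h2 : nextAvg k (fun _ x => gap x ^ 4) w x ≤ ∑ b ∈ Finset.Icc 1 k, ((k : ℝ)⁻¹ * gap x ^ 4
      + (k : ℝ)⁻¹ * ((4 * gap x ^ 3 + 6 * gap x ^ 2 + 4 * gap x + 1)
        * (if rowLetter w x 1 = b then 1 else 0))
      + (k : ℝ)⁻¹ * ((6 * gap x ^ 2 + 1 - 4 * gap x ^ 3 - 4 * gap x)
        * (if rowLetter w x 0 = b then 1 else 0))) := by
    refine Finset.sum_le_sum fun b _ => ?_
    rw [← mul_add, ← mul_add]
    exact mul_le_mul_of_nonneg_left (gap_stepR_pow_four_le hx w b) (by positivity)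
  rw [Finset.sum_add_distrib, Finset.sum_add_distrib, ← Finset.sum_mul,
    sum_inv_Icc (by omega), sum_inv_mul_ite h1, sum_inv_mul_ite h0] at h2
  have hk2 : (k : ℝ)⁻¹ ≤ 2⁻¹ := inv_anti₀ (by norm_num) (by exact_mod_cast hk)
  nlinarith [sq_nonneg (gap x)]

lemma nextAvg_conf_fresh {k : ℕ} (hk : 0 < k) {w : List ℕ} {x : ℕ → ℕ}
    (hw : ∀ a ∈ w, a ∈ Finset.Icc 1 k) (hx : Monotone x) (hxl : x 1 + 2 < w.length) :
    (k : ℝ)⁻¹ * (1 - (k : ℝ)⁻¹) * conf 0 1 w x ≤ ∑ a ∈ Finset.Icc 1 k, (k : ℝ)⁻¹ *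
      nextAvg k (fun w x => 1 - conf 0 1 w x) (w.set (x 1 + 1 + 1) a) x := by
  have hm := hx (Nat.zero_le 1)
  have hconf : ∀ w' x', 0 ≤ 1 - conf 0 1 w' x' := by
    intro w' x'
    unfold conf; split_ifs <;> norm_num
  by_cases h : rowLetter w x 0 = rowLetter w x 1
  · have h0 : rowLetter w x 0 ∈ Finset.Icc 1 k := rowLetter_mem hw (by omega)
    have hc : w.getD (x 0 + 1) 0 ∈ Finset.Icc 1 k := getD_mem_Icc hw (by omega)
    have key : ∀ a ∈ Finset.Icc 1 k, (k : ℝ)⁻¹ * ((k : ℝ)⁻¹ *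
          (1 - if w.getD (x 0 + 1) 0 = a then 1 else 0)) ≤ (k : ℝ)⁻¹ *
        nextAvg k (fun w x => 1 - conf 0 1 w x) (w.set (x 1 + 1 + 1) a) x := by
      intro a _
      refine mul_le_mul_of_nonneg_left ?_ (by positivity)
      refine le_trans (le_of_eq ?_) (Finset.single_le_sum (fun b _ =>
        mul_nonneg (inv_nonneg.2 (Nat.cast_nonneg k)) (hconf _ _)) h0)
      have e : ∀ r ≤ 1, rowLetter (w.set (x 1 + 1 + 1) a) x r = rowLetter w x r := by
        intro r hr
        have := hx hr
        unfold rowLetter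
        rw [getD_set_of_ne (by omega)]
      have e0 : stepR (w.set (x 1 + 1 + 1) a) (rowLetter w x 0) x 0 = x 0 + 1 := by
        rw [stepR_zero, e 0 (by omega), if_pos rfl]
      have e1 : stepR (w.set (x 1 + 1 + 1) a) (rowLetter w x 0) x 1 = x 1 + 1 := by
        rw [stepR_one, e 0 (by omega), e 1 le_rfl, if_pos rfl, if_pos h.symm]
        omega
      unfold conf
      have f0 : rowLetter (w.set (x 1 + 1 + 1) a)
          (stepR (w.set (x 1 + 1 + 1) a) (rowLetter w x 0) x) 0 = w.getD (x 0 + 1) 0 := by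
        unfold rowLetter at e0 ⊢
        rw [e0, getD_set_of_ne (by omega), add_zero]
      have f1 : rowLetter (w.set (x 1 + 1 + 1) a)
          (stepR (w.set (x 1 + 1 + 1) a) (rowLetter w x 0) x) 1 = a := by
        unfold rowLetter at e1 ⊢
        rw [e1, getD_set_self (by omega)]
      rw [f0, f1]
    refine le_trans (le_of_eq ?_) (Finset.sum_le_sum key)
    simp only [mul_sub, mul_one, Finset.sum_sub_distrib]
    rw [← Finset.sum_mul, sum_inv_Icc hk, sum_inv_mul_ite hc]
    unfold conf
    rw [if_pos h]
    ring
  · have : conf 0 1 w x = 0 := by unfold conf; rw [if_neg h]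
    rw [this, mul_zero]
    exact Finset.sum_nonneg fun a _ => mul_nonneg (by positivity)
      (Finset.sum_nonneg fun b _ => mul_nonneg (by positivity) (hconf _ _))

lemma rowAvg_conf_succ {k : ℕ} (hk : 0 < k) {n j : ℕ} (hn : j + 2 < n) :
    (k : ℝ)⁻¹ * (1 - (k : ℝ)⁻¹) * rowAvg k n j (conf 0 1) ≤
      1 - rowAvg k n (j + 1) (conf 0 1) := by
  have h : 1 - rowAvg k n (j + 1) (conf 0 1)
      = rowAvg k n (j + 1) (fun w x => 1 - conf 0 1 w x) := by
    rw [rowAvg_sub, rowAvg_const hk]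
  rw [h, rowAvg_succ, rowAvg_fresh hk n j 1 hn (nextAvg k _), ← rowAvg_mul_left]
  · refine rowAvg_mono _ _ _ fun w x hw hw' hx hxj => nextAvg_conf_fresh hk hw' hx ?_
    have := hxj 1; omega
  · intro w x y hxy
    refine Finset.sum_congr rfl fun b _ => ?_
    have := stepR_congr (b := b) (w := w) (w' := w) hxy fun _ _ => rfl
    have e : ∀ r ≤ 1, rowLetter w (stepR w b x) r = rowLetter w (stepR w b y) r := by
      intro r hr
      unfold rowLetter
      rw [this r hr]
    simp only [conf, e 0 zero_le_one, e 1 le_rfl]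

lemma rowAvg_gap_sq_ge {k : ℕ} (hk : 2 ≤ k) {n : ℕ} (i : ℕ) (hn : 2 * i + 2 < n) :
    (i : ℝ) / (2 * k ^ 2) ≤ rowAvg k n (2 * i) (fun _ x => gap x ^ 2) := by
  have hk0 : 0 < k := by omega
  have hk' : (0 : ℝ) < k := by exact_mod_cast hk0
  have step : ∀ j, j + 2 < n → rowAvg k n j (fun _ x => gap x ^ 2)
      + (k : ℝ)⁻¹ * (1 - rowAvg k n j (conf 0 1)) ≤
        rowAvg k n (j + 1) (fun _ x => gap x ^ 2) := by
    intro j hj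
    rw [rowAvg_succ]
    refine le_trans (le_of_eq ?_) (rowAvg_mono k n j fun w x hw hw' hx hxj =>
      nextAvg_gap_sq_ge hk0 hw' hx (by have := hxj 1; omega))
    rw [rowAvg_add, rowAvg_mul_left, rowAvg_sub, rowAvg_const hk0]
  have hk2 : (k : ℝ)⁻¹ ≤ 2⁻¹ := inv_anti₀ (by norm_num) (by exact_mod_cast hk)
  have hki : (0 : ℝ) < (k : ℝ)⁻¹ := by positivity
  induction i with
  | zero =>
    simp only [Nat.cast_zero, zero_div]
    rw [← rowAvg_const hk0 n (2 * 0) 0]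
    exact rowAvg_mono _ _ _ fun w x _ _ _ _ => sq_nonneg _
  | succ i ih =>
    have h1 := step (2 * i) (by omega)
    have h2 := step (2 * i + 1) (by omega)
    have h3 := rowAvg_conf_succ hk0 (show 2 * i + 2 < n by omega)
    have h4 := ih (by omega)
    have h5 : rowAvg k n (2 * i) (conf 0 1) ≤ 1 := by
      rw [← rowAvg_const hk0 n (2 * i) 1]
      refine rowAvg_mono _ _ _ fun w x _ _ _ _ => ?_
      unfold conf; split_ifs <;> norm_num
    rw [show 2 * (i + 1) = 2 * i + 1 + 1 by ring]
    set p := rowAvg k n (2 * i) (conf 0 1)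
    have h6 : (k : ℝ)⁻¹ / 2 ≤ (1 - p) + (1 - rowAvg k n (2 * i + 1) (conf 0 1)) := by
      refine le_trans ?_ (add_le_add_right h3 _)
      have : 0 ≤ (1 - p) * (1 - (k : ℝ)⁻¹ * (1 - (k : ℝ)⁻¹)) :=
        mul_nonneg (by linarith) (by nlinarith)
      nlinarith
    have h7 := mul_le_mul_of_nonneg_left h6 hki.le
    have h8 : ((i + 1 : ℕ) : ℝ) / (2 * k ^ 2) = i / (2 * k ^ 2) + (k : ℝ)⁻¹ * ((k : ℝ)⁻¹ / 2) := by
      push_cast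
      field_simp
    rw [h8]
    linarith

lemma rowAvg_gap_sq_le {k : ℕ} (hk : 2 ≤ k) {n : ℕ} (j : ℕ) (hn : j + 2 < n) :
    rowAvg k n j (fun _ x => gap x ^ 2) ≤ j := by
  induction j with
  | zero => rw [rowAvg_zero]; simpa [gap] using (wordAvg_const (by omega) n 0).le
  | succ j ih =>
    rw [rowAvg_succ]
    refine (rowAvg_mono k n j fun w x hw hw' hx hxj =>
      nextAvg_gap_sq_le hk hw' hx (by have := hxj 1; omega)).trans ?_
    rw [rowAvg_add, rowAvg_const (by omega)]
    push_cast
    linarith [ih (by omega)]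

lemma rowAvg_gap_pow_four_le {k : ℕ} (hk : 2 ≤ k) {n : ℕ} (j : ℕ) (hn : j + 2 < n) :
    rowAvg k n j (fun _ x => gap x ^ 4) ≤ 3 * (j : ℝ) ^ 2 := by
  induction j with
  | zero => rw [rowAvg_zero]; simpa [gap] using (wordAvg_const (by omega) n 0).le
  | succ j ih =>
    rw [rowAvg_succ]
    refine (rowAvg_mono k n j fun w x hw hw' hx hxj =>
      nextAvg_gap_pow_four_le hk hw' hx (by have := hxj 1; omega)).trans ?_
    rw [rowAvg_add, rowAvg_const (by omega), rowAvg_add, rowAvg_mul_left]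
    push_cast
    linarith [ih (by omega), rowAvg_gap_sq_le hk j (by omega : j + 2 < n)]

lemma rowAvg_gap_ge {k : ℕ} (hk : 2 ≤ k) {n : ℕ} (i : ℕ) (hn : 2 * i + 2 < n) :
    √i / (40 * k ^ 3) ≤ rowAvg k n (2 * i) (fun _ x => gap x) := by
  rcases Nat.eq_zero_or_pos i with rfl | hi
  · simp only [Nat.cast_zero, Real.sqrt_zero, zero_div]
    rw [← rowAvg_const (by omega : 0 < k) n (2 * 0) 0]
    refine rowAvg_mono _ _ _ fun w x _ _ hx _ => ?_
    rcases gap_zero_or_one_le hx with h | h <;> linarith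
  have hk' : (0 : ℝ) < k := by exact_mod_cast (by omega : 0 < k)
  have hi' : (0 : ℝ) < i := by exact_mod_cast hi
  have hs : 0 < √(i : ℝ) := Real.sqrt_pos.2 hi'
  have hss : √(i : ℝ) ^ 2 = i := Real.sq_sqrt hi'.le
  set t : ℝ := 10 * k * √(i : ℝ) with ht
  have ht0 : 0 < t := by positivity
  have h1 := rowAvg_gap_sq_ge hk i hn
  have h2 := rowAvg_gap_pow_four_le hk (2 * i) hn
  have h3 : rowAvg k n (2 * i) (fun _ x => gap x ^ 2) ≤
      t * rowAvg k n (2 * i) (fun _ x => gap x)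
        + (t ^ 2)⁻¹ * rowAvg k n (2 * i) (fun _ x => gap x ^ 4) := by
    rw [← rowAvg_mul_left, ← rowAvg_mul_left, ← rowAvg_add]
    refine rowAvg_mono _ _ _ fun w x _ _ hx _ => ?_
    have hg : 0 ≤ gap x := by rcases gap_zero_or_one_le hx with h | h <;> linarith
    have : 0 ≤ gap x * (t ^ 3 - gap x * t ^ 2 + gap x ^ 3) := by
      refine mul_nonneg hg ?_
      rcases le_total (gap x) t with h | h
      · nlinarith [mul_nonneg (sub_nonneg.2 h) (sq_nonneg t), pow_nonneg hg 3]
      · have : t ^ 2 ≤ gap x ^ 2 := by gcongr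
        nlinarith [mul_nonneg hg (sub_nonneg.2 this), pow_nonneg ht0.le 3]
    have e : t * gap x + (t ^ 2)⁻¹ * gap x ^ 4 - gap x ^ 2
        = (t ^ 2)⁻¹ * (gap x * (t ^ 3 - gap x * t ^ 2 + gap x ^ 3)) := by
      field_simp
      ring
    have := mul_nonneg (inv_nonneg.2 (sq_nonneg t)) this
    linarith
  have h4 : (t ^ 2)⁻¹ * rowAvg k n (2 * i) (fun _ x => gap x ^ 4) ≤ 3 * i / (25 * k ^ 2) := by
    calc _ ≤ (t ^ 2)⁻¹ * (3 * ((2 * i : ℕ) : ℝ) ^ 2) := by gcongr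
      _ = _ := by
        rw [ht, mul_pow, hss]; push_cast; field_simp; ring
  have h5 : (i : ℝ) / (4 * k ^ 2) ≤ i / (2 * k ^ 2) - 3 * i / (25 * k ^ 2) := by
    rw [show (i : ℝ) / (2 * k ^ 2) - 3 * i / (25 * k ^ 2) = i / (4 * k ^ 2) * (38 / 25) by
      field_simp; norm_num]
    have : 0 ≤ (i : ℝ) / (4 * k ^ 2) := by positivity
    linarith
  have h6 : √(i : ℝ) / (40 * k ^ 3) * t = i / (4 * k ^ 2) := by
    calc _ = √(i : ℝ) ^ 2 / (4 * k ^ 2) := by rw [ht]; field_simp; norm_num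
      _ = _ := by rw [hss]
  refine le_of_mul_le_mul_right ?_ ht0
  rw [h6, mul_comm _ t]
  linarith

lemma rowAvg_row_zero {k : ℕ} (hk : 0 < k) {n : ℕ} (j : ℕ) (hn : j < n) :
    rowAvg k n j (fun _ x => (x 0 : ℝ)) = j / k := by
  induction j with
  | zero => rw [rowAvg_zero]; simpa using wordAvg_const hk n 0
  | succ j ih =>
    rw [rowAvg_succ]
    have : rowAvg k n j (nextAvg k (fun _ x => (x 0 : ℝ)))
        = rowAvg k n j (fun _ x => (x 0 : ℝ) + (k : ℝ)⁻¹) := by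
      refine rowAvg_congr _ _ _ fun w x hw hw' hx hxj => ?_
      rw [nextAvg_row hk]
      have h0 : rowLetter w x 0 ∈ Finset.Icc 1 k :=
        rowLetter_mem hw' (by have := hxj 0; omega)
      have := sum_inv_mul_ite h0 1
      rw [mul_one] at this
      congr 1
      refine Eq.trans (Finset.sum_congr rfl fun b _ => ?_) this
      unfold adv
      rw [stepR_zero]
      push_cast
      ring
    rw [this, rowAvg_add, rowAvg_const hk, ih (by omega)]
    push_cast
    field_simp

lemma rowAvg_row_one_ge {k : ℕ} (hk : 2 ≤ k) {n : ℕ} (i : ℕ) (hn : 2 * i + 2 < n) :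
    2 * i / k + √i / (40 * k ^ 3) ≤ rowAvg k n (2 * i) (fun _ x => (x 1 : ℝ)) := by
  have h1 := rowAvg_gap_ge hk i hn
  unfold gap at h1
  rw [rowAvg_sub, rowAvg_row_zero (by omega) _ (by omega)] at h1
  push_cast at h1
  linarith

/-- The renewal lower bound in terms of the average position of row `r`. -/
lemma gamma_lower_rowAvg {k : ℕ} (hk : 0 < k) (r J : ℕ) (hJ : 0 < J) (I : ℝ) (hI0 : 0 ≤ I)
    (hI : ∀ n, J + (r + 1) < n → I ≤ rowAvg k n J (fun _ x => (x r : ℝ)) + (r + 1))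
    {ε : ℝ} (hε0 : 0 ≤ ε) (hε : ε ≤ 1) (hJI : (J : ℝ) ≤ (1 - ε) * k * I) {γ : ℝ}
    (hγ : Tendsto (fun n : ℕ => expLCS k n ⌊(1 - ε) * k * n⌋₊ / n) atTop (nhds γ)) :
    1 - (1 - ε) * k * (r + 1) / J ≤ γ := by
  refine gamma_lower hk r J hJ I hI0 (fun n hn => (hI n hn).trans (le_of_eq ?_)) hε0 hε hJI hγ
  rw [rowAvg]
  simp only [wordAvg_add, wordAvg_const hk]

/-- For a fixed alphabet, the deficit is at most quadratic in `ε`. -/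
lemma exists_gamma_ge {k : ℕ} (hk : 2 ≤ k) : ∃ e C : ℝ, 0 < e ∧ 0 < C ∧
    ∀ ε : ℝ, 0 < ε → ε ≤ e → ∀ γ : ℝ,
      Tendsto (fun n : ℕ => expLCS k n ⌊(1 - ε) * k * n⌋₊ / n) atTop (nhds γ) →
      1 - C * ε ^ 2 ≤ γ := by
  have hk' : (0 : ℝ) < k := by exact_mod_cast (by omega : 0 < k)
  set c : ℝ := 1 / (40 * k ^ 3) with hc
  have hc0 : 0 < c := by positivity
  refine ⟨min (1 / 2) (k * c / 4), 32 / (k * c ^ 2), by positivity, by positivity,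
    fun ε hε0 hε γ hγ => ?_⟩
  have hε1 : ε ≤ 1 / 2 := hε.trans (min_le_left _ _)
  have hε2 : ε ≤ k * c / 4 := hε.trans (min_le_right _ _)
  set B : ℝ := k * c / (4 * ε) with hB
  have hB1 : 1 ≤ B := by rw [hB, le_div_iff₀ (by positivity)]; linarith
  have hB2 : 1 ≤ B ^ 2 := one_le_pow₀ hB1
  set i : ℕ := ⌊B ^ 2⌋₊ with hi
  have hiB : (i : ℝ) ≤ B ^ 2 := Nat.floor_le (by positivity)
  have hiB' : B ^ 2 < i + 1 := Nat.lt_floor_add_one _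
  have hi1 : 1 ≤ i := Nat.le_floor (by simpa using hB2)
  have hi1' : (1 : ℝ) ≤ i := by exact_mod_cast hi1
  have hs : √(i : ℝ) ≤ B := Real.sqrt_le_iff.2 ⟨by linarith, hiB⟩
  have hss : √(i : ℝ) * √(i : ℝ) = i := Real.mul_self_sqrt (by linarith)
  have hs0 : 0 ≤ √(i : ℝ) := Real.sqrt_nonneg _
  have h1 := gamma_lower_rowAvg (by omega : 0 < k) 1 (2 * i) (by omega)
    (2 * i / k + √i * c) (by positivity) (fun n hn => ?_) hε0.le (by linarith) ?_ hγ
  · refine le_trans ?_ h1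
    have h2 : (1 - ε) * k * (((1 : ℕ) : ℝ) + 1) / ((2 * i : ℕ) : ℝ) ≤ 2 * k / B ^ 2 := by
      push_cast
      rw [div_le_div_iff₀ (by positivity) (by positivity)]
      have h3 : (1 - ε) * k ≤ k := by nlinarith
      have h4 : B ^ 2 ≤ 2 * i := by linarith
      calc (1 - ε) * k * (1 + 1) * B ^ 2 ≤ k * (1 + 1) * (2 * i) := by gcongr
        _ = _ := by ring
    have h3 : 2 * k / B ^ 2 = 32 / (k * c ^ 2) * ε ^ 2 := by
      rw [hB]; field_simp; norm_num
    linarith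
  · have := rowAvg_row_one_ge hk (n := n) i (by omega)
    have e : √(i : ℝ) * c = √i / (40 * k ^ 3) := by rw [hc]; ring
    push_cast
    rw [e]
    linarith
  · have h4 : 4 * ε * √(i : ℝ) ≤ k * c := by
      rw [hB, le_div_iff₀ (by positivity)] at hs
      linarith
    have h5 : (1 - ε) * k * (2 * i / k + √i * c) = 2 * i - 2 * ε * i + (1 - ε) * (k * c) * √i := by
      field_simp
    rw [h5]
    push_cast
    have h6 := mul_le_mul_of_nonneg_right h4 hs0
    have h7 : 0 ≤ (1 / 2 - ε) * (k * c * √(i : ℝ)) := mul_nonneg (by linarith) (by positivity)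
    rw [mul_assoc _ _ (√(i : ℝ)), hss] at h6
    linarith

/-- Relative loss in the lower bound for the average of row `m - 1`. -/
noncomputable def rowLoss (k m : ℕ) (τ : ℝ) : ℝ :=
  7 * τ + 10 * Real.exp (-(τ ^ 4 * m / 192)) + √(21 * m * (1 + Real.log m) / k)

lemma rowAvg_row_ge {k R J n : ℕ} (hk : R + 1 + 2 ≤ k) (hJ : 4 * ((R + 1) * k ^ 3) ≤ J)
    (hn : J + (R + 1) < n) {τ : ℝ} (hτ : 0 < τ) (hτ1 : τ ≤ 1 / 7) :
    (J : ℝ) / k + 2 * √((R + 1 : ℕ) * J / k) * (1 - rowLoss k (R + 1) τ)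
      ≤ rowAvg k n J (fun _ x => (x R : ℝ)) + (R + 1) := by
  have hk3 : 3 ≤ k := by omega
  have hk0 : 0 < k := by omega
  have hk' : (3 : ℝ) ≤ k := by exact_mod_cast hk3
  have hk0' : (0 : ℝ) < k := by linarith
  have hJ8 : 8 * (k * (R + 1)) ≤ J := by
    refine le_trans ?_ hJ
    have : 2 * k ≤ k ^ 3 := by nlinarith [Nat.pow_le_pow_left hk3 2]
    nlinarith [Nat.mul_le_mul_left (R + 1) this]
  have hidl := wordAvg_idl_ge (k := k) (m := R + 1) (J := J) (by omega) hk hJ8 hτ hτ1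
  set m : ℕ := R + 1 with hm
  have hm1 : (1 : ℝ) ≤ m := by exact_mod_cast (by omega : 1 ≤ m)
  have hmR : (m : ℝ) = R + 1 := by rw [hm]; push_cast; ring
  have hlog : 0 ≤ Real.log m := Real.log_nonneg hm1
  have hJ' : 4 * (m * (k : ℝ) ^ 3) ≤ J := by exact_mod_cast hJ
  have hk3pos : (k : ℝ) ≤ k ^ 3 := by nlinarith [sq_nonneg ((k : ℝ) - 1), sq_nonneg (k : ℝ)]
  have hJk : 4 * (k : ℝ) ^ 3 ≤ J := by nlinarith [pow_pos hk0' 3]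
  have hJ0 : (0 : ℝ) < J := lt_of_lt_of_le (by positivity) hJk
  set S : ℝ := √(m * J / k) with hS
  have hS0 : 0 ≤ S := Real.sqrt_nonneg _
  set P : ℝ := rowAvg k n J (fun _ x => (x R : ℝ)) with hP
  set g : ℝ := √(21 * m * (1 + Real.log m) / k) with hg
  have hg0 : 0 ≤ g := Real.sqrt_nonneg _
  have hη : 0 ≤ rowLoss k m τ := by
    unfold rowLoss
    have := Real.exp_pos (-(τ ^ 4 * m / 192))
    linarith
  by_cases hcase : (J : ℝ) / k + 2 * S ≤ P
  · have : 0 ≤ 2 * S * rowLoss k m τ := by positivity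
    linarith
  push Not at hcase
  have hSle : S ≤ J / (2 * k ^ 2) := by
    refine Real.sqrt_le_iff.2 ⟨by positivity, ?_⟩
    rw [div_pow, div_le_div_iff₀ hk0' (by positivity)]
    calc (m : ℝ) * J * (2 * (k : ℝ) ^ 2) ^ 2 = 4 * (m * (k : ℝ) ^ 3) * (J * k) := by ring
      _ ≤ (J : ℝ) * (J * k) := by gcongr
      _ = (J : ℝ) ^ 2 * k := by ring
  have hPle : P - J / k ≤ J / k ^ 2 := by
    have : 2 * (J / (2 * (k : ℝ) ^ 2)) = J / k ^ 2 := by field_simp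
    linarith
  have hC : ∀ r s, r < s → s ≤ R →
      ∑ j ∈ Finset.range J, rowAvg k n j (conf r s) ≤ 7 * J / k := by
    intro r s hrs hs
    refine (sum_rowAvg_conf_le hk0 n J hrs (by omega)).trans ?_
    have h1 : rowAvg k n J (fun _ x => (x s : ℝ)) ≤ P :=
      rowAvg_mono _ _ _ fun w x _ _ hx _ => by exact_mod_cast hx hs
    have h2 : rowAvg k n J (fun _ x => (x s : ℝ)) - J / k ≤ J / k ^ 2 := by linarith
    calc _ ≤ 2 * (k : ℝ) + 2 * J / k + (2 * k + 2) * (J / k ^ 2) := by gcongr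
      _ ≤ J / k + 2 * J / k + 4 * J / k := by
        have e1 : 2 * (k : ℝ) ≤ J / k := by
          rw [le_div_iff₀ hk0']
          nlinarith
        have e2 : (2 * (k : ℝ) + 2) * (J / k ^ 2) ≤ 4 * J / k := by
          rw [← mul_div_assoc, div_le_div_iff₀ (by positivity) hk0']
          have : (2 * (k : ℝ) + 2) ≤ 4 * k := by linarith
          calc (2 * (k : ℝ) + 2) * J * k ≤ 4 * k * J * k := by gcongr
            _ = _ := by ring
        linarith
      _ = _ := by ring
  set A : ℝ := S * g with hA
  have hApos : 0 < A := mul_pos (Real.sqrt_pos.2 (by positivity)) (Real.sqrt_pos.2 (by positivity))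
  have hloss : ∑ j ∈ Finset.range J, rowAvg k n j (confLoss k m) ≤ A ^ 2 := by
    refine (rowAvg_confLoss_le hk0 R n J _ hC (by positivity)).trans (le_of_eq ?_)
    rw [hA, mul_pow, hS, hg, Real.sq_sqrt (by positivity), Real.sq_sqrt (by positivity), ← hmR]
    field_simp
    norm_num
  have hΛ0 : 0 < ⌈A⌉₊ := Nat.ceil_pos.2 hApos
  have hΛ1 : A ≤ ⌈A⌉₊ := Nat.le_ceil A
  have hΛ2 : (⌈A⌉₊ : ℝ) < A + 1 := Nat.ceil_lt_add_one hApos.le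
  have h1 := wordAvg_idl_le hk0 R ⌈A⌉₊ n J hΛ0 hn
  have h2 : ((⌈A⌉₊ : ℝ))⁻¹ * ∑ j ∈ Finset.range J, rowAvg k n j (confLoss k m) ≤ A := by
    rw [inv_mul_le_iff₀ (by exact_mod_cast hΛ0)]
    refine hloss.trans ?_
    rw [sq]
    gcongr
  have h3 : 2 * S * (1 - rowLoss k m τ) =
      2 * S * (1 - 7 * τ - 10 * Real.exp (-(τ ^ 4 * m / 192))) - 2 * A := by
    rw [hA, rowLoss, ← hg]
    ring
  linarith

/-- Constant in the bound for `rowLoss`. -/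
noncomputable def lossConst : ℝ := 42 + 240 * 192 ^ 4

lemma rowLoss_le {k m : ℕ} {q : ℝ} (hq : 1 ≤ q) (hk : (k : ℝ) = q ^ 26) (hm : q ^ 17 ≤ m)
    (hm2 : (m : ℝ) ≤ 2 * q ^ 17) : rowLoss k m (1 / q ^ 4) ≤ lossConst * (1 / q ^ 4) := by
  have hq0 : 0 < q := by linarith
  have h1 : Real.exp (-((1 / q ^ 4) ^ 4 * m / 192)) ≤ 24 * 192 ^ 4 * (1 / q ^ 4) := by
    have e1 : q / 192 ≤ (1 / q ^ 4) ^ 4 * m / 192 := by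
      have : (1 / q ^ 4) ^ 4 * q ^ 17 = q := by field_simp
      have h := mul_le_mul_of_nonneg_left hm (by positivity : 0 ≤ (1 / q ^ 4) ^ 4)
      linarith
    have e2 := Real.pow_div_factorial_le_exp (q / 192) (by positivity) 4
    calc _ ≤ Real.exp (-(q / 192)) := Real.exp_le_exp.2 (by linarith)
      _ = (Real.exp (q / 192))⁻¹ := Real.exp_neg _
      _ ≤ ((q / 192) ^ 4 / (Nat.factorial 4))⁻¹ := inv_anti₀ (by positivity) e2
      _ = _ := by
        rw [show Nat.factorial 4 = 24 by rfl]
        push_cast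
        field_simp
  have h2 : √(21 * m * (1 + Real.log m) / k) ≤ 35 * (1 / q ^ 4) := by
    have hm0 : (0 : ℝ) < m := lt_of_lt_of_le (by positivity) hm
    have hlog : Real.log m ≤ 1 + 17 * q := by
      calc Real.log m ≤ Real.log (2 * q ^ 17) := Real.log_le_log hm0 hm2
        _ = Real.log 2 + 17 * Real.log q := by
          rw [Real.log_mul (by norm_num) (by positivity), Real.log_pow]; norm_num
        _ ≤ 1 + 17 * q := by
          have := Real.log_le_sub_one_of_pos hq0
          have := Real.log_le_sub_one_of_pos (show (0 : ℝ) < 2 by norm_num)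
          linarith
    refine Real.sqrt_le_iff.2 ⟨by positivity, ?_⟩
    rw [hk, div_le_iff₀ (by positivity)]
    have e : (35 * (1 / q ^ 4)) ^ 2 * q ^ 26 = 1225 * (q ^ 17 * q) := by
      field_simp
      norm_num
    rw [e]
    have : 1 + Real.log m ≤ 19 * q := by linarith
    calc 21 * m * (1 + Real.log m) ≤ 21 * (2 * q ^ 17) * (19 * q) := by
          have : 0 ≤ 1 + Real.log m := by
            have : 0 ≤ Real.log m := Real.log_nonneg (le_trans (one_le_pow₀ hq) hm)
            linarith
          gcongr
      _ ≤ _ := by nlinarith [pow_pos hq0 17]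
  unfold rowLoss lossConst
  linarith

lemma lossConst_ge : 42 ≤ lossConst := by unfold lossConst; norm_num

lemma one_le_loss_mul {h ε δ u : ℝ} (hh : 0 ≤ h) (hε : 0 ≤ ε) (hεδ : ε ≤ δ)
    (hu : u = 2 * h + 3 * δ) (hu2 : u ≤ 1 / 2) :
    1 ≤ ((1 - h) * (1 - ε)) ^ 2 * (1 - δ) * (1 + 2 * u) := by
  have hδ : 0 ≤ δ := hε.trans hεδ
  have h1 : 1 - h - ε ≤ (1 - h) * (1 - ε) := by nlinarith [mul_nonneg hh hε]
  have h2 : 1 - 2 * h - 2 * ε ≤ ((1 - h) * (1 - ε)) ^ 2 := by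
    linarith [sq_nonneg ((1 - h) * (1 - ε) - 1)]
  have h3 : 0 ≤ 1 - δ := by linarith
  have h4 := mul_le_mul_of_nonneg_right h2 h3
  have h5 : 1 - u ≤ (1 - 2 * h - 2 * ε) * (1 - δ) := by
    linarith [mul_nonneg hh hδ, mul_nonneg hε hδ]
  have h6 : 1 ≤ (1 - u) * (1 + 2 * u) := by
    have : 0 ≤ u * (1 / 2 - u) := mul_nonneg (by linarith) (by linarith)
    linarith
  exact h6.trans (mul_le_mul_of_nonneg_right (h5.trans h4) (by linarith))

/-- Lower bound for a large alphabet of size `q ^ 26` and small `ε`. -/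
lemma gamma_ge_of_large {k : ℕ} {q : ℝ} (hk : (k : ℝ) = q ^ 26)
    (hq : 4 * lossConst + 6 ≤ q) {ε : ℝ} (hε0 : 0 < ε) (hε : ε ≤ 1 / (4 * k)) {γ : ℝ}
    (hγ : Tendsto (fun n : ℕ => expLCS k n ⌊(1 - ε) * k * n⌋₊ / n) atTop (nhds γ)) :
    1 - (1 / 4) * ε ^ 2 * (1 + (4 * lossConst + 6) * (1 / q ^ 4)) ≤ γ := by
  have hL := lossConst_ge
  have hq2 : 2 ≤ q := by linarith
  have hq0 : 0 < q := by linarith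
  have hk0' : (0 : ℝ) < k := by rw [hk]; positivity
  have hk0 : 0 < k := by exact_mod_cast hk0'
  have hk1 : (1 : ℝ) ≤ k := by exact_mod_cast hk0
  obtain ⟨R, hR⟩ : ∃ R, ⌈q ^ 17⌉₊ = R + 1 :=
    Nat.exists_eq_succ_of_ne_zero (Nat.ceil_pos.2 (by positivity)).ne'
  set m : ℕ := R + 1 with hmR
  have hm : q ^ 17 ≤ m := hR ▸ Nat.le_ceil _
  have hq17 : 1 ≤ q ^ 17 := one_le_pow₀ (by linarith)
  have hm2 : (m : ℝ) ≤ 2 * q ^ 17 := by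
    have := Nat.ceil_lt_add_one (show 0 ≤ q ^ 17 by positivity)
    rw [hR] at this
    linarith
  have hm1 : (1 : ℝ) ≤ m := hq17.trans hm
  have hmk : m + 2 ≤ k := by
    have h9 : (2 : ℝ) ^ 9 ≤ q ^ 9 := by gcongr
    have h : (m : ℝ) + 2 ≤ k := by
      rw [hk, show q ^ 26 = q ^ 9 * q ^ 17 by ring]
      calc (m : ℝ) + 2 ≤ 2 ^ 9 * q ^ 17 := by linarith
        _ ≤ _ := by gcongr
    exact_mod_cast h
  set δ : ℝ := 1 / q ^ 4 with hδ
  have hδ0 : 0 < δ := by positivity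
  have hδq : (4 * lossConst + 6) * δ ≤ 1 := by
    rw [hδ, mul_one_div, div_le_one (by positivity)]
    exact hq.trans (le_self_pow₀ (by linarith) (by norm_num))
  have hkδ : 1 / (k : ℝ) ≤ δ := by
    rw [hk, hδ]
    exact one_div_le_one_div_of_le (by positivity) (pow_le_pow_right₀ (by linarith) (by norm_num))
  set h : ℝ := lossConst * δ with hh
  have hh0 : 0 ≤ h := by positivity
  have hh4 : h ≤ 1 / 4 := by linarith
  have hη : rowLoss k m δ ≤ h := rowLoss_le (by linarith) hk hm hm2
  have hδ7 : δ ≤ 1 / 7 := by nlinarith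
  have hεk : ε * (4 * k) ≤ 1 := by rwa [le_div_iff₀ (by positivity)] at hε
  have hε4 : ε ≤ 1 / 4 := by nlinarith
  have hεδ : ε ≤ δ := by
    refine hε.trans (le_trans ?_ hkδ)
    exact one_div_le_one_div_of_le hk0' (by linarith)
  set B : ℝ := 4 * (m * k) * ((1 - h) * (1 - ε)) ^ 2 / ε ^ 2 with hB
  have hεB : ε ^ 2 * B = 4 * (m * k) * ((1 - h) * (1 - ε)) ^ 2 := by
    rw [hB]; field_simp
  have hprod : 1 / 2 ≤ (1 - h) * (1 - ε) := by nlinarith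
  have hBge : 16 * (m * (k : ℝ) ^ 3) ≤ B := by
    rw [hB, le_div_iff₀ (by positivity)]
    have e1 : (1 / 2 : ℝ) ^ 2 ≤ ((1 - h) * (1 - ε)) ^ 2 := by gcongr
    have e2 : (ε * (4 * k)) ^ 2 ≤ 1 := pow_le_one₀ (by positivity) hεk
    calc 16 * (m * (k : ℝ) ^ 3) * ε ^ 2 = (m : ℝ) * k * (ε * (4 * k)) ^ 2 := by ring
      _ ≤ (m : ℝ) * k * 1 := by gcongr
      _ = 4 * ((m : ℝ) * k) * (1 / 2) ^ 2 := by ring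
      _ ≤ _ := by gcongr
  have hk3 : (k : ℝ) ≤ k ^ 3 := le_self_pow₀ hk1 (by norm_num)
  have hmk3 : (k : ℝ) ≤ m * k ^ 3 := by nlinarith [pow_pos hk0' 3]
  have hB0 : 0 < B := by linarith
  set J : ℕ := ⌊B⌋₊ with hJ
  have hJB : (J : ℝ) ≤ B := Nat.floor_le hB0.le
  have hJB' : B < J + 1 := Nat.lt_floor_add_one _
  have hJge : 4 * (m * k ^ 3) ≤ J := Nat.le_floor (by push_cast; linarith)
  have hJ1 : 1 ≤ J := Nat.le_floor (by push_cast; linarith)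
  have hJ1' : (1 : ℝ) ≤ J := by exact_mod_cast hJ1
  set S : ℝ := √(m * J / k) with hS
  have hS0 : 0 ≤ S := Real.sqrt_nonneg _
  have hSsq : S ^ 2 = m * J / k := Real.sq_sqrt (by positivity)
  have h1 := gamma_lower_rowAvg hk0 R J (by omega) ((J : ℝ) / k + 2 * S * (1 - h))
    (by have : 0 ≤ 2 * S * (1 - h) := mul_nonneg (by positivity) (by linarith)
        positivity) (fun n hn => ?_) hε0.le (by linarith) ?_ hγ
  · refine le_trans ?_ h1
    have hR' : (R : ℝ) + 1 = m := by rw [hmR]; push_cast; ring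
    rw [hR']
    set u : ℝ := (2 * lossConst + 3) * δ with hu
    have hu2 : u ≤ 1 / 2 := by linarith
    have hu0 : 0 ≤ u := by positivity
    have hJ0 : (0 : ℝ) < J := by linarith
    have key : (1 - ε) * k * m / J ≤ (1 / 4) * ε ^ 2 * (1 + 2 * u) := by
      rw [div_le_iff₀ hJ0]
      have e1 : 1 ≤ δ * B := by
        have : 1 ≤ δ * k := by rwa [div_le_iff₀ hk0'] at hkδ
        have : δ * k ≤ δ * B := by gcongr; linarith
        linarith
      have e2 : B * (1 - δ) ≤ J := by linarith
      have e4 : 1 ≤ ((1 - h) * (1 - ε)) ^ 2 * (1 - δ) * (1 + 2 * u) :=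
        one_le_loss_mul hh0 hε0.le hεδ (by rw [hu, hh]; ring) hu2
      calc (1 - ε) * k * m ≤ m * k * 1 := by
            have : 0 ≤ ε * (m * k) := by positivity
            linarith
        _ ≤ m * k * (((1 - h) * (1 - ε)) ^ 2 * (1 - δ) * (1 + 2 * u)) := by gcongr
        _ = (1 / 4) * (ε ^ 2 * B) * (1 - δ) * (1 + 2 * u) := by rw [hεB]; ring
        _ = (1 / 4) * ε ^ 2 * (1 + 2 * u) * (B * (1 - δ)) := by ring
        _ ≤ _ := by gcongr
    have : 2 * u = (4 * lossConst + 6) * δ := by rw [hu]; ring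
    rw [this] at key
    linarith
  · have h2 := rowAvg_row_ge hmk hJge hn hδ0 hδ7
    have h3 : 2 * S * (1 - h) ≤ 2 * S * (1 - rowLoss k m δ) := by gcongr
    linarith
  · have h5 : ε * J ≤ (1 - ε) * (2 * (S * k) * (1 - h)) := by
      have hp : 0 ≤ 2 * ((1 - h) * (1 - ε)) * (S * k) := by
        have : 0 ≤ (1 - h) * (1 - ε) := by linarith
        positivity
      have e : (ε * J) ^ 2 ≤ (2 * ((1 - h) * (1 - ε)) * (S * k)) ^ 2 := by
        calc (ε * J) ^ 2 = ε ^ 2 * J * J := by ring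
          _ ≤ ε ^ 2 * B * J := by gcongr
          _ = (2 * ((1 - h) * (1 - ε))) ^ 2 * (m * J / k * k ^ 2) := by
            rw [hεB]; field_simp; ring
          _ = _ := by rw [← hSsq]; ring
      have := abs_le_of_sq_le_sq e hp
      linarith [le_abs_self (ε * (J : ℝ))]
    have h6 : (1 - ε) * k * (J / k + 2 * S * (1 - h))
        = J - ε * J + (1 - ε) * (2 * (S * k) * (1 - h)) := by
      field_simp
    rw [h6]
    linarith

/-- Uniform constants for finitely many alphabets. -/
lemma exists_gamma_ge_of_lt (K : ℕ) : ∃ c C : ℝ, 0 < c ∧ 0 < C ∧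
    ∀ k : ℕ, 2 ≤ k → k < K → ∀ ε : ℝ, 0 < ε → ε ≤ c / (k * Real.log k) → ∀ γ : ℝ,
      Tendsto (fun n : ℕ => expLCS k n ⌊(1 - ε) * k * n⌋₊ / n) atTop (nhds γ) →
      1 - (1 / 4) * ε ^ 2 * (1 + C * (k : ℝ) ^ (-(2 : ℝ) / 13)) ≤ γ := by
  induction K with
  | zero => exact ⟨1, 1, one_pos, one_pos, fun k _ h => by omega⟩
  | succ K ih =>
    obtain ⟨c, C, hc, hC, H⟩ := ih
    by_cases hK : K < 2
    · exact ⟨c, C, hc, hC, fun k hk hkK => by omega⟩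
    push Not at hK
    obtain ⟨e, D, he, hD, HK⟩ := exists_gamma_ge hK
    have hK0 : (0 : ℝ) < K := by exact_mod_cast (by omega : 0 < K)
    have hlog : 0 < Real.log K := Real.log_pos (by exact_mod_cast (by omega : 1 < K))
    set p : ℝ := (K : ℝ) ^ (-(2 : ℝ) / 13) with hp
    have hp0 : 0 < p := Real.rpow_pos_of_pos hK0 _
    refine ⟨min c (e * (K * Real.log K)), max C (4 * D / p), by positivity,
      lt_max_of_lt_left hC, fun k hk hkK ε hε0 hε γ hγ => ?_⟩
    have hk0 : (0 : ℝ) < k := by exact_mod_cast (by omega : 0 < k)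
    have hlogk : 0 < Real.log k := Real.log_pos (by exact_mod_cast (by omega : 1 < k))
    rcases (Nat.lt_succ_iff.1 hkK).lt_or_eq with h | rfl
    · refine le_trans ?_ (H k hk h ε hε0 (hε.trans (by gcongr; exact min_le_left _ _)) γ hγ)
      gcongr
      exact le_max_left _ _
    · have h1 : ε ≤ e := by
        refine hε.trans ?_
        rw [div_le_iff₀ (by positivity)]
        exact min_le_right _ _
      refine le_trans ?_ (HK ε hε0 h1 γ hγ)
      have h2 : 4 * D ≤ max C (4 * D / p) * p := by
        rw [← div_le_iff₀ hp0]
        exact le_max_right _ _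
      have h3 := mul_le_mul_of_nonneg_right h2 (sq_nonneg ε)
      rw [← hp]
      generalize max C (4 * D / p) = M at h3 ⊢
      linarith [sq_nonneg ε]

/-- There exist absolute constants `c, C > 0` such that for every integer
`k ≥ 2` and every real `ε` with `0 < ε ≤ c/(k log k)`, the constant
`γ_{k,ε} = lim_{n → ∞} (1/n) E[LCS(w, w')]` (with `w ~ [k]^n`, `w' ~ [k]^{⌊(1-ε)kn⌋}`)
satisfies `γ_{k,ε} ≥ 1 - (1/4) ε² (1 + C k^{-2/13})`. -/
theorem stmt1 :
    ∃ c C : ℝ, 0 < c ∧ 0 < C ∧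
      ∀ (k : ℕ), 2 ≤ k → ∀ ε : ℝ, 0 < ε → ε ≤ c / (k * Real.log k) →
        ∀ γ : ℝ,
          Tendsto (fun n : ℕ => expLCS k n ⌊(1 - ε) * k * n⌋₊ / n) atTop (nhds γ) →
          1 - (1 / 4) * ε ^ 2 * (1 + C * (k : ℝ) ^ (-(2 : ℝ) / 13)) ≤ γ := by
  have hL := lossConst_ge
  set Q : ℝ := 4 * lossConst + 6 with hQ
  have hQ0 : 0 < Q := by linarith
  obtain ⟨c, C, hc, hC, H⟩ := exists_gamma_ge_of_lt ⌈Q ^ 26⌉₊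
  have hlog2 : 0 < Real.log 2 := Real.log_pos (by norm_num)
  refine ⟨min c (Real.log 2 / 4), max C Q, by positivity, lt_max_of_lt_left hC,
    fun k hk ε hε0 hε γ hγ => ?_⟩
  have hk2 : (2 : ℝ) ≤ k := by exact_mod_cast hk
  have hk0 : (0 : ℝ) < k := by linarith
  have hlogk : Real.log 2 ≤ Real.log k := Real.log_le_log (by norm_num) hk2
  have hlogk0 : 0 < Real.log k := hlog2.trans_le hlogk
  rcases lt_or_ge k ⌈Q ^ 26⌉₊ with h | h
  · refine le_trans ?_ (H k hk h ε hε0 (hε.trans (by gcongr; exact min_le_left _ _)) γ hγ)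
    gcongr
    exact le_max_left _ _
  · have hkq : (k : ℝ) = ((k : ℝ) ^ (1 / 26 : ℝ)) ^ 26 := by
      rw [← Real.rpow_natCast, ← Real.rpow_mul hk0.le]
      norm_num
    have hq : Q ≤ (k : ℝ) ^ (1 / 26 : ℝ) := by
      have h1 : Q ^ 26 ≤ ((k : ℝ) ^ (1 / 26 : ℝ)) ^ 26 := by
        rw [← hkq]
        exact (Nat.le_ceil _).trans (by exact_mod_cast h)
      exact le_of_pow_le_pow_left₀ (by norm_num) (by positivity) h1
    have hε4 : ε ≤ 1 / (4 * k) := by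
      refine hε.trans ?_
      rw [div_le_div_iff₀ (by positivity) (by positivity)]
      have h1 : min c (Real.log 2 / 4) ≤ Real.log k / 4 := (min_le_right _ _).trans (by linarith)
      calc min c (Real.log 2 / 4) * (4 * k) ≤ Real.log k / 4 * (4 * k) := by gcongr
        _ = _ := by ring
    refine le_trans ?_ (gamma_ge_of_large hkq hq hε0 hε4 hγ)
    have hp : 1 / ((k : ℝ) ^ (1 / 26 : ℝ)) ^ 4 = (k : ℝ) ^ (-(2 : ℝ) / 13) := by
      rw [← Real.rpow_natCast, ← Real.rpow_mul hk0.le, one_div, ← Real.rpow_neg hk0.le]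
      norm_num
    rw [hp]
    gcongr
    exact le_max_right _ _
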